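/- (S-arithmetic analogue of Schmidt's counting theorem, second assertion) Assume d = m + n ≥ 3. Let ψ = (ψ_p)_{p∈S} be a collection of approximating functions, N ∈ ℕ_S, v_d ∈ ℤ_S^d, and fix δ ∈ (2/3, 1). Then for almost every g ∈ SL_d(ℚ_S) (with respect to Haar measure) there exist C > 0 (allowed to depend on N) and T_0 such that for all T ⪰ T_0, |#(g(Nℤ_S^d + v_d) ∩ E_ψ(T)) − (1/N^d)·vol(E_ψ(T))| ≤ C · vol(E_ψ(T))^{δ}. -/

import Mathlib

open MeasureTheory Matrix

noncomputable section

/-- `z` belongs to the ring of `S`-integers `ℤ_S = ℤ[1/P]`,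
where `P` is the product of the finite primes in `S`. -/
def IsZS (P : ℕ) (z : ℚ) : Prop := ∃ (a : ℤ) (k : ℕ), z = (a : ℚ) / (P : ℚ) ^ k

/-- A collection of approximating functions `ψ = (ψ_p)_{p ∈ S}`:
each `ψ_p : ℝ_{>0} → ℝ_{>0}` is non-increasing and `≡ 1` on `(0,1]`
(we extend by `1` on `t ≤ 1`); moreover for each finite place `p`,
`ψ_p` is constant on `{p^{kn}, …, p^{kn+n-1}}` for every `k ∈ ℤ` and
takes values in `p^{mℤ}` on `p^ℤ`. -/
structure ApproxFamily (m n s : ℕ) (p : Fin s → ℕ) : Type where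
  psiR : ℝ → ℝ
  psiP : Fin s → ℝ → ℝ
  posR : ∀ t, 0 < psiR t
  antiR : ∀ ⦃t₁ t₂ : ℝ⦄, 0 < t₁ → t₁ ≤ t₂ → psiR t₂ ≤ psiR t₁
  oneR : ∀ ⦃t : ℝ⦄, t ≤ 1 → psiR t = 1
  posP : ∀ i t, 0 < psiP i t
  antiP : ∀ i ⦃t₁ t₂ : ℝ⦄, 0 < t₁ → t₁ ≤ t₂ → psiP i t₂ ≤ psiP i t₁
  oneP : ∀ i ⦃t : ℝ⦄, t ≤ 1 → psiP i t = 1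
  constP : ∀ i (k : ℤ) (j : ℕ), j < n →
    psiP i ((p i : ℝ) ^ (k * n + j : ℤ)) = psiP i ((p i : ℝ) ^ (k * n : ℤ))
  valsP : ∀ i (k : ℤ), ∃ l : ℤ, psiP i ((p i : ℝ) ^ k) = (p i : ℝ) ^ (m * l : ℤ)

/-- The real components of the diagonal embedding of a rational vector. -/
def ratR {k : ℕ} (q : Fin k → ℚ) : Fin k → ℝ := fun j => (q j : ℝ)

/-- The `p i`-adic components of the diagonal embedding of a rational vector. -/
def ratP {s : ℕ} (p : Fin s → ℕ) [∀ i, Fact (p i).Prime] {k : ℕ} (i : Fin s)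
    (q : Fin k → ℚ) : Fin k → ℚ_[p i] := fun j => (q j : ℚ_[p i])

/-- The region `E_f(T) ⊆ ℚ_S^m × ℚ_S^n` cut out by `‖x‖_p^m ≤ f_p(‖y‖_p^n)` and
`‖y‖_p^n ≤ T_p` for all `p ∈ S` (product coordinates). -/
def Eprod (m n : ℕ) {s : ℕ} (p : Fin s → ℕ) [∀ i, Fact (p i).Prime]
    (fR : ℝ → ℝ) (fP : Fin s → ℝ → ℝ) (TR : ℝ) (TP : Fin s → ℝ) :
    Set (((Fin m → ℝ) × ∀ i, Fin m → ℚ_[p i]) × ((Fin n → ℝ) × ∀ i, Fin n → ℚ_[p i])) :=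
  {xy | ‖xy.1.1‖ ^ m ≤ fR (‖xy.2.1‖ ^ n) ∧ ‖xy.2.1‖ ^ n ≤ TR ∧
      ∀ i, ‖xy.1.2 i‖ ^ m ≤ fP i (‖xy.2.2 i‖ ^ n) ∧ ‖xy.2.2 i‖ ^ n ≤ TP i}

/-- The region `E_f(T) ⊆ ℚ_S^{m+n}`, where the first `m` coordinates play the role of
`x` and the last `n` coordinates the role of `y`. -/
def Efull (m n : ℕ) {s : ℕ} (p : Fin s → ℕ) [∀ i, Fact (p i).Prime]
    (fR : ℝ → ℝ) (fP : Fin s → ℝ → ℝ) (TR : ℝ) (TP : Fin s → ℝ) :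
    Set ((Fin (m + n) → ℝ) × ∀ i, Fin (m + n) → ℚ_[p i]) :=
  {v | ‖fun a : Fin m => v.1 (Fin.castAdd n a)‖ ^ m
        ≤ fR (‖fun b : Fin n => v.1 (Fin.natAdd m b)‖ ^ n) ∧
      ‖fun b : Fin n => v.1 (Fin.natAdd m b)‖ ^ n ≤ TR ∧
      ∀ i, ‖fun a : Fin m => v.2 i (Fin.castAdd n a)‖ ^ m
            ≤ fP i (‖fun b : Fin n => v.2 i (Fin.natAdd m b)‖ ^ n) ∧
          ‖fun b : Fin n => v.2 i (Fin.natAdd m b)‖ ^ n ≤ TP i}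

/-- The operator norm of a real matrix acting on sup-normed spaces. -/
def opNorm {k l : ℕ} (M : Matrix (Fin k) (Fin l) ℝ) : ℝ :=
  ‖LinearMap.toContinuousLinearMap M.mulVecLin‖

/-- An element of the group `𝐇 = ∏_{p ∈ S} H_p` of block lower-triangular matrices,
given by its blocks at each place. -/
structure HElem (m n : ℕ) (s : ℕ) (p : Fin s → ℕ) [∀ i, Fact (p i).Prime] : Type where
  aR : Matrix (Fin m) (Fin m) ℝ
  bR : Matrix (Fin n) (Fin m) ℝ
  cR : Matrix (Fin n) (Fin n) ℝ
  aP : ∀ i, Matrix (Fin m) (Fin m) ℚ_[p i]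
  bP : ∀ i, Matrix (Fin n) (Fin m) ℚ_[p i]
  cP : ∀ i, Matrix (Fin n) (Fin n) ℚ_[p i]

/-- The action of an element of `𝐇` on `ℚ_S^m × ℚ_S^n`:
`h·(x, y) = (α x, β x + γ y)` at each place. -/
def HElem.act {m n s : ℕ} {p : Fin s → ℕ} [∀ i, Fact (p i).Prime] (h : HElem m n s p)
    (xy : ((Fin m → ℝ) × ∀ i, Fin m → ℚ_[p i]) × ((Fin n → ℝ) × ∀ i, Fin n → ℚ_[p i])) :
    ((Fin m → ℝ) × ∀ i, Fin m → ℚ_[p i]) × ((Fin n → ℝ) × ∀ i, Fin n → ℚ_[p i]) :=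
  ((h.aR.mulVec xy.1.1, fun i => (h.aP i).mulVec (xy.1.2 i)),
   (h.bR.mulVec xy.1.1 + h.cR.mulVec xy.2.1,
    fun i => (h.bP i).mulVec (xy.1.2 i) + (h.cP i).mulVec (xy.2.2 i)))

/-- Membership in `H̃_{∞,ε}`: operator norm bounds on the blocks. -/
def inHtilde (m n : ℕ) (ε : ℝ) (α : Matrix (Fin m) (Fin m) ℝ) (β : Matrix (Fin n) (Fin m) ℝ)
    (γ : Matrix (Fin n) (Fin n) ℝ) : Prop :=
  opNorm α ^ m ≤ 1 + ε ∧ opNorm γ ^ n ≤ 1 + ε / 2 ∧ opNorm β ≤ ε / (4 * n)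

/-- `h ∈ (H̃_{∞,ε} ∩ H̃_{∞,ε}⁻¹) × ∏_{p ∈ S_f} H_p(ℤ_p)`. -/
def HElem.isAdmissible {m n s : ℕ} {p : Fin s → ℕ} [∀ i, Fact (p i).Prime]
    (h : HElem m n s p) (ε : ℝ) : Prop :=
  IsUnit h.aR.det ∧ IsUnit h.cR.det ∧
  inHtilde m n ε h.aR h.bR h.cR ∧
  inHtilde m n ε h.aR⁻¹ (-(h.cR⁻¹ * h.bR * h.aR⁻¹)) h.cR⁻¹ ∧
  ∀ i, ((∀ a b, ‖h.aP i a b‖ ≤ 1) ∧ ‖(h.aP i).det‖ = 1) ∧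
      ((∀ a b, ‖h.cP i a b‖ ≤ 1) ∧ ‖(h.cP i).det‖ = 1) ∧
      (∀ a b, ‖h.bP i a b‖ ≤ 1)

end

noncomputable section

/-- The number of points of the image under `g ∈ SL_{m+n}(ℚ_S)` of the set of
rational vectors in `L` (diagonally embedded into `ℚ_S^{m+n}`) lying in `E`. -/
def gridCount (m n : ℕ) {s : ℕ} (p : Fin s → ℕ) [∀ i, Fact (p i).Prime]
    (g : (SpecialLinearGroup (Fin (m + n)) ℝ) ×
      ∀ i, SpecialLinearGroup (Fin (m + n)) ℚ_[p i])
    (L : Set (Fin (m + n) → ℚ))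
    (E : Set ((Fin (m + n) → ℝ) × ∀ i, Fin (m + n) → ℚ_[p i])) : ℕ :=
  Set.ncard {w : Fin (m + n) → ℚ | w ∈ L ∧
    (((g.1 : Matrix (Fin (m + n)) (Fin (m + n)) ℝ).mulVec (ratR w),
      fun i => ((g.2 i : Matrix (Fin (m + n)) (Fin (m + n)) ℚ_[p i]).mulVec (ratP p i w)))
      ∈ E)}

section Auxiliary

set_option linter.unusedSectionVars false

open scoped ENNReal

/-- `T` is a measurable set of representatives of `X` modulo the image of `j`. -/
structure IsTile {L X : Type*} [AddCommGroup L] [AddCommGroup X] [MeasurableSpace X]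
    (j : L →+ X) (T : Set X) : Prop where
  measurableSet : MeasurableSet T
  existsUnique : ∀ x, ∃! a, x + j a ∈ T

section Tile

variable {L X : Type*} [AddCommGroup L] [AddCommGroup X] [MeasureSpace X] {j : L →+ X} {T : Set X}

lemma IsTile.tsum_eq_one (hT : IsTile j T) (x : X) :
    ∑' a, T.indicator (1 : X → ℝ≥0∞) (x + j a) = 1 := by
  obtain ⟨a, ha, hu⟩ := hT.existsUnique x
  rw [tsum_eq_single a]
  · simp [Set.indicator_of_mem ha]
  · intro b hb
    exact Set.indicator_of_notMem (fun h => hb (hu b h)) _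

variable [Countable L] [MeasurableAdd X] [(volume : Measure X).IsAddLeftInvariant]

/-- Unfolding an integral over the whole space along a tile. -/
lemma IsTile.lintegral_unfold (hT : IsTile j T) {h : X → ℝ≥0∞} (hh : Measurable h) :
    ∫⁻ x, T.indicator 1 x * ∑' a, h (x + j a) = ∫⁻ x, h x := by
  have hTm : Measurable (T.indicator (1 : X → ℝ≥0∞)) := measurable_one.indicator hT.measurableSet
  simp_rw [← ENNReal.tsum_mul_left]
  rw [lintegral_tsum (fun a => by fun_prop)]
  have : ∀ a, ∫⁻ x, T.indicator 1 x * h (x + j a) = ∫⁻ x, T.indicator 1 (x + j (-a)) * h x := by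
    intro a
    rw [← lintegral_add_right_eq_self (fun x => T.indicator 1 (x + j (-a)) * h x) (j a)]
    simp
  simp_rw [this]
  rw [← lintegral_tsum (fun a => by fun_prop)]
  congr 1 with x
  rw [ENNReal.tsum_mul_right]
  have := (Equiv.neg L).tsum_eq (fun a => T.indicator (1 : X → ℝ≥0∞) (x + j a))
  simp only [Equiv.neg_apply] at this
  rw [this, hT.tsum_eq_one, one_mul]

/-- A periodic function has the same integral over any two tiles. -/
lemma IsTile.lintegral_indicator_mul_eq (hT : IsTile j T) {T' : Set X} (hT' : IsTile j T')
    {F : X → ℝ≥0∞} (hF : Measurable F) (hper : ∀ a x, F (x + j a) = F x) :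
    ∫⁻ x, T.indicator 1 x * F x = ∫⁻ x, T'.indicator 1 x * F x := by
  have hTm : Measurable (T'.indicator (1 : X → ℝ≥0∞)) := measurable_one.indicator hT'.measurableSet
  rw [← hT.lintegral_unfold (h := fun x => T'.indicator 1 x * F x) (by fun_prop)]
  congr 1 with x
  simp_rw [hper]
  rw [ENNReal.tsum_mul_right, hT'.tsum_eq_one, one_mul]

lemma IsTile.translate (hT : IsTile j T) (c : X) : IsTile j {x | x + c ∈ T} where
  measurableSet := hT.measurableSet.preimage (measurable_add_const c)
  existsUnique x := by
    obtain ⟨a, ha, hu⟩ := hT.existsUnique (x + c)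
    refine ⟨a, ?_, fun b hb => hu b ?_⟩
    · simpa [add_right_comm] using ha
    · simpa [add_right_comm] using hb

lemma IsTile.lintegral_translate (hT : IsTile j T)
    {F : X → ℝ≥0∞} (hF : Measurable F) (hper : ∀ a x, F (x + j a) = F x) (c : X) :
    ∫⁻ x, T.indicator 1 x * F (x + c) = ∫⁻ x, T.indicator 1 x * F x := by
  rw [hT.lintegral_indicator_mul_eq (hT.translate (-c)) hF hper]
  rw [← lintegral_add_right_eq_self (fun x => {x | x + -c ∈ T}.indicator 1 x * F x) c]
  congr 1 with x
  have hx : x + c ∈ {x | x + -c ∈ T} ↔ x ∈ T := by simp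
  congr 1
  by_cases h : x ∈ T
  · rw [Set.indicator_of_mem h, Set.indicator_of_mem (hx.2 h)]; rfl
  · rw [Set.indicator_of_notMem h, Set.indicator_of_notMem (mt hx.1 h)]

/-- Averaging a periodization along a surjective homomorphism that respects the lattices. -/
lemma IsTile.lintegral_hom {L' Y : Type*} [AddCommGroup L'] [AddCommGroup Y] [MeasureSpace Y]
    [Countable L'] [MeasurableAdd₂ Y] [(volume : Measure Y).IsAddLeftInvariant]
    [SigmaFinite (volume : Measure X)] [SigmaFinite (volume : Measure Y)]
    {j' : L' →+ Y} {T' : Set Y}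
    (hT : IsTile j T) (hT' : IsTile j' T') (h1 : volume T = 1) (h1' : volume T' = 1)
    (A : X →+ Y) (hA : Measurable A) (hsurj : Function.Surjective A)
    (hlat : ∀ a, ∃ b, A (j a) = j' b) {h : Y → ℝ≥0∞} (hh : Measurable h) :
    ∫⁻ x, T.indicator 1 x * ∑' b, h (A x + j' b) = ∫⁻ y, h y := by
  set F : Y → ℝ≥0∞ := fun y => ∑' b, h (y + j' b) with hFdef
  have hF : Measurable F := Measurable.tsum fun b => hh.comp (measurable_add_const _)
  have hper : ∀ b y, F (y + j' b) = F y := by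
    intro b y
    simp only [hFdef, add_assoc, ← map_add]
    exact (Equiv.addLeft b).tsum_eq (fun b => h (y + j' b))
  have hTm : Measurable (T.indicator (1 : X → ℝ≥0∞)) := measurable_one.indicator hT.measurableSet
  have hTm' : Measurable (T'.indicator (1 : Y → ℝ≥0∞)) := measurable_one.indicator hT'.measurableSet
  have iT : ∫⁻ x, T.indicator (1 : X → ℝ≥0∞) x = 1 := by
    rw [lintegral_indicator_one hT.measurableSet, h1]
  have iT' : ∫⁻ x, T'.indicator (1 : Y → ℝ≥0∞) x = 1 := by
    rw [lintegral_indicator_one hT'.measurableSet, h1']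
  have hJ : ∀ c, ∫⁻ x, T.indicator 1 x * F (A x + c) = ∫⁻ x, T.indicator 1 x * F (A x) := by
    intro c
    obtain ⟨r, rfl⟩ := hsurj c
    simp_rw [← map_add]
    refine hT.lintegral_translate (F := fun x => F (A x)) (hF.comp hA) ?_ r
    intro a x
    obtain ⟨b, hb⟩ := hlat a
    simp only [map_add, hb, hper]
  calc ∫⁻ x, T.indicator 1 x * F (A x)
      = ∫⁻ c, T'.indicator 1 c * ∫⁻ x, T.indicator 1 x * F (A x + c) := by
        simp_rw [hJ]
        rw [lintegral_mul_const _ hTm', iT', one_mul]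
    _ = ∫⁻ c, ∫⁻ x, T.indicator 1 x * (T'.indicator 1 c * F (c + A x)) := by
        congr 1 with c
        rw [← lintegral_const_mul _ (by fun_prop)]
        congr 1 with x
        rw [add_comm, mul_left_comm]
    _ = ∫⁻ x, ∫⁻ c, T.indicator 1 x * (T'.indicator 1 c * F (c + A x)) := by
        refine lintegral_lintegral_swap (Measurable.aemeasurable ?_)
        exact (hTm.comp measurable_snd).mul ((hTm'.comp measurable_fst).mul
          (hF.comp (measurable_fst.add (hA.comp measurable_snd))))
    _ = ∫⁻ x, T.indicator 1 x * ∫⁻ y, h y := by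
        congr 1 with x
        rw [lintegral_const_mul _ (by fun_prop),
          hT'.lintegral_translate hF hper, hT'.lintegral_unfold hh]
    _ = ∫⁻ y, h y := by rw [lintegral_mul_const _ hTm, iT, one_mul]

end Tile

section Pi

lemma IsTile.pi {κ L X : Type*} [Fintype κ] [AddCommGroup L] [AddCommGroup X] [MeasureSpace X]
    {j : L →+ X} {T : Set X} (hT : IsTile j T) :
    IsTile (j.compLeft κ) (Set.univ.pi fun _ => T) where
  measurableSet := MeasurableSet.univ_pi fun _ => hT.measurableSet
  existsUnique x := by
    choose a ha hu using fun k => hT.existsUnique (x k)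
    refine ⟨a, fun k _ => ha k, fun b hb => ?_⟩
    funext k
    exact hu k _ (hb k (Set.mem_univ k))

lemma lintegral_fin_succ {X : Type*} [MeasureSpace X] [SigmaFinite (volume : Measure X)] {n : ℕ}
    {h : (Fin (n + 1) → X) → ℝ≥0∞} (hh : Measurable h) :
    ∫⁻ v, h v = ∫⁻ x, ∫⁻ v', h (Fin.cons x v') := by
  have := (volume_preserving_piFinSuccAbove (fun _ : Fin (n + 1) => X) 0).symm
  rw [← this.lintegral_comp hh, Measure.volume_eq_prod, lintegral_prod]
  · simp [MeasurableEquiv.piFinSuccAbove, Fin.insertNthEquiv]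
  · exact (hh.comp (MeasurableEquiv.measurable _)).aemeasurable

lemma measurable_fin_cons {X Z : Type*} [MeasurableSpace X] [MeasurableSpace Z] {n : ℕ}
    {f : Z → X} {g : Z → Fin n → X} (hf : Measurable f) (hg : Measurable g) :
    Measurable fun z => (Fin.cons (f z) (g z) : Fin (n + 1) → X) := by
  refine measurable_pi_lambda _ fun i => ?_
  refine Fin.cases ?_ (fun i => ?_) i
  · simpa using hf
  · simpa using hg.eval

end Pi

/-- The entries of a matrix in `SL_k(Λ)`. -/
def ent {Λ : Type*} [CommRing Λ] {k : ℕ} (γ : SpecialLinearGroup (Fin k) Λ) : Fin k → Fin k → Λ :=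
  fun i j => γ i j

/-- The right action of `SL_k(Λ)` on row vectors. -/
def rmul {Λ : Type*} [CommRing Λ] {k : ℕ} (w : Fin k → Λ) (γ : SpecialLinearGroup (Fin k) Λ) :
    Fin k → Λ := fun j => ∑ i, w i * ent γ i j

section Entries

variable {Λ : Type*} [CommRing Λ] {k : ℕ}

lemma ent_injective : Function.Injective (ent : SpecialLinearGroup (Fin k) Λ → _) :=
  fun _ _ h => Matrix.SpecialLinearGroup.ext _ _ fun i j => congrFun (congrFun h i) j

lemma ent_mul (γ' γ : SpecialLinearGroup (Fin k) Λ) (i : Fin k) :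
    ent (γ' * γ) i = rmul (ent γ' i) γ := by
  funext j
  simp [ent, rmul, Matrix.mul_apply]

lemma rmul_mul (w : Fin k → Λ) (γ' γ : SpecialLinearGroup (Fin k) Λ) :
    rmul (rmul w γ') γ = rmul w (γ' * γ) := by
  funext j
  simp only [rmul, ent_mul, Finset.sum_mul, Finset.mul_sum]
  rw [Finset.sum_comm]
  simp only [mul_assoc]

lemma rmul_one (w : Fin k → Λ) : rmul w 1 = w := by
  funext j
  simp [rmul, ent, Matrix.one_apply]

/-- The right action of an element of `SL_k(Λ)` as a permutation of `Λ^k`. -/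
def rmulEquiv (γ : SpecialLinearGroup (Fin k) Λ) : (Fin k → Λ) ≃ (Fin k → Λ) where
  toFun w := rmul w γ
  invFun w := rmul w γ⁻¹
  left_inv w := by simp [rmul_mul, rmul_one]
  right_inv w := by simp [rmul_mul, rmul_one]

instance [Countable Λ] : Countable (SpecialLinearGroup (Fin k) Λ) :=
  ent_injective.countable

end Entries

/-- The set of first rows of matrices in `SL_{d+1}(Λ)`. -/
def firstRows (Λ : Type*) [CommRing Λ] (d : ℕ) : Set (Fin (d + 1) → Λ) :=
  {u | ∃ γ : SpecialLinearGroup (Fin (d + 1)) Λ, ent γ 0 = u}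

/-- A countable domain `Λ` embedded as a lattice in a ring `R` with an invariant measure,
with the data needed to integrate over matrices modulo `SL_d(Λ)`. -/
structure LatticeRing (Λ R : Type*) [CommRing Λ] [CommRing R] [MeasureSpace R] where
  emb : Λ →+* R
  tile : Set R
  isTile : IsTile emb.toAddMonoidHom tile
  volume_tile : volume tile = 1
  isUnit_emb : ∀ a, a ≠ 0 → IsUnit (emb a)
  ae_isUnit : ∀ᵐ x : R, IsUnit x
  measurable_inv : Measurable (Ring.inverse : R → R)
  cmod : R → ℝ≥0∞
  measurable_cmod : Measurable cmod
  cmod_ne_zero : ∀ a, IsUnit a → cmod a ≠ 0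
  cmod_ne_top : ∀ a, cmod a ≠ ∞
  lintegral_mul : ∀ a, IsUnit a → ∀ h : R → ℝ≥0∞, Measurable h →
    cmod a * ∫⁻ x, h (a * x) = ∫⁻ x, h x
  shell : Set R
  measurableSet_shell : MeasurableSet shell
  isUnit_of_mem_shell : ∀ a ∈ shell, IsUnit a
  volume_shell : volume shell ≠ ∞
  cmod_le : ∃ C : ℝ≥0∞, C ≠ ∞ ∧ ∀ a ∈ shell, cmod a ≤ C
  reps : Set Λ
  zero_notMem_reps : (0 : Λ) ∉ reps
  existsUnique_reps : ∀ (d : ℕ) (w : Fin (d + 2) → Λ), w ≠ 0 →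
    ∃! ku : reps × firstRows Λ (d + 1), w = fun i => (ku.1 : Λ) * (ku.2 : Fin (d + 2) → Λ) i
  tsum_reps : ∀ j, 2 ≤ j → ∑' k : reps, ((cmod (emb k))⁻¹) ^ j ≠ ∞
  cmod_mul : ∀ a b, cmod (a * b) = cmod a * cmod b
  exists_exhaustion : ∀ d, ∃ U : ℕ → Set (Fin (d + 1) → R), (∀ l, MeasurableSet (U l)) ∧
    (∀ l, volume (U l) ≠ 0) ∧ (∀ l, volume (U l) ≠ ∞) ∧
    Filter.Tendsto (fun l => volume (U l)) Filter.atTop (nhds ∞) ∧ (∀ x, ∃ l, x ∈ U l) ∧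
    ∀ M : Fin (d + 1) → Fin (d + 1) → R, IsUnit (Matrix.det (Matrix.of M)) →
      ∀ z : Fin (d + 1) → R, (∀ l, ∑' w : Fin (d + 1) → Λ,
        (U l).indicator (1 : (Fin (d + 1) → R) → ℝ≥0∞) (fun j => z j + ∑ i, emb (w i) * M i j) ≠ ∞) ∧
      Filter.Tendsto (fun l => (∑' w : Fin (d + 1) → Λ,
        (U l).indicator (1 : (Fin (d + 1) → R) → ℝ≥0∞) (fun j => z j + ∑ i, emb (w i) * M i j)) / volume (U l))
        Filter.atTop (nhds (cmod (Matrix.det (Matrix.of M)))⁻¹)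

namespace LatticeRing

variable {Λ R : Type*} [CommRing Λ] [CommRing R] [MeasureSpace R] (D : LatticeRing Λ R)

/-- The row vector `w • M`. -/
def comb {k n : ℕ} (w : Fin k → Λ) (M : Fin k → Fin n → R) : Fin n → R :=
  fun j => ∑ i, D.emb (w i) * M i j

/-- The matrix product `γ * M`. -/
def act {k l n : ℕ} (γ : Fin l → Fin k → Λ) (M : Fin k → Fin n → R) : Fin l → Fin n → R :=
  fun i => D.comb (γ i) M

/-- Scaling of the first coordinate. -/
def sc {e : ℕ} (c : R) (v : Fin (e + 1) → R) : Fin (e + 1) → R :=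
  Fin.cons (c * v 0) (Fin.tail v)

/-- The product of the row `(c, v)` with a unipotent-by-diagonal matrix of determinant one
whose first row is `x`. -/
def st {e : ℕ} (x : Fin (e + 2) → R) (c : R) (v : Fin (e + 1) → R) : Fin (e + 2) → R :=
  fun j => c * x j + (Fin.cons 0 (sc (Ring.inverse (x 0)) v) : Fin (e + 2) → R) j

/-- Inverse of `st x`. -/
def unst {e : ℕ} (x y : Fin (e + 2) → R) : R × (Fin (e + 1) → R) :=
  (y 0 * Ring.inverse (x 0),
    sc (x 0) (fun j => y j.succ - y 0 * Ring.inverse (x 0) * x j.succ))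

section Algebra

lemma sc_sc {e : ℕ} (c c' : R) (v : Fin (e + 1) → R) : sc c (sc c' v) = sc (c * c') v := by
  funext j
  refine Fin.cases ?_ (fun i => ?_) j <;> simp [sc, mul_assoc, Fin.tail]

lemma sc_one {e : ℕ} (v : Fin (e + 1) → R) : sc 1 v = v := by
  funext j
  refine Fin.cases ?_ (fun i => ?_) j <;> simp [sc, Fin.tail]

lemma st_unst {e : ℕ} {x : Fin (e + 2) → R} (hx : IsUnit (x 0)) (y : Fin (e + 2) → R) :
    st x (unst x y).1 (unst x y).2 = y := by
  have h := Ring.inverse_mul_cancel _ hx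
  funext j
  refine Fin.cases ?_ (fun i => ?_) j
  · simp [st, unst, mul_assoc, h]
  · simp only [st, unst, sc_sc, h, sc_one, Fin.cons_succ]
    ring

lemma unst_st {e : ℕ} {x : Fin (e + 2) → R} (hx : IsUnit (x 0)) (c : R) (v : Fin (e + 1) → R) :
    unst x (st x c v) = (c, v) := by
  have h := Ring.mul_inverse_cancel _ hx
  have h0 : st x c v 0 * Ring.inverse (x 0) = c := by
    simp [st, mul_assoc, h]
  refine Prod.ext h0 ?_
  simp only [unst, h0]
  simp only [st, Fin.cons_succ, add_sub_cancel_left]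
  change sc (x 0) (sc _ v) = v
  rw [sc_sc, h, sc_one]

lemma st_zero_right {e : ℕ} (x : Fin (e + 2) → R) (c : R) : st x c 0 = fun j => c * x j := by
  funext j
  refine Fin.cases ?_ (fun i => ?_) j
  · simp [st]
  · refine Fin.cases ?_ (fun i => ?_) i <;> simp [st, sc, Fin.tail]

lemma st_sum {e k : ℕ} (x : Fin (e + 2) → R) (a : Fin k → R) (b : Fin k → R)
    (v : Fin k → Fin (e + 1) → R) :
    st x (∑ i, a i * b i) (fun j => ∑ i, a i * v i j) = fun j => ∑ i, a i * st x (b i) (v i) j := by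
  funext j
  simp only [st, mul_add, Finset.sum_add_distrib, Finset.sum_mul, mul_assoc]
  congr 1
  refine Fin.cases ?_ (fun i => ?_) j
  · simp
  · refine Fin.cases ?_ (fun i => ?_) i
    · simp [sc, Finset.mul_sum, mul_left_comm]
    · simp [sc, Fin.tail]

lemma st_add {e : ℕ} (x : Fin (e + 2) → R) (c c' : R) (v : Fin (e + 1) → R) :
    st x (c + c') v = fun j => c * x j + st x c' v j := by
  funext j
  simp only [st]
  ring

lemma comb_act {k l n : ℕ} (w : Fin l → Λ) (γ : Fin l → Fin k → Λ) (M : Fin k → Fin n → R) :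
    D.comb w (D.act γ M) = D.comb (fun j => ∑ i, w i * γ i j) M := by
  funext j
  simp only [comb, act, map_sum, map_mul, Finset.sum_mul, Finset.mul_sum]
  rw [Finset.sum_comm]
  simp only [mul_assoc]

lemma comb_act_ent {k n : ℕ} (w : Fin k → Λ) (γ : SpecialLinearGroup (Fin k) Λ)
    (M : Fin k → Fin n → R) : D.comb w (D.act (ent γ) M) = D.comb (rmul w γ) M :=
  D.comb_act _ _ _

lemma act_act {k n : ℕ} (γ' γ : SpecialLinearGroup (Fin k) Λ) (M : Fin k → Fin n → R) :
    D.act (ent γ') (D.act (ent γ) M) = D.act (ent (γ' * γ)) M := by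
  funext i
  rw [act, comb_act_ent, act, ent_mul]

lemma act_one {k n : ℕ} (M : Fin k → Fin n → R) :
    D.act (ent (1 : SpecialLinearGroup (Fin k) Λ)) M = M := by
  funext i j
  simp [act, comb, ent, Matrix.one_apply]

lemma det_act {k : ℕ} (γ : SpecialLinearGroup (Fin k) Λ) (M : Fin k → Fin k → R) :
    Matrix.det (Matrix.of (D.act (ent γ) M)) = Matrix.det (Matrix.of M) := by
  have : Matrix.of (D.act (ent γ) M) = (Matrix.SpecialLinearGroup.map D.emb γ).1 * Matrix.of M := by
    ext i j
    simp [act, comb, ent, Matrix.mul_apply]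
  rw [this, Matrix.det_mul, (Matrix.SpecialLinearGroup.map D.emb γ).2, one_mul]

end Algebra

section Measure

variable [MeasurableAdd₂ R] [MeasurableMul₂ R] [MeasurableSub₂ R]

@[fun_prop]
lemma measurable_comb {k n : ℕ} (w : Fin k → Λ) :
    Measurable (D.comb w : (Fin k → Fin n → R) → _) := by
  unfold comb
  fun_prop

@[fun_prop]
lemma measurable_act {k l n : ℕ} (γ : Fin l → Fin k → Λ) :
    Measurable (D.act γ : (Fin k → Fin n → R) → _) :=
  measurable_pi_lambda _ fun _ => D.measurable_comb _

lemma measurable_sc {Z : Type*} [MeasurableSpace Z] {e : ℕ} {c : Z → R} {v : Z → Fin (e + 1) → R}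
    (hc : Measurable c) (hv : Measurable v) : Measurable fun z => sc (c z) (v z) := by
  unfold sc Fin.tail
  exact measurable_fin_cons (by fun_prop) (by fun_prop)

lemma measurable_st (D : LatticeRing Λ R) {Z : Type*} [MeasurableSpace Z] {e : ℕ} {x : Z → Fin (e + 2) → R} {c : Z → R}
    {v : Z → Fin (e + 1) → R} (hx : Measurable x) (hc : Measurable c) (hv : Measurable v) :
    Measurable fun z => st (x z) (c z) (v z) := by
  unfold st
  refine measurable_pi_lambda _ fun j => ?_
  refine (hc.mul hx.eval).add ?_
  exact (measurable_fin_cons measurable_const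
    (measurable_sc (D.measurable_inv.comp hx.eval) hv)).eval

lemma measurable_unst (D : LatticeRing Λ R) {Z : Type*} [MeasurableSpace Z] {e : ℕ} {x y : Z → Fin (e + 2) → R}
    (hx : Measurable x) (hy : Measurable y) :
    Measurable fun z => unst (x z) (y z) := by
  unfold unst
  have h := D.measurable_inv.comp (hx.eval (a := 0))
  simp only [Function.comp_def] at h
  exact (by fun_prop : Measurable fun z => y z 0 * Ring.inverse (x z 0)).prodMk
    (measurable_sc (by fun_prop) (by fun_prop))

lemma measurable_det {k : ℕ} : Measurable fun M : Fin k → Fin k → R => (Matrix.of M).det := by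
  simp only [Matrix.det_apply, Matrix.of_apply]
  refine Finset.measurable_sum _ fun σ _ => ?_
  simp only [Units.smul_def, zsmul_eq_mul]
  exact measurable_const.mul (Finset.measurable_prod _ fun i _ => by fun_prop)

variable [SigmaFinite (volume : Measure R)] [(volume : Measure R).IsAddLeftInvariant]

lemma cmod_mul_inverse {a : R} (ha : IsUnit a) : D.cmod a * D.cmod (Ring.inverse a) = 1 := by
  have hT : Measurable (D.tile.indicator (1 : R → ℝ≥0∞)) :=
    measurable_one.indicator D.isTile.measurableSet
  have h1 := D.lintegral_mul a ha (fun x => D.tile.indicator 1 (Ring.inverse a * x)) (by fun_prop)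
  have h2 := D.lintegral_mul _ (ha.ringInverse) _ hT
  simp only [← mul_assoc, Ring.inverse_mul_cancel _ ha, one_mul] at h1
  rw [← h1, ← mul_assoc, lintegral_indicator_one D.isTile.measurableSet, D.volume_tile,
    mul_one, mul_comm] at h2
  exact h2

lemma lintegral_sc {e : ℕ} {c : R} (hc : IsUnit c) {h : (Fin (e + 1) → R) → ℝ≥0∞}
    (hh : Measurable h) : D.cmod c * ∫⁻ v, h (sc c v) = ∫⁻ v, h v := by
  rw [lintegral_fin_succ hh, lintegral_fin_succ (h := fun v => h (sc c v))
    (hh.comp (measurable_sc measurable_const measurable_id))]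
  have := D.lintegral_mul c hc (fun x => ∫⁻ v', h (Fin.cons x v'))
    (Measurable.lintegral_prod_right'
      (f := fun z : R × (Fin e → R) => h (Fin.cons z.1 z.2))
      (hh.comp (measurable_fin_cons measurable_fst measurable_snd)))
  rw [← this]
  rfl

lemma lintegral_smul {a : R} (ha : IsUnit a) {n : ℕ} {h : (Fin n → R) → ℝ≥0∞}
    (hh : Measurable h) : D.cmod a ^ n * ∫⁻ v : Fin n → R, h (fun i => a * v i) = ∫⁻ v, h v := by
  induction n with
  | zero =>
    rw [pow_zero, one_mul]
    refine lintegral_congr fun v => congrArg h (Subsingleton.elim _ _)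
  | succ n ih =>
    rw [lintegral_fin_succ hh,
      lintegral_fin_succ (h := fun v => h (fun i => a * v i)) (hh.comp (by fun_prop))]
    have hm : Measurable fun z : R × (Fin n → R) => h (Fin.cons z.1 z.2) :=
      hh.comp (measurable_fin_cons measurable_fst measurable_snd)
    rw [← D.lintegral_mul a ha _ (Measurable.lintegral_prod_right' hm), pow_succ', mul_assoc]
    congr 1
    rw [← lintegral_const_mul]
    · congr 1 with x
      rw [← ih (h := fun v => h (Fin.cons (a * x) v))
        (hh.comp (measurable_fin_cons measurable_const measurable_id))]
      congr 2 with v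
      congr 1
      funext j
      refine Fin.cases ?_ (fun i => ?_) j <;> simp
    · refine Measurable.lintegral_prod_right'
        (f := fun z : R × (Fin n → R) => h fun i => a * (Fin.cons z.1 z.2 : Fin (n+1) → R) i) ?_
      refine hh.comp (measurable_pi_lambda _ fun j => ?_)
      exact measurable_const.mul (measurable_fin_cons measurable_fst measurable_snd).eval

lemma lintegral_st (D : LatticeRing Λ R) {e : ℕ} {x : Fin (e + 2) → R} (hx : IsUnit (x 0))
    {h : (Fin (e + 2) → R) → ℝ≥0∞} (hh : Measurable h) :
    ∫⁻ c, ∫⁻ v, h (st x c v) = ∫⁻ y, h y := by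
  have hst : ∀ c v, st x c v = (Fin.cons (x 0 * c)
      (sc (Ring.inverse (x 0)) v + fun j => c * x j.succ) : Fin (e + 2) → R) := by
    intro c v
    funext j
    refine Fin.cases ?_ (fun i => ?_) j
    · simp [st, mul_comm]
    · simp [st, add_comm]
  have hm : Measurable fun z : R × (Fin (e + 1) → R) => h (Fin.cons z.1 z.2) :=
    hh.comp (measurable_fin_cons measurable_fst measurable_snd)
  have inner : ∀ c, ∫⁻ v, h (st x c v) = D.cmod (x 0) * ∫⁻ v, h (Fin.cons (x 0 * c) v) := by
    intro c
    have hm2 : Measurable fun v : Fin (e + 1) → R => h (Fin.cons (x 0 * c) v) :=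
      hh.comp (measurable_fin_cons measurable_const measurable_id)
    have h1 := D.lintegral_sc hx.ringInverse
      (h := fun v => h (Fin.cons (x 0 * c) (v + fun j => c * x j.succ)))
      (hm2.comp (measurable_id.add_const _))
    rw [lintegral_add_right_eq_self (fun v => h (Fin.cons (x 0 * c) v))] at h1
    rw [← h1, ← mul_assoc, D.cmod_mul_inverse hx, one_mul]
    simp_rw [hst]
  simp_rw [inner]
  rw [lintegral_const_mul, D.lintegral_mul _ hx _ (Measurable.lintegral_prod_right' hm),
    ← lintegral_fin_succ hh]
  exact (Measurable.lintegral_prod_right' hm).comp (measurable_const_mul _)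

variable [Countable Λ]

lemma volume_pi_tile (n : ℕ) : volume (Set.univ.pi fun _ : Fin n => D.tile) = 1 := by
  rw [volume_pi_pi]
  simp [D.volume_tile]

lemma lintegral_act {k n : ℕ} (γ : SpecialLinearGroup (Fin k) Λ) {h : (Fin k → Fin n → R) → ℝ≥0∞}
    (hh : Measurable h) : ∫⁻ M, h (D.act (ent γ) M) = ∫⁻ M, h M := by
  have hT := (D.isTile.pi (κ := Fin n)).pi (κ := Fin k)
  have h1 : volume (Set.univ.pi fun _ : Fin k => Set.univ.pi fun _ : Fin n => D.tile) = 1 := by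
    rw [volume_pi_pi]
    simp [D.volume_pi_tile]
  have hinv' : ∀ M : Fin k → Fin n → R, D.act (ent γ) (D.act (ent γ⁻¹) M) = M := by
    intro M
    rw [act_act, mul_inv_cancel, act_one]
  let A : (Fin k → Fin n → R) →+ (Fin k → Fin n → R) :=
    { toFun := D.act (ent γ)
      map_zero' := by funext i j; simp [act, comb]
      map_add' := by intro M M'; funext i j; simp [act, comb, mul_add, Finset.sum_add_distrib] }
  have key : ∀ (γ' γ : SpecialLinearGroup (Fin k) Λ) (a : Fin k → Fin n → Λ) (i : Fin k) (j : Fin n),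
      ∑ l, ent γ' i l * ∑ q, ent γ l q * a q j = ∑ q, ent (γ' * γ) i q * a q j := by
    intro γ' γ a i j
    simp only [ent_mul, rmul, Finset.sum_mul, Finset.mul_sum]
    rw [Finset.sum_comm]
    simp only [mul_assoc]
  let B : (Fin k → Fin n → Λ) ≃ (Fin k → Fin n → Λ) :=
    { toFun := fun a i j => ∑ l, ent γ i l * a l j
      invFun := fun a i j => ∑ l, ent γ⁻¹ i l * a l j
      left_inv := fun a => by
        funext i j
        simp only [key, inv_mul_cancel]
        simp [ent, Matrix.one_apply]
      right_inv := fun a => by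
        funext i j
        simp only [key, mul_inv_cancel]
        simp [ent, Matrix.one_apply] }
  let J := (D.emb.toAddMonoidHom.compLeft (Fin n)).compLeft (Fin k)
  have hAB : ∀ a, A (J a) = J (B a) := by
    intro a
    funext i j
    simp [A, J, B, act, comb]
  rw [← hT.lintegral_hom hT h1 h1 A (D.measurable_act _) (fun y => ⟨_, hinv' y⟩)
    (fun a => ⟨B a, hAB a⟩) hh,
    ← hT.lintegral_unfold (h := fun M => h (D.act (ent γ) M)) (by fun_prop)]
  congr 1 with x
  congr 1
  refine Eq.trans ?_ (B.tsum_eq (fun a => h (A x + J a)))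
  refine tsum_congr fun a => congrArg h ?_
  rw [← hAB, ← map_add]
  rfl

lemma lintegral_torus {n : ℕ} {v : Fin n → Λ} (hv : v ≠ 0) {h : R → ℝ≥0∞} (hh : Measurable h) :
    ∫⁻ b : Fin n → R, (Set.univ.pi fun _ : Fin n => D.tile).indicator 1 b *
      ∑' a : Λ, h (∑ i, D.emb (v i) * b i + D.emb a) = ∫⁻ t, h t := by
  obtain ⟨i, hi⟩ := Function.ne_iff.1 hv
  let A : (Fin n → R) →+ R :=
    { toFun := fun b => ∑ i, D.emb (v i) * b i
      map_zero' := by simp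
      map_add' := by intro M M'; simp [mul_add, Finset.sum_add_distrib] }
  refine (D.isTile.pi (κ := Fin n)).lintegral_hom D.isTile (D.volume_pi_tile n) D.volume_tile A
    (by change Measurable fun b : Fin n → R => ∑ i, D.emb (v i) * b i; fun_prop)
    (fun y => ⟨Pi.single i (Ring.inverse (D.emb (v i)) * y), ?_⟩)
    (fun a => ⟨∑ i, v i * a i, ?_⟩) hh
  · change ∑ k, D.emb (v k) * (Pi.single i (Ring.inverse (D.emb (v i)) * y) : Fin n → R) k = y
    rw [Finset.sum_eq_single i]
    · rw [Pi.single_eq_same, ← mul_assoc, Ring.mul_inverse_cancel _ (D.isUnit_emb _ hi), one_mul]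
    · intro b _ hb
      simp [Pi.single_eq_of_ne hb]
    · simp
  · simp [A]

end Measure

end LatticeRing

section Stabilizer

variable {Λ : Type*} [CommRing Λ] {d : ℕ}

lemma det_cons_one_zero (β : Fin d → Λ) (γ : Fin d → Fin d → Λ) :
    (Matrix.of (Fin.cons (Fin.cons 1 0) (fun i => Fin.cons (β i) (γ i)) :
      Fin (d + 1) → Fin (d + 1) → Λ)).det = (Matrix.of γ).det := by
  rw [Matrix.det_succ_row_zero, Fin.sum_univ_succ]
  simp only [Matrix.of_apply, Fin.cons_zero, Fin.cons_succ, Pi.zero_apply]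
  simp only [Fin.val_zero, pow_zero, mul_one, Fin.val_succ, mul_zero, zero_mul,
    Finset.sum_const_zero, add_zero, one_mul]
  congr 1

/-- The element of the stabilizer of the first basis vector with given lower blocks. -/
def stabMat (β : Fin d → Λ) (γ : SpecialLinearGroup (Fin d) Λ) :
    SpecialLinearGroup (Fin (d + 1)) Λ :=
  ⟨Matrix.of (Fin.cons (Fin.cons 1 0) (fun i => Fin.cons (β i) (ent γ i))), by
    rw [det_cons_one_zero]; exact γ.2⟩

lemma ent_stabMat (β : Fin d → Λ) (γ : SpecialLinearGroup (Fin d) Λ) :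
    ent (stabMat β γ) = Fin.cons (Fin.cons 1 0) (fun i => Fin.cons (β i) (ent γ i)) := rfl

lemma ent_one_zero : ent (1 : SpecialLinearGroup (Fin (d + 1)) Λ) 0 = Fin.cons 1 0 := by
  funext j
  refine Fin.cases ?_ (fun i => ?_) j
  · simp [ent]
  · simp [ent, (Fin.succ_ne_zero i).symm]

lemma exists_stabMat {γ : SpecialLinearGroup (Fin (d + 1)) Λ} (h : ent γ 0 = Fin.cons 1 0) :
    ∃ β γ', γ = stabMat β γ' := by
  have h2 : ent γ = Fin.cons (Fin.cons 1 0)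
      (fun i => Fin.cons (ent γ i.succ 0) (Fin.tail (ent γ i.succ))) := by
    funext i
    refine Fin.cases ?_ (fun i => ?_) i
    · simpa using h
    · simp
  have hdet : (Matrix.of (fun i : Fin d => Fin.tail (ent γ i.succ))).det = 1 := by
    rw [← det_cons_one_zero (fun i => ent γ i.succ 0), ← h2]
    exact γ.2
  exact ⟨fun i => ent γ i.succ 0, ⟨_, hdet⟩, ent_injective h2⟩

/-- A matrix in `SL_{d+1}(Λ)` with given first row. -/
def completion (u : firstRows Λ d) : SpecialLinearGroup (Fin (d + 1)) Λ := u.2.choose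

lemma ent_completion (u : firstRows Λ d) : ent (completion u) 0 = u := u.2.choose_spec

lemma rmul_cons_one_zero (γ : SpecialLinearGroup (Fin (d + 1)) Λ) :
    rmul (Fin.cons 1 0) γ = ent γ 0 := by
  rw [← ent_one_zero, ← ent_mul, one_mul]

lemma ent_stabMat_mul (β : Fin d → Λ) (γ' : SpecialLinearGroup (Fin d) Λ)
    (γ : SpecialLinearGroup (Fin (d + 1)) Λ) : ent (stabMat β γ' * γ) 0 = ent γ 0 := by
  rw [ent_mul, ent_stabMat, Fin.cons_zero, rmul_cons_one_zero]

lemma bijective_stabMat_mul_completion : Function.Bijective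
    (fun z : firstRows Λ d × (Fin d → Λ) × SpecialLinearGroup (Fin d) Λ =>
      stabMat z.2.1 z.2.2 * completion z.1) := by
  constructor
  · rintro ⟨u, β, γ⟩ ⟨u', β', γ'⟩ h
    simp only at h
    have hu : u = u' := by
      apply Subtype.ext
      have := congrArg (fun g => ent g 0) h
      simpa [ent_stabMat_mul, ent_completion] using this
    subst hu
    have h2 := congrArg ent (mul_right_cancel h)
    rw [ent_stabMat, ent_stabMat] at h2
    have h3 : ∀ i, β i = β' i ∧ ent γ i = ent γ' i := by
      intro i
      have := congrFun h2 i.succ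
      simpa [Fin.cons_inj] using this
    have h4 : β = β' := funext fun i => (h3 i).1
    have h5 : γ = γ' := ent_injective (funext fun i => (h3 i).2)
    rw [h4, h5]
  · intro γ
    let u : firstRows Λ d := ⟨ent γ 0, γ, rfl⟩
    obtain ⟨β, γ', h⟩ := exists_stabMat (γ := γ * (completion u)⁻¹) (by
      rw [ent_mul, show ent γ 0 = (u : Fin (d + 1) → Λ) from rfl, ← ent_completion, ← ent_mul,
        mul_inv_cancel, ent_one_zero])
    exact ⟨(u, β, γ'), by simp [← h]⟩

lemma tsum_specialLinearGroup (F : SpecialLinearGroup (Fin (d + 1)) Λ → ℝ≥0∞) :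
    ∑' γ, F γ = ∑' u : firstRows Λ d, ∑' β : Fin d → Λ, ∑' γ' : SpecialLinearGroup (Fin d) Λ,
      F (stabMat β γ' * completion u) := by
  rw [← (Equiv.ofBijective _ bijective_stabMat_mul_completion).tsum_eq, ENNReal.tsum_prod']
  refine tsum_congr fun u => ?_
  rw [ENNReal.tsum_prod']
  rfl

/-- The right action of `SL_{d+1}(Λ)` permutes the set of first rows. -/
def firstRowsEquiv (γ : SpecialLinearGroup (Fin (d + 1)) Λ) : firstRows Λ d ≃ firstRows Λ d :=
  (rmulEquiv γ).subtypeEquiv (by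
    intro w
    constructor
    · rintro ⟨γ', rfl⟩
      exact ⟨γ' * γ, ent_mul _ _ _⟩
    · rintro ⟨γ', h⟩
      refine ⟨γ' * γ⁻¹, ?_⟩
      rw [ent_mul, h]
      exact (rmulEquiv γ).left_inv w)

end Stabilizer

namespace LatticeRing

variable {Λ R : Type*} [CommRing Λ] [CommRing R] [MeasureSpace R] (D : LatticeRing Λ R)

/-- The matrix with first row `x` and remaining rows `(b, M) * s(x)`. -/
def Psi {e : ℕ} (x : Fin (e + 2) → R) (b : Fin (e + 1) → R) (M : Fin (e + 1) → Fin (e + 1) → R) :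
    Fin (e + 2) → Fin (e + 2) → R :=
  Fin.cons x fun i => st x (b i) (M i)

/-- The coordinate `b` of a matrix `Psi x b M`. -/
def bPart {e : ℕ} (M : Fin (e + 2) → Fin (e + 2) → R) : Fin (e + 1) → R :=
  fun i => (unst (M 0) (M i.succ)).1

/-- The coordinate `M` of a matrix `Psi x b M`. -/
def mPart {e : ℕ} (M : Fin (e + 2) → Fin (e + 2) → R) : Fin (e + 1) → Fin (e + 1) → R :=
  fun i => (unst (M 0) (M i.succ)).2

section Algebra

variable {e : ℕ}

lemma Psi_parts {M : Fin (e + 2) → Fin (e + 2) → R} (h : IsUnit (M 0 0)) :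
    Psi (M 0) (bPart M) (mPart M) = M := by
  funext i
  refine Fin.cases rfl (fun i => ?_) i
  exact st_unst h _

lemma bPart_Psi {x : Fin (e + 2) → R} (h : IsUnit (x 0)) (b : Fin (e + 1) → R)
    (M : Fin (e + 1) → Fin (e + 1) → R) : bPart (Psi x b M) = b := by
  funext i
  change (unst x (st x _ _)).1 = _
  rw [unst_st h]

lemma mPart_Psi {x : Fin (e + 2) → R} (h : IsUnit (x 0)) (b : Fin (e + 1) → R)
    (M : Fin (e + 1) → Fin (e + 1) → R) : mPart (Psi x b M) = M := by
  funext i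
  change (unst x (st x _ _)).2 = _
  rw [unst_st h]

lemma det_Psi {x : Fin (e + 2) → R} (h : IsUnit (x 0)) (b : Fin (e + 1) → R)
    (M : Fin (e + 1) → Fin (e + 1) → R) : (Matrix.of (Psi x b M)).det = (Matrix.of M).det := by
  set c := Ring.inverse (x 0) with hc
  have h1 : (Matrix.of (Psi x b M)).det = (Matrix.of (Fin.cons x (fun i => Fin.cons 0 (sc c (M i))) :
      Fin (e + 2) → Fin (e + 2) → R)).det := by
    refine Matrix.det_eq_of_forall_row_eq_smul_add_const (Fin.cons 0 b) 0 (by simp) ?_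
    intro i j
    refine Fin.cases ?_ (fun i => ?_) i
    · simp [Psi]
    · simp [Psi, st, ← hc, add_comm]
  rw [h1, Matrix.det_succ_column_zero, Fin.sum_univ_succ]
  simp only [Matrix.of_apply, Fin.cons_zero, Fin.cons_succ]
  simp only [Fin.val_zero, pow_zero, one_mul, mul_zero, zero_mul, Finset.sum_const_zero, add_zero]
  have h2 : ((Matrix.of (Fin.cons x (fun i => Fin.cons 0 (sc c (M i))) :
      Fin (e + 2) → Fin (e + 2) → R)).submatrix (Fin.succAbove 0) Fin.succ) =
      Matrix.of fun i j => (Fin.cons c 1 : Fin (e + 1) → R) j * Matrix.of M i j := by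
    ext i j
    simp only [Matrix.submatrix_apply, Matrix.of_apply, Fin.succAbove_zero, Fin.cons_succ]
    refine Fin.cases ?_ (fun j => ?_) j <;> simp [sc, Fin.tail]
  rw [h2, Matrix.det_mul_row, Fin.prod_univ_succ]
  simp [← mul_assoc, hc, Ring.mul_inverse_cancel _ h]

lemma comb_Psi (w : Fin (e + 2) → Λ) (x : Fin (e + 2) → R) (b : Fin (e + 1) → R)
    (M : Fin (e + 1) → Fin (e + 1) → R) :
    D.comb w (Psi x b M) = st x (D.emb (w 0) + ∑ i, D.emb (w i.succ) * b i)
      (D.comb (Fin.tail w) M) := by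
  rw [st_add]
  have := st_sum x (fun i : Fin (e + 1) => D.emb (w i.succ)) b M
  funext j
  have h2 := congrFun this j
  have h3 : D.comb (Fin.tail w) M = fun j => ∑ i, D.emb (w i.succ) * M i j := rfl
  rw [h3, h2, comb, Fin.sum_univ_succ]
  simp [Psi]

lemma comb_zero {k n : ℕ} (M : Fin k → Fin n → R) : D.comb 0 M = 0 := by
  funext j
  simp [comb]

lemma act_stabMat (β : Fin (e + 1) → Λ) (γ : SpecialLinearGroup (Fin (e + 1)) Λ)
    (x : Fin (e + 2) → R) (b : Fin (e + 1) → R) (M : Fin (e + 1) → Fin (e + 1) → R) :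
    D.act (ent (stabMat β γ)) (Psi x b M) =
      Psi x ((fun i => ∑ l, D.emb (ent γ i l) * b l) + fun i => D.emb (β i)) (D.act (ent γ) M) := by
  funext i
  rw [act, comb_Psi]
  refine Fin.cases ?_ (fun i => ?_) i
  · have : (Fin.tail (Fin.cons 1 0 : Fin (e + 2) → Λ)) = 0 := rfl
    simp [ent_stabMat, Psi, this, comb_zero, st_zero_right]
  · simp only [ent_stabMat, Psi, Fin.cons_succ, Fin.cons_zero, Fin.tail_cons]
    congr 1
    simp [add_comm]

end Algebra

section Measure

variable [MeasurableAdd₂ R] [MeasurableMul₂ R] [MeasurableSub₂ R]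

lemma measurable_Psi (D : LatticeRing Λ R) {e : ℕ} {Z : Type*} [MeasurableSpace Z]
    {x : Z → Fin (e + 2) → R} {b : Z → Fin (e + 1) → R} {M : Z → Fin (e + 1) → Fin (e + 1) → R}
    (hx : Measurable x) (hb : Measurable b) (hM : Measurable M) :
    Measurable fun z => Psi (x z) (b z) (M z) :=
  measurable_fin_cons hx (measurable_pi_lambda _ fun _ => D.measurable_st hx hb.eval hM.eval)

lemma measurable_bPart (D : LatticeRing Λ R) {e : ℕ} :
    Measurable (bPart : (Fin (e + 2) → Fin (e + 2) → R) → _) :=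
  measurable_pi_lambda _ fun _ => (D.measurable_unst (by fun_prop) (by fun_prop)).fst

lemma measurable_mPart (D : LatticeRing Λ R) {e : ℕ} :
    Measurable (mPart : (Fin (e + 2) → Fin (e + 2) → R) → _) :=
  measurable_pi_lambda _ fun _ => (D.measurable_unst (by fun_prop) (by fun_prop)).snd

variable [SigmaFinite (volume : Measure R)] [(volume : Measure R).IsAddLeftInvariant]

lemma measurePreserving_st (D : LatticeRing Λ R) {e : ℕ} {x : Fin (e + 2) → R}
    (hx : IsUnit (x 0)) :
    MeasurePreserving (fun z : R × (Fin (e + 1) → R) => st x z.1 z.2) volume volume := by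
  have hm : Measurable (fun z : R × (Fin (e + 1) → R) => st x z.1 z.2) :=
    D.measurable_st measurable_const measurable_fst measurable_snd
  refine ⟨hm, ?_⟩
  ext s hs
  rw [Measure.map_apply hm hs, ← lintegral_indicator_one hs, ← D.lintegral_st hx
    (measurable_one.indicator hs), ← lintegral_indicator_one (hm hs), Measure.volume_eq_prod,
    lintegral_prod _ ((measurable_one.indicator (hm hs)).aemeasurable)]
  rfl

lemma ae_isUnit_apply (D : LatticeRing Λ R) {n : ℕ} (i : Fin n) :
    ∀ᵐ x : Fin n → R, IsUnit (x i) :=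
  (Measure.quasiMeasurePreserving_eval (fun _ => (volume : Measure R)) i).ae D.ae_isUnit

lemma lintegral_Psi (D : LatticeRing Λ R) {e : ℕ} {F : (Fin (e + 2) → Fin (e + 2) → R) → ℝ≥0∞}
    (hF : Measurable F) : ∫⁻ M, F M = ∫⁻ x, ∫⁻ b, ∫⁻ M, F (Psi x b M) := by
  rw [lintegral_fin_succ hF]
  refine lintegral_congr_ae ?_
  filter_upwards [D.ae_isUnit_apply (n := e + 2) 0] with x hx
  have hmx : Measurable fun N : Fin (e + 1) → Fin (e + 2) → R => F (Fin.cons x N) :=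
    hF.comp (measurable_fin_cons measurable_const measurable_id)
  have h1 := volume_preserving_pi (fun _ : Fin (e + 1) => D.measurePreserving_st hx)
  rw [← h1.lintegral_comp hmx, ← (volume_measurePreserving_arrowProdEquivProdArrow R
    (Fin (e + 1) → R) (Fin (e + 1))).symm.lintegral_comp
      (f := fun a => F (Fin.cons x fun i => st x (a i).1 (a i).2)) (hmx.comp h1.measurable),
    Measure.volume_eq_prod, lintegral_prod]
  · rfl
  · exact ((hmx.comp h1.measurable).comp (MeasurableEquiv.measurable _)).aemeasurable

lemma ae_parts (D : LatticeRing Λ R) {e : ℕ} {p : (Fin (e + 1) → Fin (e + 1) → R) → Prop}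
    (hp : ∀ᵐ M, p M) : ∀ᵐ M : Fin (e + 2) → Fin (e + 2) → R, IsUnit (M 0 0) ∧ p (mPart M) := by
  refine Filter.Eventually.and ?_ ?_
  · exact (Measure.quasiMeasurePreserving_eval (fun _ => (volume : Measure (Fin (e + 2) → R))) 0).ae
      (D.ae_isUnit_apply 0)
  · obtain ⟨N, hN, hNm, hN0⟩ := exists_measurable_superset_of_null (ae_iff.1 hp)
    rw [ae_iff]
    refine measure_mono_null (t := mPart ⁻¹' N) (fun M hM => hN hM) ?_
    have hm : MeasurableSet (mPart ⁻¹' N : Set (Fin (e + 2) → Fin (e + 2) → R)) :=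
      D.measurable_mPart hNm
    rw [← lintegral_indicator_one hm, D.lintegral_Psi (measurable_one.indicator hm)]
    rw [lintegral_eq_zero_of_ae_eq_zero]
    filter_upwards [D.ae_isUnit_apply (n := e + 2) 0] with x hx
    have : ∀ b : Fin (e + 1) → R, ∀ M, (mPart ⁻¹' N).indicator
        (1 : (Fin (e + 2) → Fin (e + 2) → R) → ℝ≥0∞) (Psi x b M) = N.indicator 1 M := by
      intro b M
      have := mPart_Psi hx b M
      by_cases hM : M ∈ N
      · rw [Set.indicator_of_mem hM, Set.indicator_of_mem (by rwa [Set.mem_preimage, this])]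
        rfl
      · rw [Set.indicator_of_notMem hM,
          Set.indicator_of_notMem (by rwa [Set.mem_preimage, this])]
    simp_rw [this]
    rw [lintegral_indicator_one hNm, hN0]
    simp

end Measure

end LatticeRing

namespace LatticeRing

variable {Λ R : Type*} [CommRing Λ] [CommRing R] [MeasureSpace R]
  [MeasurableAdd₂ R] [MeasurableMul₂ R] [MeasurableSub₂ R]
  [SigmaFinite (volume : Measure R)] [(volume : Measure R).IsAddLeftInvariant] [Countable Λ]
  (D : LatticeRing Λ R)

/-- Weights on matrices whose `SL_k(Λ)`-periodization is the indicator of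
`{M | det M ∈ shell}`. -/
structure IsWeight {k : ℕ} (φ : (Fin k → Fin k → R) → ℝ≥0∞) : Prop where
  measurable : Measurable φ
  ae_tsum : ∀ᵐ M, ∑' γ : SpecialLinearGroup (Fin k) Λ, φ (D.act (ent γ) M) =
    D.shell.indicator 1 (Matrix.of M).det

variable {D}

lemma IsWeight.ae_eq_mul {k : ℕ} {φ : (Fin k → Fin k → R) → ℝ≥0∞} (h : D.IsWeight φ) :
    ∀ᵐ M, φ M = φ M * D.shell.indicator 1 (Matrix.of M).det := by
  filter_upwards [h.ae_tsum] with M hM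
  by_cases hd : (Matrix.of M).det ∈ D.shell
  · rw [Set.indicator_of_mem hd]; simp
  · rw [Set.indicator_of_notMem hd, ENNReal.tsum_eq_zero] at hM
    have := hM 1
    rw [act_one] at this
    rw [this, zero_mul]

variable (D)

lemma ae_act {k n : ℕ} {p : (Fin k → Fin n → R) → Prop} (hp : ∀ᵐ M, p M) :
    ∀ᵐ M, ∀ γ : SpecialLinearGroup (Fin k) Λ, p (D.act (ent γ) M) := by
  rw [ae_all_iff]
  intro γ
  obtain ⟨N, hN, hNm, hN0⟩ := exists_measurable_superset_of_null (ae_iff.1 hp)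
  rw [ae_iff]
  refine measure_mono_null (t := D.act (ent γ) ⁻¹' N) (fun M hM => hN hM) ?_
  have := D.lintegral_act γ (measurable_one.indicator hNm)
  rw [lintegral_indicator_one hNm, hN0] at this
  rw [← lintegral_indicator_one (D.measurable_act _ hNm)]
  exact this

/-- The weight `1_T(b) φ(M')` on matrices `Psi x b M'`. -/
def tau {e : ℕ} (φ : (Fin (e + 1) → Fin (e + 1) → R) → ℝ≥0∞)
    (M : Fin (e + 2) → Fin (e + 2) → R) : ℝ≥0∞ :=
  (Set.univ.pi fun _ : Fin (e + 1) => D.tile).indicator 1 (bPart M) * φ (mPart M)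

lemma measurableSet_pi_tile (n : ℕ) : MeasurableSet (Set.univ.pi fun _ : Fin n => D.tile) :=
  MeasurableSet.univ_pi fun _ => D.isTile.measurableSet

lemma measurable_tau {e : ℕ} {φ : (Fin (e + 1) → Fin (e + 1) → R) → ℝ≥0∞} (hφ : Measurable φ) :
    Measurable (D.tau φ) :=
  ((measurable_one.indicator (D.measurableSet_pi_tile _)).comp D.measurable_bPart).mul
    (hφ.comp D.measurable_mPart)

variable {D} in
lemma IsWeight.tsum_tau {e : ℕ} {φ : (Fin (e + 1) → Fin (e + 1) → R) → ℝ≥0∞} (h : D.IsWeight φ) :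
    ∀ᵐ M, ∑' β : Fin (e + 1) → Λ, ∑' γ : SpecialLinearGroup (Fin (e + 1)) Λ,
      D.tau φ (D.act (ent (stabMat β γ)) M) = D.shell.indicator 1 (Matrix.of M).det := by
  filter_upwards [D.ae_parts h.ae_tsum] with M ⟨hM0, hM⟩
  have h1 : ∀ β γ, D.tau φ (D.act (ent (stabMat β γ)) M) =
      (Set.univ.pi fun _ : Fin (e + 1) => D.tile).indicator 1
        ((fun i => ∑ l, D.emb (ent γ i l) * bPart M l) + fun i => D.emb (β i)) *
        φ (D.act (ent γ) (mPart M)) := by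
    intro β γ
    conv_lhs => rw [← Psi_parts hM0, act_stabMat, tau, bPart_Psi hM0, mPart_Psi hM0]
  simp_rw [h1]
  rw [ENNReal.tsum_comm]
  simp_rw [ENNReal.tsum_mul_right]
  have h2 : ∀ x : Fin (e + 1) → R, ∑' β : Fin (e + 1) → Λ,
      (Set.univ.pi fun _ : Fin (e + 1) => D.tile).indicator (1 : (Fin (e + 1) → R) → ℝ≥0∞)
        (x + fun i => D.emb (β i)) = 1 :=
    fun x => (D.isTile.pi (κ := Fin (e + 1))).tsum_eq_one x
  simp_rw [h2, one_mul]
  rw [hM, ← det_Psi hM0 (bPart M), Psi_parts hM0]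

variable {D} in
lemma IsWeight.lintegral_unfold {e : ℕ} {φ : (Fin (e + 2) → Fin (e + 2) → R) → ℝ≥0∞}
    {φ' : (Fin (e + 1) → Fin (e + 1) → R) → ℝ≥0∞} (h : D.IsWeight φ) (h' : D.IsWeight φ')
    {H : (Fin (e + 2) → Fin (e + 2) → R) → ℝ≥0∞} (hH : Measurable H)
    (hinv : ∀ β γ M, H (D.act (ent (stabMat β γ)) M) = H M) :
    ∫⁻ M, φ M * ∑' u : firstRows Λ (e + 1), H (D.act (ent (completion u)) M) =
      ∫⁻ x, ∫⁻ b, (Set.univ.pi fun _ : Fin (e + 1) => D.tile).indicator 1 b *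
        ∫⁻ M', φ' M' * H (Psi x b M') := by
  have hτ := D.measurable_tau h'.measurable
  have hφ := h.measurable
  calc ∫⁻ M, φ M * ∑' u : firstRows Λ (e + 1), H (D.act (ent (completion u)) M)
      = ∫⁻ M, ∑' γ : SpecialLinearGroup (Fin (e + 2)) Λ, φ M *
          (D.tau φ' (D.act (ent γ) M) * H (D.act (ent γ) M)) := by
        refine lintegral_congr_ae ?_
        filter_upwards [h.ae_eq_mul, D.ae_act h'.tsum_tau] with M hM hM'
        rw [ENNReal.tsum_mul_left, tsum_specialLinearGroup]
        rw [hM, mul_assoc, mul_assoc]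
        refine congrArg (φ M * ·) ?_
        rw [← ENNReal.tsum_mul_left, ← ENNReal.tsum_mul_left]
        refine tsum_congr fun u => ?_
        have := hM' (completion u)
        rw [det_act] at this
        simp_rw [← act_act, hinv, ENNReal.tsum_mul_right]
        rw [this, ← mul_assoc]
        congr 1
        by_cases hd : (Matrix.of M).det ∈ D.shell
        · rw [Set.indicator_of_mem hd]; simp
        · rw [Set.indicator_of_notMem hd]; simp
    _ = ∑' γ : SpecialLinearGroup (Fin (e + 2)) Λ, ∫⁻ M, φ M *
          (D.tau φ' (D.act (ent γ) M) * H (D.act (ent γ) M)) :=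
        lintegral_tsum fun γ => by fun_prop
    _ = ∑' γ : SpecialLinearGroup (Fin (e + 2)) Λ, ∫⁻ M, φ (D.act (ent γ⁻¹) M) *
          (D.tau φ' M * H M) := by
        refine tsum_congr fun γ => ?_
        rw [← D.lintegral_act γ⁻¹ (h := fun M => φ M *
          (D.tau φ' (D.act (ent γ) M) * H (D.act (ent γ) M))) (by fun_prop)]
        simp only [act_act, mul_inv_cancel, act_one]
    _ = ∫⁻ M, (∑' γ : SpecialLinearGroup (Fin (e + 2)) Λ, φ (D.act (ent γ⁻¹) M)) *
          (D.tau φ' M * H M) := by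
        simp_rw [← ENNReal.tsum_mul_right]
        rw [lintegral_tsum fun γ => by fun_prop]
    _ = ∫⁻ M, D.tau φ' M * H M := by
        refine lintegral_congr_ae ?_
        filter_upwards [h.ae_tsum, D.ae_parts h'.ae_eq_mul] with M hM ⟨hM0, hM'⟩
        have hi : ∑' γ : SpecialLinearGroup (Fin (e + 2)) Λ, φ (D.act (ent γ⁻¹) M) =
            ∑' γ : SpecialLinearGroup (Fin (e + 2)) Λ, φ (D.act (ent γ) M) :=
          (Equiv.inv _).tsum_eq (fun γ => φ (D.act (ent γ) M))
        rw [hi, hM]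
        rw [← det_Psi hM0 (bPart M), Psi_parts hM0] at hM'
        rw [← mul_assoc]
        congr 1
        rw [tau]
        conv_rhs => rw [hM']
        ring
    _ = _ := by
        rw [D.lintegral_Psi (by fun_prop)]
        refine lintegral_congr_ae ?_
        filter_upwards [D.ae_isUnit_apply (n := e + 2) 0] with x hx
        refine lintegral_congr fun b => ?_
        rw [← lintegral_const_mul]
        · refine lintegral_congr fun M => ?_
          rw [tau, bPart_Psi hx, mPart_Psi hx, mul_assoc]
        · exact h'.measurable.mul (hH.comp
            (D.measurable_Psi measurable_const measurable_const measurable_id))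

lemma exists_majorant (d : ℕ) : ∃ f : (Fin (d + 1) → R) → ℝ≥0∞, Measurable f ∧ (∀ x, f x ≠ 0) ∧
    ∀ M : Fin (d + 1) → Fin (d + 1) → R, IsUnit (Matrix.det (Matrix.of M)) →
      ∑' w : Fin (d + 1) → Λ, f (D.comb w M) ≠ ∞ := by
  obtain ⟨U, hU, h0, htop, -, hex, hcount⟩ := D.exists_exhaustion d
  refine ⟨fun x => ∑' l : ℕ, (2⁻¹ ^ l / volume (U l)) * (U l).indicator 1 x,
    Measurable.tsum fun l => measurable_const.mul (measurable_one.indicator (hU l)),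
    fun x => ?_, fun M hM => ?_⟩
  · obtain ⟨l, hl⟩ := hex x
    rw [Ne, ENNReal.tsum_eq_zero, not_forall]
    refine ⟨l, ?_⟩
    rw [Set.indicator_of_mem hl]
    simp [htop l]
  · rw [ENNReal.tsum_comm]
    simp_rw [ENNReal.tsum_mul_left]
    obtain ⟨hfin, hlim⟩ := hcount M hM 0
    simp only [Pi.zero_apply, zero_add] at hfin hlim
    obtain ⟨C, hC, hC'⟩ : ∃ C : ℝ≥0∞, C ≠ ∞ ∧ ∀ l, (∑' w : Fin (d + 1) → Λ,
        (U l).indicator (1 : (Fin (d + 1) → R) → ℝ≥0∞) (fun j => ∑ i, D.emb (w i) * M i j)) / volume (U l) ≤ C := by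
      have hne : (D.cmod (Matrix.of M).det)⁻¹ ≠ ∞ := ENNReal.inv_ne_top.2 (D.cmod_ne_zero _ hM)
      have hev := hlim.eventually (gt_mem_nhds (ENNReal.lt_add_right hne one_ne_zero))
      obtain ⟨n, hn⟩ := Filter.eventually_atTop.1 hev
      refine ⟨((D.cmod (Matrix.of M).det)⁻¹ + 1) + ∑ l ∈ Finset.range n, (∑' w : Fin (d + 1) → Λ,
        (U l).indicator (1 : (Fin (d + 1) → R) → ℝ≥0∞) (fun j => ∑ i, D.emb (w i) * M i j)) / volume (U l),
        ?_, fun l => ?_⟩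
      · refine ENNReal.add_ne_top.2 ⟨by simp [hne], ?_⟩
        refine (ENNReal.sum_lt_top.2 fun l _ => ?_).ne
        exact ENNReal.div_lt_top (hfin l) (h0 l)
      · rcases lt_or_ge l n with hl | hl
        · exact le_add_of_nonneg_of_le (by positivity)
            (Finset.single_le_sum (f := fun l => (∑' w : Fin (d + 1) → Λ,
              (U l).indicator (1 : (Fin (d + 1) → R) → ℝ≥0∞) (fun j => ∑ i, D.emb (w i) * M i j)) / volume (U l))
              (fun _ _ => by positivity) (Finset.mem_range.2 hl))
        · exact (hn l hl).le.trans le_self_add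
    refine ne_top_of_le_ne_top (b := ∑' l : ℕ, 2⁻¹ ^ l * C) ?_ (ENNReal.tsum_le_tsum fun l => ?_)
    · rw [ENNReal.tsum_mul_right, ENNReal.tsum_geometric]
      refine ENNReal.mul_ne_top ?_ hC
      simp
    · rw [div_eq_mul_inv, mul_assoc, mul_comm (volume (U l))⁻¹, ← div_eq_mul_inv]
      gcongr
      exact hC' l

variable {D} in
lemma IsWeight.exists_succ {e : ℕ} {φ : (Fin (e + 1) → Fin (e + 1) → R) → ℝ≥0∞}
    (h : D.IsWeight φ) : ∃ φ' : (Fin (e + 2) → Fin (e + 2) → R) → ℝ≥0∞, D.IsWeight φ' := by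
  obtain ⟨f, hf, hf0, hft⟩ := D.exists_majorant (e + 1)
  let F : (Fin (e + 2) → Fin (e + 2) → R) → ℝ≥0∞ := fun M =>
    ∑' u : firstRows Λ (e + 1), f (D.comb (u : Fin (e + 2) → Λ) M)
  have hF : Measurable F := Measurable.tsum fun u => hf.comp (D.measurable_comb _)
  have hFinv : ∀ γ M, F (D.act (ent γ) M) = F M := by
    intro γ M
    simp only [F, comb_act_ent]
    exact (firstRowsEquiv γ).tsum_eq (fun u => f (D.comb u M))
  refine ⟨fun M => f (M 0) / F M * D.tau φ M, by
    have := D.measurable_tau h.measurable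
    fun_prop, ?_⟩
  filter_upwards [D.ae_act h.tsum_tau] with M hM
  rw [tsum_specialLinearGroup]
  have h1 : ∀ (u : firstRows Λ (e + 1)) β γ',
      D.act (ent (stabMat β γ' * completion u)) M 0 = D.comb u M := by
    intro u β γ'
    rw [act, ent_stabMat_mul, ent_completion]
  simp_rw [h1, hFinv, ENNReal.tsum_mul_left, ← act_act]
  have h2 := fun u : firstRows Λ (e + 1) => hM (completion u)
  simp_rw [h2, det_act, ENNReal.tsum_mul_right, div_eq_mul_inv, ENNReal.tsum_mul_right]
  by_cases hd : (Matrix.of M).det ∈ D.shell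
  · rw [Set.indicator_of_mem hd]
    have hu := hft M (D.isUnit_of_mem_shell _ hd)
    rw [ENNReal.mul_inv_cancel]
    · simp
    · rw [Ne, ENNReal.tsum_eq_zero, not_forall]
      exact ⟨⟨_, 1, rfl⟩, hf0 _⟩
    · exact ne_top_of_le_ne_top hu (ENNReal.tsum_comp_le_tsum_of_injective
        Subtype.val_injective (fun w => f (D.comb w M)))
  · rw [Set.indicator_of_notMem hd]; simp

lemma exists_isWeight (e : ℕ) : ∃ φ : (Fin (e + 1) → Fin (e + 1) → R) → ℝ≥0∞, D.IsWeight φ := by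
  induction e with
  | zero =>
    have hm : Measurable fun M : Fin 1 → Fin 1 → R =>
        D.shell.indicator (1 : R → ℝ≥0∞) (Matrix.of M).det :=
      (measurable_one.indicator D.measurableSet_shell).comp measurable_det
    refine ⟨_, hm, Filter.Eventually.of_forall fun M => ?_⟩
    have : Unique (SpecialLinearGroup (Fin 1) Λ) := Unique.mk' _
    simp only [det_act]
    rw [tsum_eq_single 1 fun γ hγ => absurd (Subsingleton.elim γ 1) hγ]
  | succ e ih =>
    obtain ⟨φ, h⟩ := ih
    exact h.exists_succ

end LatticeRing

section Cong

variable {Λ : Type*} [CommRing Λ]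

/-- Nonzero vectors congruent to `w` modulo `N`. -/
def cong {d : ℕ} (N : Λ) (w : Fin d → Λ) : Set (Fin d → Λ) := {w' | w' ≠ 0 ∧ ∀ i, N ∣ w' i - w i}

lemma rmul_eq_zero_iff {d : ℕ} (w : Fin d → Λ) (γ : SpecialLinearGroup (Fin d) Λ) :
    rmul w γ = 0 ↔ w = 0 := by
  have h0 : ∀ γ : SpecialLinearGroup (Fin d) Λ, rmul 0 γ = 0 := by
    intro γ; funext j; simp [rmul]
  constructor
  · intro h
    have := congrArg (fun v => rmul v γ⁻¹) h
    simpa [rmul_mul, rmul_one, h0] using this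
  · rintro rfl
    exact h0 γ

lemma dvd_rmul_sub {d : ℕ} {N : Λ} {w w' : Fin d → Λ} (h : ∀ i, N ∣ w' i - w i)
    (γ : SpecialLinearGroup (Fin d) Λ) (i : Fin d) : N ∣ rmul w' γ i - rmul w γ i := by
  simp only [rmul, ← Finset.sum_sub_distrib, ← sub_mul]
  exact Finset.dvd_sum fun j _ => (h j).mul_right _

/-- The right action of `SL_d(Λ)` on congruence classes. -/
def congEquiv {d : ℕ} (N : Λ) (w : Fin d → Λ) (γ : SpecialLinearGroup (Fin d) Λ) :
    cong N w ≃ cong N (rmul w γ) :=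
  (rmulEquiv γ).subtypeEquiv (by
    intro w'
    change w' ≠ 0 ∧ _ ↔ rmul w' γ ≠ 0 ∧ ∀ i, N ∣ rmul w' γ i - rmul w γ i
    rw [Ne, Ne, rmul_eq_zero_iff]
    refine and_congr_right fun _ => ⟨fun h => dvd_rmul_sub h γ, fun h => ?_⟩
    have := dvd_rmul_sub h γ⁻¹
    simpa [rmul_mul, rmul_one] using this)

lemma coe_congEquiv {d : ℕ} (N : Λ) (w : Fin d → Λ) (γ : SpecialLinearGroup (Fin d) Λ)
    (w' : cong N w) : (congEquiv N w γ w' : Fin d → Λ) = rmul w' γ := rfl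

/-- Nonzero scalars congruent to `k` modulo `N`. -/
def scong (N k : Λ) : Set Λ := {α | α ≠ 0 ∧ N ∣ α - k}

lemma tsum_cong [IsDomain Λ] {d : ℕ} {N : Λ} (hN : N ≠ 0) (k : Λ) (F : (Fin (d + 1) → Λ) → ℝ≥0∞) :
    ∑' w : cong N (Fin.cons k 0 : Fin (d + 1) → Λ), F w =
      ∑' α : scong N k, F (Fin.cons α 0) +
      ∑' v : {v : Fin d → Λ // v ≠ 0}, ∑' β : Λ, F (Fin.cons (k + N * β) fun i => N * v.1 i) := by
  let e : scong N k ⊕ ({v : Fin d → Λ // v ≠ 0} × Λ) → cong N (Fin.cons k 0 : Fin (d + 1) → Λ) :=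
    Sum.elim (fun α => ⟨Fin.cons α 0, fun h => α.2.1 (congrFun h 0), by
        refine Fin.cases ?_ (fun i => ?_)
        · simpa using α.2.2
        · simp⟩)
      (fun z => ⟨Fin.cons (k + N * z.2) fun i => N * z.1.1 i, fun h => z.1.2 (by
          funext i
          have := congrFun h i.succ
          simpa [hN] using this), by
        refine Fin.cases ?_ (fun i => ?_)
        · simp
        · simp⟩)
  have he : Function.Bijective e := by
    constructor
    · rintro (a | a) (b | b) h <;> have h' := congrArg Subtype.val h <;>
        simp only [e, Sum.elim_inl, Sum.elim_inr] at h'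
      · rw [Fin.cons_inj] at h'
        exact congrArg Sum.inl (Subtype.ext h'.1)
      · rw [Fin.cons_inj] at h'
        refine absurd ?_ b.1.2
        funext i
        have := congrFun h'.2 i
        simpa [hN] using this.symm
      · rw [Fin.cons_inj] at h'
        refine absurd ?_ a.1.2
        funext i
        have := congrFun h'.2 i
        simpa [hN] using this
      · rw [Fin.cons_inj] at h'
        congr 1
        refine Prod.ext (Subtype.ext (funext fun i => ?_)) ?_
        · have := congrFun h'.2 i
          simpa [hN] using this
        · simpa [hN] using h'.1
    · rintro ⟨w, hw0, hw⟩
      by_cases ht : Fin.tail w = 0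
      · refine ⟨Sum.inl ⟨w 0, fun h => hw0 ?_, by simpa using hw 0⟩, Subtype.ext ?_⟩
        · rw [← Fin.cons_self_tail w, h, ht]
          funext i
          refine Fin.cases rfl (fun i => rfl) i
        · change Fin.cons (w 0) 0 = w
          rw [← ht, Fin.cons_self_tail]
      · obtain ⟨β, hβ⟩ := hw 0
        choose v hv using fun i : Fin d => hw i.succ
        simp only [Fin.cons_zero, Fin.cons_succ, Pi.zero_apply, sub_zero] at hβ hv
        refine ⟨Sum.inr (⟨v, fun h => ht ?_⟩, β), Subtype.ext ?_⟩
        · funext i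
          simp [Fin.tail, hv, h]
        · change Fin.cons (k + N * β) (fun i => N * v i) = w
          rw [← hβ, add_sub_cancel]
          conv_rhs => rw [← Fin.cons_self_tail w]
          congr 1
          funext i
          exact (hv i).symm
  rw [← (Equiv.ofBijective e he).tsum_eq, ENNReal.summable.tsum_sum ENNReal.summable]
  congr 1
  rw [ENNReal.tsum_prod']
  rfl

end Cong

namespace LatticeRing

variable {Λ R : Type*} [CommRing Λ] [CommRing R] [MeasureSpace R]
  [MeasurableAdd₂ R] [MeasurableMul₂ R] [MeasurableSub₂ R]
  [SigmaFinite (volume : Measure R)] [(volume : Measure R).IsAddLeftInvariant] [Countable Λ]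
  [IsDomain Λ] (D : LatticeRing Λ R)

lemma tsum_ne_zero (D : LatticeRing Λ R) {e : ℕ} (F : (Fin (e + 2) → Λ) → ℝ≥0∞) :
    ∑' w : {w : Fin (e + 2) → Λ // w ≠ 0}, F w =
      ∑' k : D.reps, ∑' u : firstRows Λ (e + 1), F (fun i => k * (u : Fin (e + 2) → Λ) i) := by
  have hne : ∀ (k : D.reps) (u : firstRows Λ (e + 1)),
      (fun i => (k : Λ) * (u : Fin (e + 2) → Λ) i) ≠ 0 := by
    intro k u h
    have hk : (k : Λ) ≠ 0 := fun h => D.zero_notMem_reps (h ▸ k.2)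
    have hu : (u : Fin (e + 2) → Λ) = 0 := by
      funext i
      simpa [hk] using congrFun h i
    obtain ⟨γ, hγ⟩ := u.2
    rw [hu, ← rmul_cons_one_zero, rmul_eq_zero_iff] at hγ
    exact one_ne_zero (congrFun hγ 0)
  let E : D.reps × firstRows Λ (e + 1) → {w : Fin (e + 2) → Λ // w ≠ 0} :=
    fun z => ⟨_, hne z.1 z.2⟩
  have hE : Function.Bijective E := by
    constructor
    · intro a b h
      have h' := congrArg Subtype.val h
      exact (D.existsUnique_reps e _ (hne a.1 a.2)).unique rfl h'
    · rintro ⟨w, hw⟩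
      obtain ⟨z, hz, -⟩ := D.existsUnique_reps e w hw
      exact ⟨z, Subtype.ext hz.symm⟩
  rw [← (Equiv.ofBijective E hE).tsum_eq, ENNReal.tsum_prod']
  rfl

/-- Equivariant families of functions. -/
structure Equivar {k : ℕ} (F : (Fin k → Λ) → (Fin k → Fin k → R) → ℝ≥0∞) : Prop where
  measurable : ∀ w, Measurable (F w)
  eq : ∀ w γ M, F w (D.act (ent γ) M) = F (rmul w γ) M

variable {D} in
lemma IsWeight.lintegral_tsum_ne_zero {e : ℕ} {φ : (Fin (e + 2) → Fin (e + 2) → R) → ℝ≥0∞}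
    {φ' : (Fin (e + 1) → Fin (e + 1) → R) → ℝ≥0∞} (h : D.IsWeight φ) (h' : D.IsWeight φ')
    {F : (Fin (e + 2) → Λ) → (Fin (e + 2) → Fin (e + 2) → R) → ℝ≥0∞} (hF : D.Equivar F) :
    ∫⁻ M, φ M * ∑' w : {w : Fin (e + 2) → Λ // w ≠ 0}, F w M =
      ∑' k : D.reps, ∫⁻ x, ∫⁻ M', φ' M' * ∫⁻ b,
        (Set.univ.pi fun _ : Fin (e + 1) => D.tile).indicator 1 b *
          F (Fin.cons k 0) (Psi x b M') := by
  have hmul : ∀ (k : Λ) (γ : SpecialLinearGroup (Fin (e + 2)) Λ),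
      rmul (Fin.cons k 0) γ = fun i => k * ent γ 0 i := by
    intro k γ
    funext j
    simp [rmul, Fin.sum_univ_succ]
  have hm := hF.measurable
  have hφ := h.measurable
  have hφ' := h'.measurable
  calc ∫⁻ M, φ M * ∑' w : {w : Fin (e + 2) → Λ // w ≠ 0}, F w M
      = ∫⁻ M, ∑' k : D.reps, φ M *
          ∑' u : firstRows Λ (e + 1), F (Fin.cons k 0) (D.act (ent (completion u)) M) := by
        refine lintegral_congr fun M => ?_
        rw [D.tsum_ne_zero (fun w => F w M), ENNReal.tsum_mul_left]
        simp_rw [hF.eq, hmul, ent_completion]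
    _ = ∑' k : D.reps, ∫⁻ M, φ M *
          ∑' u : firstRows Λ (e + 1), F (Fin.cons k 0) (D.act (ent (completion u)) M) := by
        refine lintegral_tsum fun k => ?_
        have : Measurable fun M => ∑' u : firstRows Λ (e + 1),
          F (Fin.cons k 0) (D.act (ent (completion u)) M) := Measurable.tsum fun u => by fun_prop
        fun_prop
    _ = _ := by
        refine tsum_congr fun k => ?_
        rw [h.lintegral_unfold h' (hm _)]
        · refine lintegral_congr fun x => ?_
          have hP : Measurable fun z : (Fin (e + 1) → R) × (Fin (e + 1) → Fin (e + 1) → R) =>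
              F (Fin.cons k 0) (Psi x z.1 z.2) :=
            (hm _).comp (D.measurable_Psi measurable_const measurable_fst measurable_snd)
          have hP1 : ∀ b, Measurable fun z => F (Fin.cons k 0) (Psi x b z) :=
            fun b => hP.comp measurable_prodMk_left
          have hP2 : ∀ M, Measurable fun b => F (Fin.cons k 0) (Psi x b M) :=
            fun b => hP.comp measurable_prodMk_right
          have hT := (measurable_one : Measurable (1 : (Fin (e + 1) → R) → ℝ≥0∞)).indicator
            (D.measurableSet_pi_tile (e + 1))
          calc _ = ∫⁻ b, ∫⁻ M', (Set.univ.pi fun _ : Fin (e + 1) => D.tile).indicator 1 b *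
                (φ' M' * F (Fin.cons k 0) (Psi x b M')) := by
                refine lintegral_congr fun b => ?_
                exact (lintegral_const_mul _ (hφ'.mul (hP1 b))).symm
            _ = ∫⁻ M', ∫⁻ b, (Set.univ.pi fun _ : Fin (e + 1) => D.tile).indicator 1 b *
                (φ' M' * F (Fin.cons k 0) (Psi x b M')) := by
                refine lintegral_lintegral_swap (Measurable.aemeasurable ?_)
                exact (hT.comp measurable_fst).mul ((hφ'.comp measurable_snd).mul hP)
            _ = _ := by
                refine lintegral_congr fun M' => ?_
                refine Eq.trans ?_ (lintegral_const_mul _ (hT.mul (hP2 M')))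
                refine lintegral_congr fun b => ?_
                ring
        · intro β γ M
          rw [hF.eq, hmul, ent_stabMat, Fin.cons_zero]
          congr 1
          funext j
          refine Fin.cases ?_ (fun i => ?_) j <;> simp

end LatticeRing

namespace LatticeRing

variable {Λ R : Type*} [CommRing Λ] [CommRing R] [MeasureSpace R]
  [MeasurableAdd₂ R] [MeasurableMul₂ R] [MeasurableSub₂ R]
  [SigmaFinite (volume : Measure R)] [(volume : Measure R).IsAddLeftInvariant] [Countable Λ]
  [IsDomain Λ] (D : LatticeRing Λ R)

/-- The point of the unimodular lattice attached to `M` with coordinates `w`. -/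
def Dv {e : ℕ} (M : Fin (e + 1) → Fin (e + 1) → R) (w : Fin (e + 1) → Λ) : Fin (e + 1) → R :=
  sc (Ring.inverse (Matrix.of M).det) (D.comb w M)

lemma measurable_Dv {e : ℕ} (w : Fin (e + 1) → Λ) : Measurable fun M => D.Dv M w :=
  measurable_sc (D.measurable_inv.comp measurable_det) (D.measurable_comb w)

lemma Dv_act {e : ℕ} (w : Fin (e + 1) → Λ) (γ : SpecialLinearGroup (Fin (e + 1)) Λ)
    (M : Fin (e + 1) → Fin (e + 1) → R) : D.Dv (D.act (ent γ) M) w = D.Dv M (rmul w γ) := by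
  rw [Dv, Dv, det_act, comb_act_ent]

lemma Dv_Psi {e : ℕ} {x : Fin (e + 2) → R} (h : IsUnit (x 0)) (b : Fin (e + 1) → R)
    (M : Fin (e + 1) → Fin (e + 1) → R) (w : Fin (e + 2) → Λ) :
    D.Dv (Psi x b M) w = sc (Ring.inverse (Matrix.of M).det)
      (st x (D.emb (w 0) + ∑ i, D.emb (w i.succ) * b i) (D.comb (Fin.tail w) M)) := by
  rw [Dv, det_Psi h, comb_Psi]

lemma Dv_Psi_cons_zero {e : ℕ} {x : Fin (e + 2) → R} (h : IsUnit (x 0)) (b : Fin (e + 1) → R)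
    (M : Fin (e + 1) → Fin (e + 1) → R) (k : Λ) :
    D.Dv (Psi x b M) (Fin.cons k 0) = sc (Ring.inverse (Matrix.of M).det)
      (fun j => D.emb k * x j) := by
  rw [Dv_Psi _ h, Fin.tail_cons, comb_zero, st_zero_right]
  simp

lemma lintegral_sc_inverse {e : ℕ} {c : R} (hc : IsUnit c) {h : (Fin (e + 1) → R) → ℝ≥0∞}
    (hh : Measurable h) : ∫⁻ v, h (sc (Ring.inverse c) v) = D.cmod c * ∫⁻ v, h v := by
  rw [← D.lintegral_sc hc.ringInverse hh, ← mul_assoc, D.cmod_mul_inverse hc, one_mul]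

lemma lintegral_smul' {a : R} (ha : IsUnit a) {n : ℕ} {h : (Fin n → R) → ℝ≥0∞}
    (hh : Measurable h) :
    ∫⁻ v : Fin n → R, h (fun i => a * v i) = (D.cmod a)⁻¹ ^ n * ∫⁻ v, h v := by
  rw [← D.lintegral_smul ha hh, ← mul_assoc, ← mul_pow, ENNReal.inv_mul_cancel
    (D.cmod_ne_zero a ha) (D.cmod_ne_top a), one_pow, one_mul]

lemma lintegral_mul' {a : R} (ha : IsUnit a) {h : R → ℝ≥0∞}
    (hh : Measurable h) : ∫⁻ v, h (a * v) = (D.cmod a)⁻¹ * ∫⁻ v, h v := by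
  rw [← D.lintegral_mul a ha h hh, ← mul_assoc, ENNReal.inv_mul_cancel
    (D.cmod_ne_zero a ha) (D.cmod_ne_top a), one_mul]

lemma isUnit_reps (k : D.reps) : IsUnit (D.emb k) :=
  D.isUnit_emb _ fun h => D.zero_notMem_reps (h ▸ k.2)

/-- The zeta value `∑_k |k|^{-j}`. -/
def zeta (j : ℕ) : ℝ≥0∞ := ∑' k : D.reps, (D.cmod (D.emb k))⁻¹ ^ j

/-- The moment `∫ φ |det|^j`. -/
def mom {k : ℕ} (φ : (Fin k → Fin k → R) → ℝ≥0∞) (j : ℕ) : ℝ≥0∞ :=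
  ∫⁻ M, φ M * D.cmod (Matrix.of M).det ^ j

lemma measurable_cmod_det {k : ℕ} :
    Measurable fun M : Fin k → Fin k → R => D.cmod (Matrix.of M).det :=
  D.measurable_cmod.comp measurable_det

variable {D}

lemma IsWeight.lintegral_congr_unit {k : ℕ} {φ : (Fin k → Fin k → R) → ℝ≥0∞} (h : D.IsWeight φ)
    {F G : (Fin k → Fin k → R) → ℝ≥0∞} (hFG : ∀ M, IsUnit (Matrix.of M).det → F M = G M) :
    ∫⁻ M, φ M * F M = ∫⁻ M, φ M * G M := by
  refine lintegral_congr_ae ?_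
  filter_upwards [h.ae_eq_mul] with M hM
  by_cases hd : (Matrix.of M).det ∈ D.shell
  · rw [hFG M (D.isUnit_of_mem_shell _ hd)]
  · rw [Set.indicator_of_notMem hd, mul_zero] at hM
    simp [hM]

lemma lintegral_tile (D : LatticeRing Λ R) {n : ℕ} (c : ℝ≥0∞) :
    ∫⁻ b : Fin n → R, (Set.univ.pi fun _ : Fin n => D.tile).indicator 1 b * c = c := by
  rw [lintegral_mul_const _ (measurable_one.indicator (D.measurableSet_pi_tile n)),
    lintegral_indicator_one (D.measurableSet_pi_tile n), D.volume_pi_tile, one_mul]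

lemma IsWeight.lintegral_firstMoment {e : ℕ} {φ : (Fin (e + 2) → Fin (e + 2) → R) → ℝ≥0∞}
    {φ' : (Fin (e + 1) → Fin (e + 1) → R) → ℝ≥0∞} (h : D.IsWeight φ) (h' : D.IsWeight φ')
    {g : (Fin (e + 2) → R) → ℝ≥0∞} (hg : Measurable g) :
    ∫⁻ M, φ M * ∑' w : {w : Fin (e + 2) → Λ // w ≠ 0}, g (D.Dv M w) =
      D.zeta (e + 2) * D.mom φ' 1 * ∫⁻ x, g x := by
  rw [h.lintegral_tsum_ne_zero h' (F := fun w M => g (D.Dv M w))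
    ⟨fun w => hg.comp (D.measurable_Dv w), fun w γ M => by rw [Dv_act]⟩]
  rw [zeta, mul_assoc, ← ENNReal.tsum_mul_right]
  refine tsum_congr fun k => ?_
  have hm : Measurable fun z : (Fin (e + 2) → R) × (Fin (e + 1) → Fin (e + 1) → R) =>
      φ' z.2 * g (sc (Ring.inverse (Matrix.of z.2).det) (fun j => D.emb k * z.1 j)) :=
    (h'.measurable.comp measurable_snd).mul (hg.comp (measurable_sc
      ((D.measurable_inv.comp measurable_det).comp measurable_snd) (by fun_prop)))
  calc _ = ∫⁻ x : Fin (e + 2) → R, ∫⁻ M', φ' M' * g (sc (Ring.inverse (Matrix.of M').det)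
          (fun j => D.emb k * x j)) := by
        refine lintegral_congr_ae ?_
        filter_upwards [D.ae_isUnit_apply (n := e + 2) 0] with x hx
        simp_rw [D.Dv_Psi_cons_zero hx, D.lintegral_tile]
    _ = ∫⁻ M', φ' M' * ∫⁻ x : Fin (e + 2) → R, g (sc (Ring.inverse (Matrix.of M').det)
          (fun j => D.emb k * x j)) := by
        rw [lintegral_lintegral_swap hm.aemeasurable]
        refine lintegral_congr fun M' => ?_
        rw [lintegral_const_mul]
        exact hg.comp (measurable_sc measurable_const (by fun_prop))
    _ = ∫⁻ M', φ' M' * ((D.cmod (D.emb k))⁻¹ ^ (e + 2) * (D.cmod (Matrix.of M').det *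
          ∫⁻ x, g x)) := by
        refine h'.lintegral_congr_unit fun M' hM' => ?_
        rw [D.lintegral_smul' (D.isUnit_reps k)
          (h := fun x => g (sc (Ring.inverse (Matrix.of M').det) x))
          (hg.comp (measurable_sc measurable_const measurable_id)), D.lintegral_sc_inverse hM' hg]
    _ = _ := by
        have hc := D.measurable_cmod_det (k := e + 1)
        have hφ := h'.measurable
        rw [mom, ← lintegral_mul_const _ (by fun_prop), ← lintegral_const_mul _ (by fun_prop)]
        refine lintegral_congr fun M' => ?_
        ring

lemma sc_smul {e : ℕ} (c a : R) (x : Fin (e + 1) → R) :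
    sc c (fun j => a * x j) = fun j => a * sc c x j := by
  funext j
  refine Fin.cases ?_ (fun i => ?_) j
  · simp [sc, mul_left_comm]
  · simp [sc, Fin.tail]

/-- The integral of `g` over the line `sc δ⁻¹ (st x t y)`. -/
def lineInt {e : ℕ} (g : (Fin (e + 2) → R) → ℝ≥0∞) (x : Fin (e + 2) → R) (δ : R)
    (y : Fin (e + 1) → R) : ℝ≥0∞ := ∫⁻ t, g (sc (Ring.inverse δ) (st x t y))

lemma measurable_lineInt (D : LatticeRing Λ R) {e : ℕ} {g : (Fin (e + 2) → R) → ℝ≥0∞}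
    (hg : Measurable g) {Z : Type*} [MeasurableSpace Z] {x : Z → Fin (e + 2) → R} {δ : Z → R}
    {y : Z → Fin (e + 1) → R} (hx : Measurable x) (hδ : Measurable δ) (hy : Measurable y) :
    Measurable fun z => lineInt g (x z) (δ z) (y z) :=
  Measurable.lintegral_prod_right' (f := fun z : Z × R =>
    g (sc (Ring.inverse (δ z.1)) (st (x z.1) z.2 (y z.1))))
    (hg.comp (measurable_sc (D.measurable_inv.comp (hδ.comp measurable_fst))
      (D.measurable_st (hx.comp measurable_fst) measurable_snd (hy.comp measurable_fst))))

lemma lintegral_lineInt (D : LatticeRing Λ R) {e : ℕ} {g : (Fin (e + 2) → R) → ℝ≥0∞}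
    (hg : Measurable g) {x : Fin (e + 2) → R} (hx : IsUnit (x 0)) {δ : R} (hδ : IsUnit δ) {c : R}
    (hc : IsUnit c) : ∫⁻ y : Fin (e + 1) → R, lineInt g x δ (fun j => c * y j) =
      (D.cmod c)⁻¹ ^ (e + 1) * (D.cmod δ * ∫⁻ z, g z) := by
  have hg2 : Measurable fun z => g (sc (Ring.inverse δ) z) :=
    hg.comp (measurable_sc measurable_const measurable_id)
  rw [D.lintegral_smul' hc (h := fun y => lineInt g x δ y)
    (D.measurable_lineInt hg measurable_const measurable_const measurable_id),
    ← D.lintegral_sc_inverse hδ hg, ← D.lintegral_st hx hg2]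
  congr 1
  unfold lineInt
  rw [lintegral_lintegral_swap]
  exact (hg2.comp (D.measurable_st measurable_const measurable_snd measurable_fst)).aemeasurable

lemma rmul_smul {k : ℕ} (N : Λ) (v : Fin k → Λ) (γ : SpecialLinearGroup (Fin k) Λ) :
    rmul (fun i => N * v i) γ = fun i => N * rmul v γ i := by
  funext j
  simp only [rmul, Finset.mul_sum, mul_assoc]

lemma comb_cons_zero (D : LatticeRing Λ R) {e : ℕ} (N k : Λ) (x : Fin (e + 2) → R)
    (b : Fin (e + 1) → R) (M : Fin (e + 1) → Fin (e + 1) → R) :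
    D.comb (fun i => N * (Fin.cons k 0 : Fin (e + 2) → Λ) i) (Psi x b M) =
      fun j => D.emb (N * k) * x j := by
  funext j
  simp [comb, Fin.sum_univ_succ, Psi]

lemma IsWeight.lintegral_lineInt {e : ℕ} {φ' : (Fin (e + 2) → Fin (e + 2) → R) → ℝ≥0∞}
    {φ'' : (Fin (e + 1) → Fin (e + 1) → R) → ℝ≥0∞} (h' : D.IsWeight φ') (h'' : D.IsWeight φ'')
    {g : (Fin (e + 3) → R) → ℝ≥0∞} (hg : Measurable g) {f : R → ℝ≥0∞} (hf : Measurable f)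
    {x : Fin (e + 3) → R} (hx : IsUnit (x 0)) {N : Λ} (hN : N ≠ 0) :
    ∫⁻ M', φ' M' * ∑' v : {v : Fin (e + 2) → Λ // v ≠ 0}, f (Matrix.of M').det *
        lineInt g x (Matrix.of M').det (D.comb (fun i => N * v.1 i) M') =
      (D.cmod (D.emb N))⁻¹ ^ (e + 2) * D.zeta (e + 2) * (∫⁻ z, g z) *
        ∫⁻ M'', φ'' M'' * (D.cmod (Matrix.of M'').det * f (Matrix.of M'').det) := by
  have hm : ∀ w : Fin (e + 2) → Λ, Measurable fun M : Fin (e + 2) → Fin (e + 2) → R =>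
      f (Matrix.of M).det * lineInt g x (Matrix.of M).det (D.comb w M) := fun w =>
    (hf.comp measurable_det).mul
      (D.measurable_lineInt hg measurable_const measurable_det (D.measurable_comb _))
  rw [h'.lintegral_tsum_ne_zero h'' (F := fun v M' => f (Matrix.of M').det *
        lineInt g x (Matrix.of M').det (D.comb (fun i => N * v i) M'))
    ⟨fun w => hm _, fun w γ M => by rw [det_act, comb_act_ent, rmul_smul]⟩]
  rw [zeta, mul_assoc, mul_assoc, mul_left_comm, ← ENNReal.tsum_mul_right]
  refine tsum_congr fun k => ?_
  have hNk : IsUnit (D.emb (N * k)) := by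
    rw [map_mul]
    exact (D.isUnit_emb N hN).mul (D.isUnit_reps k)
  have hm2 : Measurable fun z : (Fin (e + 2) → R) × (Fin (e + 1) → Fin (e + 1) → R) =>
      φ'' z.2 * (f (Matrix.of z.2).det *
        lineInt g x (Matrix.of z.2).det (fun j => D.emb (N * k) * z.1 j)) :=
    (h''.measurable.comp measurable_snd).mul (((hf.comp measurable_det).comp measurable_snd).mul
      (D.measurable_lineInt hg measurable_const (measurable_det.comp measurable_snd)
        (by fun_prop)))
  calc _ = ∫⁻ y : Fin (e + 2) → R, ∫⁻ M'', φ'' M'' * (f (Matrix.of M'').det *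
        lineInt g x (Matrix.of M'').det (fun j => D.emb (N * k) * y j)) := by
        refine lintegral_congr_ae ?_
        filter_upwards [D.ae_isUnit_apply (n := e + 2) 0] with y hy
        simp_rw [det_Psi hy, D.comb_cons_zero, D.lintegral_tile]
    _ = ∫⁻ M'', φ'' M'' * (f (Matrix.of M'').det * ∫⁻ y : Fin (e + 2) → R,
        lineInt g x (Matrix.of M'').det (fun j => D.emb (N * k) * y j)) := by
        rw [lintegral_lintegral_swap hm2.aemeasurable]
        refine lintegral_congr fun M' => ?_
        have hm3 : Measurable fun y : Fin (e + 2) → R =>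
            lineInt g x (Matrix.of M').det (fun j => D.emb (N * k) * y j) :=
          D.measurable_lineInt hg measurable_const measurable_const (by fun_prop)
        rw [lintegral_const_mul _ (by fun_prop), lintegral_const_mul _ hm3]
    _ = ∫⁻ M'', φ'' M'' * (f (Matrix.of M'').det * ((D.cmod (D.emb (N * k)))⁻¹ ^ (e + 2) *
          (D.cmod (Matrix.of M'').det * ∫⁻ z, g z))) := by
        refine h''.lintegral_congr_unit fun M' hM' => ?_
        rw [LatticeRing.lintegral_lineInt D hg hx hM' hNk]
    _ = _ := by
        have hc := D.measurable_cmod_det (k := e + 1)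
        have hφ := h''.measurable
        have hfd : Measurable fun M : Fin (e + 1) → Fin (e + 1) → R => f (Matrix.of M).det :=
          hf.comp measurable_det
        have hcN : (D.cmod (D.emb (N * k)))⁻¹ = (D.cmod (D.emb N))⁻¹ * (D.cmod (D.emb k))⁻¹ := by
          rw [map_mul, D.cmod_mul, ENNReal.mul_inv (Or.inr (D.cmod_ne_top _))
            (Or.inl (D.cmod_ne_top _))]
        have hp : Measurable fun M : Fin (e + 1) → Fin (e + 1) → R =>
            φ'' M * (D.cmod (Matrix.of M).det * f (Matrix.of M).det) := hφ.mul (hc.mul hfd)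
        rw [← lintegral_const_mul _ hp, ← lintegral_const_mul _ (hp.const_mul _),
          ← lintegral_const_mul _ ((hp.const_mul _).const_mul _), hcN]
        refine lintegral_congr fun M' => ?_
        ring

lemma lintegral_tile_cong (D : LatticeRing Λ R) {e : ℕ} {g : (Fin (e + 2) → R) → ℝ≥0∞}
    (hg : Measurable g) {x : Fin (e + 2) → R} (hx : IsUnit (x 0)) {N : Λ} (hN : N ≠ 0) (k : Λ)
    (M : Fin (e + 1) → Fin (e + 1) → R) :
    ∫⁻ b, (Set.univ.pi fun _ : Fin (e + 1) => D.tile).indicator 1 b *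
        ∑' w : cong N (Fin.cons k 0 : Fin (e + 2) → Λ), g (D.Dv (Psi x b M) w) =
      ∑' α : scong N k, g (sc (Ring.inverse (Matrix.of M).det) (fun j => D.emb α * x j)) +
      (D.cmod (D.emb N))⁻¹ * ∑' v : {v : Fin (e + 1) → Λ // v ≠ 0},
        lineInt g x (Matrix.of M).det (D.comb (fun i => N * v.1 i) M) := by
  let h : (Fin (e + 1) → Λ) → R → ℝ≥0∞ := fun v t => g (sc (Ring.inverse (Matrix.of M).det)
    (st x (D.emb k + D.emb N * t) (D.comb (fun i => N * v i) M)))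
  have hh : ∀ v, Measurable (h v) := fun v => hg.comp (measurable_sc measurable_const
    (D.measurable_st measurable_const (by fun_prop) measurable_const))
  have h1 : ∀ (v : Fin (e + 1) → Λ) b (β : Λ), g (D.Dv (Psi x b M)
      (Fin.cons (k + N * β) fun i => N * v i)) = h v (∑ i, D.emb (v i) * b i + D.emb β) := by
    intro v b β
    simp only [h]
    rw [Dv_Psi _ hx, Fin.tail_cons]
    congr 3
    simp only [Fin.cons_zero, Fin.cons_succ, map_add, map_mul, mul_add, Finset.mul_sum, mul_assoc]
    ring
  have h2 : ∀ v, ∫⁻ t, h v t = (D.cmod (D.emb N))⁻¹ *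
      lineInt g x (Matrix.of M).det (D.comb (fun i => N * v i) M) := by
    intro v
    have hm : Measurable fun t => g (sc (Ring.inverse (Matrix.of M).det)
        (st x t (D.comb (fun i => N * v i) M))) :=
      hg.comp (measurable_sc measurable_const
        (D.measurable_st measurable_const measurable_id measurable_const))
    rw [lineInt, ← lintegral_add_left_eq_self (fun t => g (sc (Ring.inverse (Matrix.of M).det)
        (st x t (D.comb (fun i => N * v i) M)))) (D.emb k),
      ← D.lintegral_mul' (D.isUnit_emb N hN) (h := fun t => g (sc (Ring.inverse (Matrix.of M).det)
        (st x (D.emb k + t) (D.comb (fun i => N * v i) M)))) (hm.comp (measurable_const_add _))]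
  have hT : Measurable ((Set.univ.pi fun _ : Fin (e + 1) => D.tile).indicator
      (1 : (Fin (e + 1) → R) → ℝ≥0∞)) := measurable_one.indicator (D.measurableSet_pi_tile _)
  have hh3 : ∀ v : Fin (e + 1) → Λ, Measurable fun b : Fin (e + 1) → R =>
      ∑' β : Λ, h v (∑ i, D.emb (v i) * b i + D.emb β) :=
    fun v => Measurable.tsum fun β => (hh v).comp (by fun_prop)
  have h4 := fun b => tsum_cong hN k (fun w => g (D.Dv (Psi x b M) w))
  simp_rw [h4, D.Dv_Psi_cons_zero hx, h1, mul_add]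
  rw [lintegral_add_left (hT.mul_const _), D.lintegral_tile]
  congr 1
  simp_rw [← ENNReal.tsum_mul_left]
  rw [lintegral_tsum fun v => by
    simp_rw [ENNReal.tsum_mul_left]
    exact (hT.mul (hh3 v)).aemeasurable]
  refine tsum_congr fun v => ?_
  simp_rw [ENNReal.tsum_mul_left]
  rw [D.lintegral_torus v.2 (hh v), h2]

end LatticeRing

namespace LatticeRing

variable {Λ R : Type*} [CommRing Λ] [CommRing R] [MeasureSpace R]
  [MeasurableAdd₂ R] [MeasurableMul₂ R] [MeasurableSub₂ R]
  [SigmaFinite (volume : Measure R)] [(volume : Measure R).IsAddLeftInvariant] [Countable Λ]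
  [IsDomain Λ] (D : LatticeRing Λ R)

/-- The contribution of linearly dependent pairs to the second moment. -/
def dep {d : ℕ} (N : Λ) (g g' : (Fin d → R) → ℝ≥0∞) : ℝ≥0∞ :=
  ∑' k : D.reps, ∑' α : scong N (k : Λ), ∫⁻ x : Fin d → R,
    g (fun j => D.emb k * x j) * g' (fun j => D.emb α * x j)

variable {D}

lemma IsWeight.lintegral_sc_smul {e : ℕ} {φ : (Fin (e + 1) → Fin (e + 1) → R) → ℝ≥0∞}
    (h : D.IsWeight φ) {g : (Fin (e + 3) → R) → ℝ≥0∞} (hg : Measurable g) {k : R} (hk : IsUnit k) :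
    ∫⁻ x : Fin (e + 3) → R, ∫⁻ M, φ M * (D.cmod (Matrix.of M).det *
      g (sc (Ring.inverse (Matrix.of M).det) (fun j => k * x j))) =
      (D.cmod k)⁻¹ ^ (e + 3) * (D.mom φ 2 * ∫⁻ x, g x) := by
  have hc := D.measurable_cmod_det (k := e + 1)
  have hφ := h.measurable
  have hm : Measurable fun z : (Fin (e + 3) → R) × (Fin (e + 1) → Fin (e + 1) → R) =>
      φ z.2 * (D.cmod (Matrix.of z.2).det *
        g (sc (Ring.inverse (Matrix.of z.2).det) (fun j => k * z.1 j))) :=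
    (hφ.comp measurable_snd).mul ((hc.comp measurable_snd).mul (hg.comp (measurable_sc
      ((D.measurable_inv.comp measurable_det).comp measurable_snd) (by fun_prop))))
  rw [lintegral_lintegral_swap hm.aemeasurable]
  calc _ = ∫⁻ M, φ M * (D.cmod (Matrix.of M).det * ∫⁻ x : Fin (e + 3) → R,
        g (sc (Ring.inverse (Matrix.of M).det) (fun j => k * x j))) := by
        refine lintegral_congr fun M => ?_
        have hm2 : Measurable fun x : Fin (e + 3) → R =>
            g (sc (Ring.inverse (Matrix.of M).det) (fun j => k * x j)) :=
          hg.comp (measurable_sc measurable_const (by fun_prop))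
        rw [lintegral_const_mul _ (hm2.const_mul _), lintegral_const_mul _ hm2]
    _ = ∫⁻ M, φ M * (D.cmod (Matrix.of M).det * ((D.cmod k)⁻¹ ^ (e + 3) *
        (D.cmod (Matrix.of M).det * ∫⁻ x, g x))) := by
        refine h.lintegral_congr_unit fun M' hM' => ?_
        rw [D.lintegral_smul' hk
          (h := fun x => g (sc (Ring.inverse (Matrix.of M').det) x))
          (hg.comp (measurable_sc measurable_const measurable_id)), D.lintegral_sc_inverse hM' hg]
    _ = _ := by
        have hp : Measurable fun M : Fin (e + 1) → Fin (e + 1) → R =>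
            φ M * D.cmod (Matrix.of M).det ^ 2 := hφ.mul (hc.pow_const 2)
        rw [mom, ← lintegral_mul_const _ hp, ← lintegral_const_mul _ (hp.mul_const _)]
        refine lintegral_congr fun M' => ?_
        ring

lemma IsWeight.lintegral_dep {e : ℕ} {φ : (Fin (e + 1) → Fin (e + 1) → R) → ℝ≥0∞}
    (h : D.IsWeight φ) {g g' : (Fin (e + 2) → R) → ℝ≥0∞} (hg : Measurable g) (hg' : Measurable g')
    (k : R) {A : Set Λ} :
    ∫⁻ x : Fin (e + 2) → R, ∫⁻ M, φ M * (
      g (sc (Ring.inverse (Matrix.of M).det) (fun j => k * x j)) *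
      ∑' α : A, g' (sc (Ring.inverse (Matrix.of M).det) (fun j => D.emb α * x j))) =
      D.mom φ 1 * ∑' α : A, ∫⁻ x : Fin (e + 2) → R,
        g (fun j => k * x j) * g' (fun j => D.emb α * x j) := by
  have hc := D.measurable_cmod_det (k := e + 1)
  have hφ := h.measurable
  have hsc : ∀ a : R, Measurable fun z : (Fin (e + 2) → R) × (Fin (e + 1) → Fin (e + 1) → R) =>
      sc (Ring.inverse (Matrix.of z.2).det) (fun j => a * z.1 j) := fun a =>
    measurable_sc ((D.measurable_inv.comp measurable_det).comp measurable_snd) (by fun_prop)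
  have hm : Measurable fun z : (Fin (e + 2) → R) × (Fin (e + 1) → Fin (e + 1) → R) =>
      φ z.2 * (g (sc (Ring.inverse (Matrix.of z.2).det) (fun j => k * z.1 j)) *
      ∑' α : A, g' (sc (Ring.inverse (Matrix.of z.2).det) (fun j => D.emb α * z.1 j))) :=
    (hφ.comp measurable_snd).mul ((hg.comp (hsc k)).mul
      (Measurable.tsum fun α => hg'.comp (hsc _)))
  rw [lintegral_lintegral_swap hm.aemeasurable]
  have hH : ∀ α : Λ, Measurable fun x : Fin (e + 2) → R =>
      g (fun j => k * x j) * g' (fun j => D.emb α * x j) := fun α =>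
    (hg.comp (by fun_prop)).mul (hg'.comp (by fun_prop))
  calc _ = ∫⁻ M, φ M * ∑' α : A, ∫⁻ x : Fin (e + 2) → R,
        (fun x : Fin (e + 2) → R => g (fun j => k * x j) * g' (fun j => D.emb α * x j))
          (sc (Ring.inverse (Matrix.of M).det) x) := by
        refine lintegral_congr fun M => ?_
        have hs : ∀ a : R, Measurable fun x : Fin (e + 2) → R =>
          sc (Ring.inverse (Matrix.of M).det) (fun j => a * x j) := fun a =>
            measurable_sc measurable_const (by fun_prop)
        have hp : Measurable fun x : Fin (e + 2) → R =>
            g (sc (Ring.inverse (Matrix.of M).det) (fun j => k * x j)) *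
            ∑' α : A, g' (sc (Ring.inverse (Matrix.of M).det) (fun j => D.emb α * x j)) :=
          (hg.comp (hs k)).mul (Measurable.tsum fun α => hg'.comp (hs _))
        rw [lintegral_const_mul _ hp]
        congr 1
        have hq : ∀ α : A, Measurable fun x : Fin (e + 2) → R =>
            (fun x : Fin (e + 2) → R => g (fun j => k * x j) * g' (fun j => D.emb α * x j))
              (sc (Ring.inverse (Matrix.of M).det) x) := fun α =>
          (hH α).comp (measurable_sc measurable_const measurable_id)
        rw [← lintegral_tsum fun α => (hq α).aemeasurable]
        refine lintegral_congr fun x => ?_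
        simp only [ENNReal.tsum_mul_left, ← sc_smul]
    _ = ∫⁻ M, φ M * (D.cmod (Matrix.of M).det * ∑' α : A, ∫⁻ x : Fin (e + 2) → R,
        g (fun j => k * x j) * g' (fun j => D.emb α * x j)) := by
        refine h.lintegral_congr_unit fun M' hM' => ?_
        rw [← ENNReal.tsum_mul_left]
        exact tsum_congr fun α => D.lintegral_sc_inverse hM' (hH α)
    _ = _ := by
        have hp : Measurable fun M : Fin (e + 1) → Fin (e + 1) → R =>
            φ M * D.cmod (Matrix.of M).det ^ 1 := hφ.mul (hc.pow_const 1)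
        rw [mom, ← lintegral_mul_const _ hp]
        refine lintegral_congr fun M' => ?_
        ring

set_option maxHeartbeats 800000 in
lemma IsWeight.lintegral_secondMoment {e : ℕ} {φ : (Fin (e + 3) → Fin (e + 3) → R) → ℝ≥0∞}
    {φ' : (Fin (e + 2) → Fin (e + 2) → R) → ℝ≥0∞} {φ'' : (Fin (e + 1) → Fin (e + 1) → R) → ℝ≥0∞}
    (h : D.IsWeight φ) (h' : D.IsWeight φ') (h'' : D.IsWeight φ'')
    {g g' : (Fin (e + 3) → R) → ℝ≥0∞} (hg : Measurable g) (hg' : Measurable g')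
    {N : Λ} (hN : N ≠ 0) :
    ∫⁻ M, φ M * ∑' w : {w : Fin (e + 3) → Λ // w ≠ 0}, g (D.Dv M w) *
        ∑' w' : cong N (w : Fin (e + 3) → Λ), g' (D.Dv M w') =
      (D.cmod (D.emb N))⁻¹ ^ (e + 3) * D.zeta (e + 3) * D.zeta (e + 2) * D.mom φ'' 2 *
        (∫⁻ x, g x) * (∫⁻ x, g' x) + D.mom φ' 1 * D.dep N g g' := by
  rw [h.lintegral_tsum_ne_zero h' (F := fun w M => g (D.Dv M w) *
        ∑' w' : cong N (w : Fin (e + 3) → Λ), g' (D.Dv M w'))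
    ⟨fun w => (hg.comp (D.measurable_Dv w)).mul (Measurable.tsum fun w' =>
        hg'.comp (D.measurable_Dv _)), fun w γ M => by
      rw [Dv_act, ← (congEquiv N w γ).tsum_eq]
      simp only [coe_congEquiv, Dv_act]⟩]
  have hk : ∀ k : D.reps, ∫⁻ x : Fin (e + 3) → R, ∫⁻ M', φ' M' * ∫⁻ b,
        (Set.univ.pi fun _ : Fin (e + 2) => D.tile).indicator 1 b *
          (g (D.Dv (Psi x b M') (Fin.cons k 0)) *
        ∑' w' : cong N (Fin.cons k 0 : Fin (e + 3) → Λ), g' (D.Dv (Psi x b M') w')) =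
      (D.mom φ' 1 * ∑' α : scong N (k : Λ), ∫⁻ x : Fin (e + 3) → R,
        g (fun j => D.emb k * x j) * g' (fun j => D.emb α * x j)) +
      (D.cmod (D.emb N))⁻¹ ^ (e + 3) * D.zeta (e + 2) * (∫⁻ x, g' x) *
        ((D.cmod (D.emb k))⁻¹ ^ (e + 3) * (D.mom φ'' 2 * ∫⁻ x, g x)) := by
    intro k
    have hsc : ∀ a : R, Measurable fun z : (Fin (e + 3) → R) × (Fin (e + 2) → Fin (e + 2) → R) =>
        sc (Ring.inverse (Matrix.of z.2).det) (fun j => a * z.1 j) := fun a =>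
      measurable_sc ((D.measurable_inv.comp measurable_det).comp measurable_snd) (by fun_prop)
    have hm1 : Measurable fun z : (Fin (e + 3) → R) × (Fin (e + 2) → Fin (e + 2) → R) =>
        φ' z.2 * (g (sc (Ring.inverse (Matrix.of z.2).det) (fun j => D.emb k * z.1 j)) *
        ∑' α : scong N (k : Λ),
          g' (sc (Ring.inverse (Matrix.of z.2).det) (fun j => D.emb α * z.1 j))) :=
      (h'.measurable.comp measurable_snd).mul ((hg.comp (hsc _)).mul
        (Measurable.tsum fun α => hg'.comp (hsc _)))
    calc _ = ∫⁻ x : Fin (e + 3) → R, ((∫⁻ M', φ' M' * (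
          g (sc (Ring.inverse (Matrix.of M').det) (fun j => D.emb k * x j)) *
          ∑' α : scong N (k : Λ),
            g' (sc (Ring.inverse (Matrix.of M').det) (fun j => D.emb α * x j)))) +
        (D.cmod (D.emb N))⁻¹ * ∫⁻ M', φ' M' * ∑' v : {v : Fin (e + 2) → Λ // v ≠ 0},
          (fun t => g (sc (Ring.inverse t) (fun j => D.emb k * x j))) (Matrix.of M').det *
            lineInt g' x (Matrix.of M').det (D.comb (fun i => N * v.1 i) M')) := by
          refine lintegral_congr_ae ?_
          filter_upwards [D.ae_isUnit_apply (n := e + 3) 0] with x hx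
          have hgx : Measurable fun M : Fin (e + 2) → Fin (e + 2) → R =>
              g (sc (Ring.inverse (Matrix.of M).det) (fun j => D.emb k * x j)) :=
            hg.comp ((hsc _).comp measurable_prodMk_left)
          have hl : ∀ w : Fin (e + 2) → Λ, Measurable fun M : Fin (e + 2) → Fin (e + 2) → R =>
              lineInt g' x (Matrix.of M).det (D.comb w M) := fun w =>
            D.measurable_lineInt hg' measurable_const measurable_det (D.measurable_comb _)
          have hp : Measurable fun M : Fin (e + 2) → Fin (e + 2) → R =>
              φ' M * ∑' v : {v : Fin (e + 2) → Λ // v ≠ 0},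
                g (sc (Ring.inverse (Matrix.of M).det) (fun j => D.emb k * x j)) *
                  lineInt g' x (Matrix.of M).det (D.comb (fun i => N * v.1 i) M) :=
            h'.measurable.mul (Measurable.tsum fun v => hgx.mul (hl _))
          have hp1 : Measurable fun M : Fin (e + 2) → Fin (e + 2) → R =>
              φ' M * (g (sc (Ring.inverse (Matrix.of M).det) (fun j => D.emb k * x j)) *
              ∑' α : scong N (k : Λ),
                g' (sc (Ring.inverse (Matrix.of M).det) (fun j => D.emb α * x j))) :=
            hm1.comp measurable_prodMk_left
          rw [← lintegral_const_mul _ hp, ← lintegral_add_left hp1]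
          refine lintegral_congr fun M' => ?_
          simp_rw [D.Dv_Psi_cons_zero hx, mul_left_comm _ (g _)]
          have hinner : Measurable fun b : Fin (e + 2) → R =>
              (Set.univ.pi fun _ : Fin (e + 2) => D.tile).indicator (1 : (Fin (e + 2) → R) → ℝ≥0∞) b *
              ∑' w' : cong N (Fin.cons k 0 : Fin (e + 3) → Λ), g' (D.Dv (Psi x b M') w') :=
            (measurable_one.indicator (D.measurableSet_pi_tile _)).mul (Measurable.tsum fun w' =>
              hg'.comp ((D.measurable_Dv _).comp
                (D.measurable_Psi measurable_const measurable_id measurable_const)))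
          rw [lintegral_const_mul _ hinner, D.lintegral_tile_cong hg' hx hN]
          simp only [ENNReal.tsum_mul_left]
          ring
      _ = ∫⁻ x : Fin (e + 3) → R, ((∫⁻ M', φ' M' * (
          g (sc (Ring.inverse (Matrix.of M').det) (fun j => D.emb k * x j)) *
          ∑' α : scong N (k : Λ),
            g' (sc (Ring.inverse (Matrix.of M').det) (fun j => D.emb α * x j)))) +
        (D.cmod (D.emb N))⁻¹ * ((D.cmod (D.emb N))⁻¹ ^ (e + 2) * D.zeta (e + 2) * (∫⁻ z, g' z) *
          ∫⁻ M'', φ'' M'' * (D.cmod (Matrix.of M'').det *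
            g (sc (Ring.inverse (Matrix.of M'').det) (fun j => D.emb k * x j))))) := by
          refine lintegral_congr_ae ?_
          filter_upwards [D.ae_isUnit_apply (n := e + 3) 0] with x hx
          rw [h'.lintegral_lineInt h'' hg' (f := fun t => g (sc (Ring.inverse t)
            (fun j => D.emb k * x j))) (hg.comp (measurable_sc D.measurable_inv measurable_const))
            hx hN]
      _ = _ := by
          have hm2 : Measurable fun x : Fin (e + 3) → R =>
              ∫⁻ M'' : Fin (e + 1) → Fin (e + 1) → R, φ'' M'' * (D.cmod (Matrix.of M'').det *
            g (sc (Ring.inverse (Matrix.of M'').det) (fun j => D.emb k * x j))) :=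
            Measurable.lintegral_prod_right' (f := fun z : (Fin (e + 3) → R) ×
              (Fin (e + 1) → Fin (e + 1) → R) => φ'' z.2 * (D.cmod (Matrix.of z.2).det *
            g (sc (Ring.inverse (Matrix.of z.2).det) (fun j => D.emb k * z.1 j))))
              ((h''.measurable.comp measurable_snd).mul
                ((D.measurable_cmod_det.comp measurable_snd).mul (hg.comp (measurable_sc
                  ((D.measurable_inv.comp measurable_det).comp measurable_snd) (by fun_prop)))))
          rw [lintegral_add_left hm1.lintegral_prod_right', h'.lintegral_dep hg hg',
            lintegral_const_mul _ (hm2.const_mul _), lintegral_const_mul _ hm2,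
            h''.lintegral_sc_smul hg (D.isUnit_reps k)]
          ring
  rw [tsum_congr hk, ENNReal.tsum_add, ENNReal.tsum_mul_left, ENNReal.tsum_mul_left,
    ENNReal.tsum_mul_right, dep, zeta, add_comm]
  congr 1
  rw [← zeta]
  simp only [zeta]
  ring

end LatticeRing

namespace LatticeRing

variable {Λ R : Type*} [CommRing Λ] [CommRing R] [MeasureSpace R]
  [MeasurableAdd₂ R] [MeasurableMul₂ R] [MeasurableSub₂ R]
  [SigmaFinite (volume : Measure R)] [(volume : Measure R).IsAddLeftInvariant] [Countable Λ]
  [IsDomain Λ] (D : LatticeRing Λ R)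

/-- A sequence of sets of finite volume in which translates of lattices are asymptotically
equidistributed. -/
structure IsExhaustion {d : ℕ} (U : ℕ → Set (Fin (d + 1) → R)) : Prop where
  measurableSet : ∀ l, MeasurableSet (U l)
  volume_ne_zero : ∀ l, volume (U l) ≠ 0
  volume_ne_top : ∀ l, volume (U l) ≠ ∞
  tendsto_volume : Filter.Tendsto (fun l => volume (U l)) Filter.atTop (nhds ∞)
  tsum_ne_top : ∀ M : Fin (d + 1) → Fin (d + 1) → R, IsUnit (Matrix.det (Matrix.of M)) →
      ∀ z : Fin (d + 1) → R, ∀ l, ∑' w : Fin (d + 1) → Λ,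
        (U l).indicator (1 : (Fin (d + 1) → R) → ℝ≥0∞)
          (fun j => z j + ∑ i, D.emb (w i) * M i j) ≠ ∞
  tendsto_tsum : ∀ M : Fin (d + 1) → Fin (d + 1) → R, IsUnit (Matrix.det (Matrix.of M)) →
      ∀ z : Fin (d + 1) → R, Filter.Tendsto (fun l => (∑' w : Fin (d + 1) → Λ,
        (U l).indicator (1 : (Fin (d + 1) → R) → ℝ≥0∞)
          (fun j => z j + ∑ i, D.emb (w i) * M i j)) / volume (U l))
        Filter.atTop (nhds (D.cmod (Matrix.det (Matrix.of M)))⁻¹)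

lemma exists_isExhaustion (d : ℕ) : ∃ U : ℕ → Set (Fin (d + 1) → R), D.IsExhaustion U := by
  obtain ⟨U, h1, h2, h3, h4, -, h5⟩ := D.exists_exhaustion d
  exact ⟨U, h1, h2, h3, h4, fun M hM z => (h5 M hM z).1, fun M hM z => (h5 M hM z).2⟩

/-- The number (as an extended nonnegative real) of nonzero lattice points in `A` whose coordinates
are congruent to `y` modulo `N`. -/
def cnt {e : ℕ} (N : Λ) (y : Fin (e + 1) → Λ) (A : Set (Fin (e + 1) → R))
    (M : Fin (e + 1) → Fin (e + 1) → R) : ℝ≥0∞ :=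
  ∑' w : cong N y, A.indicator (1 : (Fin (e + 1) → R) → ℝ≥0∞) (D.Dv M w)

lemma measurable_cnt {e : ℕ} (N : Λ) (y : Fin (e + 1) → Λ) {A : Set (Fin (e + 1) → R)}
    (hA : MeasurableSet A) : Measurable (D.cnt N y A) :=
  Measurable.tsum fun _ => (measurable_one.indicator hA).comp (D.measurable_Dv _)

lemma cnt_congr {e : ℕ} {N : Λ} {y y' : Fin (e + 1) → Λ} (h : ∀ i, N ∣ y i - y' i)
    (A : Set (Fin (e + 1) → R)) (M : Fin (e + 1) → Fin (e + 1) → R) :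
    D.cnt N y A M = D.cnt N y' A M := by
  have : cong N y = cong N y' := by
    ext w
    refine and_congr_right fun _ => forall_congr' fun i => ?_
    rw [← dvd_add_left (h i), sub_add_sub_cancel]
  rw [cnt, this, cnt]

lemma cnt_act {e : ℕ} (N : Λ) (y : Fin (e + 1) → Λ) (A : Set (Fin (e + 1) → R))
    (γ : SpecialLinearGroup (Fin (e + 1)) Λ) (M : Fin (e + 1) → Fin (e + 1) → R) :
    D.cnt N y A (D.act (ent γ) M) = D.cnt N (rmul y γ) A M := by
  rw [cnt, cnt, ← (congEquiv N y γ).tsum_eq]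
  simp only [coe_congEquiv, Dv_act]

/-- Translation by `y` composed with multiplication by `N`. -/
lemma tsum_affine {e : ℕ} {N : Λ} (hN : N ≠ 0) (y : Fin (e + 1) → Λ)
    (F : (Fin (e + 1) → Λ) → ℝ≥0∞) :
    ∑' v : Fin (e + 1) → Λ, F (fun i => y i + N * v i) =
      ∑' w : {w : Fin (e + 1) → Λ | ∀ i, N ∣ w i - y i}, F w := by
  let E : (Fin (e + 1) → Λ) → {w : Fin (e + 1) → Λ | ∀ i, N ∣ w i - y i} :=
    fun v => ⟨fun i => y i + N * v i, fun i => by simp⟩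
  have hE : Function.Bijective E := by
    constructor
    · intro a b h
      funext i
      have := congrFun (congrArg Subtype.val h) i
      simpa [E, hN] using this
    · rintro ⟨w, hw⟩
      choose v hv using id hw
      refine ⟨v, Subtype.ext (funext fun i => ?_)⟩
      simp [E, ← hv]
  exact (Equiv.ofBijective E hE).tsum_eq (fun w => F w)

lemma cnt_le_tsum_affine {e : ℕ} {N : Λ} (hN : N ≠ 0) (y : Fin (e + 1) → Λ)
    (A : Set (Fin (e + 1) → R)) (M : Fin (e + 1) → Fin (e + 1) → R) :
    D.cnt N y A M ≤ ∑' v : Fin (e + 1) → Λ,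
      A.indicator (1 : (Fin (e + 1) → R) → ℝ≥0∞) (D.Dv M fun i => y i + N * v i) := by
  rw [tsum_affine hN y (fun w => A.indicator (1 : (Fin (e + 1) → R) → ℝ≥0∞) (D.Dv M w))]
  exact ENNReal.tsum_mono_subtype
    (fun w => A.indicator (1 : (Fin (e + 1) → R) → ℝ≥0∞) (D.Dv M w)) fun w hw => hw.2

lemma tsum_affine_le_cnt {e : ℕ} {N : Λ} (hN : N ≠ 0) (y : Fin (e + 1) → Λ)
    (A : Set (Fin (e + 1) → R)) (M : Fin (e + 1) → Fin (e + 1) → R) :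
    ∑' v : Fin (e + 1) → Λ,
      A.indicator (1 : (Fin (e + 1) → R) → ℝ≥0∞) (D.Dv M fun i => y i + N * v i) ≤
      D.cnt N y A M + 1 := by
  rw [tsum_affine hN y (fun w => A.indicator (1 : (Fin (e + 1) → R) → ℝ≥0∞) (D.Dv M w))]
  have hsub : {w : Fin (e + 1) → Λ | ∀ i, N ∣ w i - y i} ⊆ cong N y ∪ {0} := fun w hw => by
    by_cases h : w = 0
    · exact Or.inr h
    · exact Or.inl ⟨h, hw⟩
  refine (ENNReal.tsum_mono_subtype
    (fun w => A.indicator (1 : (Fin (e + 1) → R) → ℝ≥0∞) (D.Dv M w)) hsub).trans ?_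
  refine (ENNReal.tsum_union_le
    (fun w => A.indicator (1 : (Fin (e + 1) → R) → ℝ≥0∞) (D.Dv M w)) _ _).trans
    (add_le_add le_rfl ?_)
  rw [tsum_singleton 0 (fun w => A.indicator (1 : (Fin (e + 1) → R) → ℝ≥0∞) (D.Dv M w))]
  exact Set.indicator_le_self' (fun _ _ => zero_le) _

/-- Scale the first column so as to obtain determinant one. -/
def unimod {e : ℕ} (M : Fin (e + 1) → Fin (e + 1) → R) : Fin (e + 1) → Fin (e + 1) → R :=
  fun i => sc (Ring.inverse (Matrix.of M).det) (M i)

lemma of_unimod {e : ℕ} (M : Fin (e + 1) → Fin (e + 1) → R) :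
    Matrix.of (unimod M) = (Matrix.of M).updateCol 0
      (Ring.inverse (Matrix.of M).det • (fun i => M i 0)) := by
  ext i j
  refine Fin.cases ?_ (fun j => ?_) j
  · simp [unimod, sc]
  · simp [unimod, sc, Fin.tail]

lemma det_unimod {e : ℕ} {M : Fin (e + 1) → Fin (e + 1) → R} (hM : IsUnit (Matrix.of M).det) :
    (Matrix.of (unimod M)).det = 1 := by
  rw [of_unimod, Matrix.det_updateCol_smul]
  have : (Matrix.of M).updateCol 0 (fun i => M i 0) = Matrix.of M := by
    ext i j
    by_cases h : j = 0
    · subst h; simp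
    · simp [h]
  rw [this, Ring.inverse_mul_cancel _ hM]

lemma Dv_eq_comb {e : ℕ} (M : Fin (e + 1) → Fin (e + 1) → R) (w : Fin (e + 1) → Λ) :
    D.Dv M w = D.comb w (unimod M) := by
  funext j
  refine Fin.cases ?_ (fun j => ?_) j
  · simp only [Dv, sc, comb, unimod, Fin.cons_zero, Finset.mul_sum]
    exact Finset.sum_congr rfl fun i _ => by ring
  · simp [Dv, sc, comb, unimod, Fin.tail]

lemma Dv_affine {e : ℕ} (M : Fin (e + 1) → Fin (e + 1) → R) (N : Λ) (y v : Fin (e + 1) → Λ) :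
    D.Dv M (fun i => y i + N * v i) = fun j => D.comb y (unimod M) j +
      ∑ i, D.emb (v i) * (fun i j => D.emb N * unimod M i j) i j := by
  funext j
  rw [Dv_eq_comb, comb, comb, ← Finset.sum_add_distrib]
  refine Finset.sum_congr rfl fun i _ => ?_
  rw [map_add, map_mul]
  ring

lemma det_smul_unimod {e : ℕ} {M : Fin (e + 1) → Fin (e + 1) → R} (hM : IsUnit (Matrix.of M).det)
    (a : R) : (Matrix.of fun i j => a * unimod M i j).det = a ^ (e + 1) := by
  have : (Matrix.of fun i j => a * unimod M i j) = a • Matrix.of (unimod M) := by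
    ext i j; simp
  rw [this, Matrix.det_smul, det_unimod hM, mul_one, Fintype.card_fin]

lemma cmod_one : D.cmod 1 = 1 := by
  have h := D.cmod_mul_inverse (isUnit_one (M := R))
  rw [Ring.inverse_one] at h
  have h2 := D.cmod_mul 1 1
  rw [mul_one, h] at h2
  exact h2

lemma cmod_pow (a : R) (n : ℕ) : D.cmod (a ^ n) = D.cmod a ^ n := by
  induction n with
  | zero => simp [cmod_one]
  | succ n ih => rw [pow_succ, D.cmod_mul, ih, pow_succ]

variable {D}

lemma IsExhaustion.tendsto_cnt {e : ℕ} {U : ℕ → Set (Fin (e + 1) → R)} (hU : D.IsExhaustion U)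
    {N : Λ} (hN : N ≠ 0) (y : Fin (e + 1) → Λ) {M : Fin (e + 1) → Fin (e + 1) → R}
    (hM : IsUnit (Matrix.of M).det) :
    Filter.Tendsto (fun l => D.cnt N y (U l) M / volume (U l)) Filter.atTop
      (nhds ((D.cmod (D.emb N))⁻¹ ^ (e + 1))) := by
  have hu : IsUnit (Matrix.of fun i j => D.emb N * unimod M i j).det := by
    rw [det_smul_unimod hM]
    exact (D.isUnit_emb N hN).pow _
  have h1 := hU.tendsto_tsum _ hu (D.comb y (unimod M))
  rw [det_smul_unimod hM, cmod_pow, ENNReal.inv_pow] at h1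
  have hDv : ∀ v : Fin (e + 1) → Λ, (fun j => D.comb y (unimod M) j +
      ∑ i, D.emb (v i) * (D.emb N * unimod M i j)) = D.Dv M fun i => y i + N * v i :=
    fun v => (D.Dv_affine M N y v).symm
  simp only [hDv] at h1
  have h2 : Filter.Tendsto (fun l => 1 / volume (U l)) Filter.atTop (nhds 0) := by
    simp only [one_div]
    rw [← ENNReal.inv_top]
    exact tendsto_inv_iff.2 hU.tendsto_volume
  have h3 := ENNReal.Tendsto.sub h1 h2 (Or.inr ENNReal.zero_ne_top)
  rw [tsub_zero] at h3
  refine tendsto_of_tendsto_of_tendsto_of_le_of_le h3 h1 (fun l => ?_) (fun l => ?_)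
  · refine tsub_le_iff_right.2 ?_
    rw [← ENNReal.add_div]
    exact ENNReal.div_le_div_right (D.tsum_affine_le_cnt hN y (U l) M) _
  · exact ENNReal.div_le_div_right (D.cnt_le_tsum_affine hN y (U l) M) _

lemma IsWeight.mom_le {k : ℕ} {φ : (Fin k → Fin k → R) → ℝ≥0∞} (h : D.IsWeight φ)
    (hf : ∫⁻ M, φ M ≠ ∞) (j : ℕ) : D.mom φ j ≠ ∞ := by
  obtain ⟨C, hC, hle⟩ := D.cmod_le
  refine ne_top_of_le_ne_top (ENNReal.mul_ne_top hf (ENNReal.pow_ne_top (n := j) hC)) ?_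
  rw [mom, ← lintegral_mul_const _ h.measurable]
  refine lintegral_mono_ae ?_
  filter_upwards [h.ae_eq_mul] with M hM
  by_cases hd : (Matrix.of M).det ∈ D.shell
  · gcongr
    exact hle _ hd
  · rw [Set.indicator_of_notMem hd, mul_zero] at hM
    simp [hM]

lemma IsWeight.fatou {k : ℕ} {φ : (Fin k → Fin k → R) → ℝ≥0∞} (h : D.IsWeight φ)
    {f : ℕ → (Fin k → Fin k → R) → ℝ≥0∞} {F : (Fin k → Fin k → R) → ℝ≥0∞} {B : ℕ → ℝ≥0∞}
    {b : ℝ≥0∞} (hf : ∀ l, Measurable (f l))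
    (hF : ∀ M, IsUnit (Matrix.of M).det → Filter.Tendsto (fun l => f l M) Filter.atTop (nhds (F M)))
    (hB : ∀ l, ∫⁻ M, φ M * f l M ≤ B l) (hb : Filter.Tendsto B Filter.atTop (nhds b)) :
    ∫⁻ M, φ M * F M ≤ b := by
  calc ∫⁻ M, φ M * F M = ∫⁻ M, φ M * Filter.liminf (fun l => f l M) Filter.atTop :=
        h.lintegral_congr_unit fun M hM => by rw [(hF M hM).liminf_eq]
    _ ≤ ∫⁻ M, Filter.liminf (fun l => φ M * f l M) Filter.atTop := by
        refine lintegral_mono fun M => ?_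
        have := ENNReal.le_liminf_mul (f := Filter.atTop) (u := fun _ : ℕ => φ M)
          (v := fun l => f l M)
        rwa [Filter.liminf_const] at this
    _ ≤ Filter.liminf (fun l => ∫⁻ M, φ M * f l M) Filter.atTop :=
        lintegral_liminf_le fun l => h.measurable.mul (hf l)
    _ ≤ Filter.liminf B Filter.atTop := Filter.liminf_le_liminf (Filter.Eventually.of_forall hB)
    _ = b := hb.liminf_eq

lemma IsWeight.lintegral_ne_top {e : ℕ} {φ : (Fin (e + 1) → Fin (e + 1) → R) → ℝ≥0∞}
    (h : D.IsWeight φ) : ∫⁻ M, φ M ≠ ∞ := by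
  induction e with
  | zero =>
    have hu : Unique (SpecialLinearGroup (Fin 1) Λ) := Unique.mk' _
    have h1 : ∫⁻ M, φ M = ∫⁻ M : Fin 1 → Fin 1 → R, D.shell.indicator 1 (Matrix.of M).det := by
      refine lintegral_congr_ae ?_
      filter_upwards [h.ae_tsum] with M hM
      rw [← hM, tsum_eq_single 1 fun γ hγ => absurd (Subsingleton.elim γ 1) hγ, act_one]
    have hs : Measurable (D.shell.indicator (1 : R → ℝ≥0∞)) :=
      measurable_one.indicator D.measurableSet_shell
    rw [h1]
    have h2 : ∀ M : Fin 1 → Fin 1 → R, (Matrix.of M).det = M 0 0 := fun M => by simp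
    simp only [h2]
    have h3 := (volume_preserving_funUnique (Fin 1) R).lintegral_comp hs
    have h4 := (volume_preserving_funUnique (Fin 1) (Fin 1 → R)).lintegral_comp
      (f := fun v : Fin 1 → R => D.shell.indicator (1 : R → ℝ≥0∞) (v 0))
      (hs.comp (measurable_pi_apply 0))
    have h5 : ∫⁻ M : Fin 1 → Fin 1 → R, D.shell.indicator (1 : R → ℝ≥0∞) (M 0 0) =
        ∫⁻ x : R, D.shell.indicator (1 : R → ℝ≥0∞) x := h4.trans h3
    rw [h5, lintegral_indicator_one D.measurableSet_shell]
    exact D.volume_shell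
  | succ e ih =>
    obtain ⟨φ', h'⟩ := D.exists_isWeight e
    obtain ⟨U, hU⟩ := D.exists_isExhaustion (e + 1)
    have hfin : D.zeta (e + 2) * D.mom φ' 1 ≠ ∞ :=
      ENNReal.mul_ne_top (D.tsum_reps _ (by omega)) (h'.mom_le (ih h') 1)
    refine ne_top_of_le_ne_top hfin ?_
    have hmoment : ∀ l, ∫⁻ M, φ M * (D.cnt 1 0 (U l) M / volume (U l)) =
        D.zeta (e + 2) * D.mom φ' 1 := by
      intro l
      have := h.lintegral_firstMoment h' (g := (U l).indicator 1)
        (measurable_one.indicator (hU.measurableSet l))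
      rw [lintegral_indicator_one (hU.measurableSet l)] at this
      simp only [← mul_div_assoc]
      simp only [div_eq_mul_inv]
      have hp : Measurable fun M => φ M * D.cnt 1 0 (U l) M :=
        h.measurable.mul (D.measurable_cnt _ _ (hU.measurableSet l))
      rw [lintegral_mul_const _ hp]
      have hcnt : ∀ M, D.cnt 1 0 (U l) M = ∑' w : {w : Fin (e + 2) → Λ // w ≠ 0},
          (U l).indicator (1 : (Fin (e + 2) → R) → ℝ≥0∞) (D.Dv M w) := by
        intro M
        have : cong (1 : Λ) (0 : Fin (e + 2) → Λ) = {w | w ≠ 0} := by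
          ext w; simp [cong]
        rw [cnt, this]
        rfl
      simp only [hcnt]
      rw [this, mul_assoc, ENNReal.mul_inv_cancel (hU.volume_ne_zero l) (hU.volume_ne_top l),
        mul_one]
    have := h.fatou (f := fun l M => D.cnt 1 0 (U l) M / volume (U l)) (F := fun _ => 1)
      (B := fun _ => D.zeta (e + 2) * D.mom φ' 1)
      (fun l => (D.measurable_cnt _ _ (hU.measurableSet l)).div_const _) (fun M hM => by
        simpa only [map_one, cmod_one, inv_one, one_pow] using
          hU.tendsto_cnt one_ne_zero 0 hM) (fun l => (hmoment l).le) tendsto_const_nhds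
    simpa using this

end LatticeRing

/-- The square of the difference of two extended nonnegative reals. -/
def sqd (a b : ℝ≥0∞) : ℝ≥0∞ := (a - b) ^ 2 + (b - a) ^ 2

lemma sqd_comm (a b : ℝ≥0∞) : sqd a b = sqd b a := add_comm _ _

lemma sqd_add (a b : ℝ≥0∞) : sqd a b + 2 * (a * b) = a ^ 2 + b ^ 2 := by
  wlog h : a ≤ b generalizing a b
  · rw [sqd_comm, mul_comm a b, this b a (le_of_not_ge h), add_comm]
  obtain ⟨c, rfl⟩ := exists_add_of_le h
  rcases eq_or_ne a ∞ with rfl | ha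
  · simp
  rw [sqd, tsub_eq_zero_of_le h, ENNReal.add_sub_cancel_left ha]
  ring

lemma tendsto_sqd {a b : ℝ≥0∞} {f : ℕ → ℝ≥0∞} (hb : b ≠ ∞)
    (h : Filter.Tendsto f Filter.atTop (nhds b)) :
    Filter.Tendsto (fun l => sqd a (f l)) Filter.atTop (nhds (sqd a b)) :=
  (ENNReal.Tendsto.pow (ENNReal.Tendsto.sub tendsto_const_nhds h (Or.inr hb))).add
    (ENNReal.Tendsto.pow (ENNReal.Tendsto.sub h tendsto_const_nhds (Or.inl hb)))

lemma Measurable.sqd {X : Type*} [MeasurableSpace X] {f g : X → ℝ≥0∞} (hf : Measurable f)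
    (hg : Measurable g) : Measurable fun x => sqd (f x) (g x) :=
  ((hf.sub hg).pow_const 2).add ((hg.sub hf).pow_const 2)

namespace LatticeRing

variable {Λ R : Type*} [CommRing Λ] [CommRing R] [MeasureSpace R]
  [MeasurableAdd₂ R] [MeasurableMul₂ R] [MeasurableSub₂ R]
  [SigmaFinite (volume : Measure R)] [(volume : Measure R).IsAddLeftInvariant] [Countable Λ]
  [IsDomain Λ] (D : LatticeRing Λ R)

/-- A representative of a vector of residue classes. -/
def classRep {k : ℕ} {N : Λ} (Y : Fin k → Λ ⧸ Ideal.span {N}) : Fin k → Λ := fun i => (Y i).out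

lemma dvd_iff_mk_eq {N a b : Λ} :
    N ∣ a - b ↔ Ideal.Quotient.mk (Ideal.span {N}) a = Ideal.Quotient.mk (Ideal.span {N}) b := by
  rw [Ideal.Quotient.eq, Ideal.mem_span_singleton]

lemma mk_classRep {k : ℕ} {N : Λ} (Y : Fin k → Λ ⧸ Ideal.span {N}) (i : Fin k) :
    Ideal.Quotient.mk (Ideal.span {N}) (classRep Y i) = Y i := Quotient.out_eq' _

lemma tsum_mul_tsum_cong {e : ℕ} (N : Λ) (A B : Set (Fin (e + 1) → R))
    (M : Fin (e + 1) → Fin (e + 1) → R) :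
    ∑' w : {w : Fin (e + 1) → Λ // w ≠ 0}, A.indicator (1 : (Fin (e + 1) → R) → ℝ≥0∞) (D.Dv M w) *
      ∑' w' : cong N (w : Fin (e + 1) → Λ),
        B.indicator (1 : (Fin (e + 1) → R) → ℝ≥0∞) (D.Dv M w') =
      ∑' Y : Fin (e + 1) → Λ ⧸ Ideal.span {N},
        D.cnt N (classRep Y) A M * D.cnt N (classRep Y) B M := by
  let q : {w : Fin (e + 1) → Λ // w ≠ 0} → Fin (e + 1) → Λ ⧸ Ideal.span {N} :=
    fun w i => Ideal.Quotient.mk _ (w.1 i)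
  change ∑' w : {w : Fin (e + 1) → Λ // w ≠ 0},
    A.indicator (1 : (Fin (e + 1) → R) → ℝ≥0∞) (D.Dv M w) * D.cnt N w B M = _
  rw [← ENNReal.tsum_fiberwise _ q]
  refine tsum_congr fun Y => ?_
  have h1 : ∀ w : q ⁻¹' {Y}, D.cnt N w.1.1 B M = D.cnt N (classRep Y) B M := by
    rintro ⟨w, hw⟩
    refine D.cnt_congr (fun i => ?_) B M
    rw [dvd_iff_mk_eq, mk_classRep]
    exact congrFun hw i
  simp only [h1, ENNReal.tsum_mul_right]
  congr 1
  let E : q ⁻¹' {Y} → cong N (classRep Y) := fun w => ⟨w.1.1, w.1.2, fun i => by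
    rw [dvd_iff_mk_eq, mk_classRep]
    exact congrFun w.2 i⟩
  have hE : Function.Bijective E := by
    constructor
    · intro a b h
      have h' : (a.1.1 : Fin (e + 1) → Λ) = b.1.1 := congrArg (fun z => z.1) h
      exact Subtype.ext (Subtype.ext h')
    · rintro ⟨w, h0, hw⟩
      refine ⟨⟨⟨w, h0⟩, funext fun i => ?_⟩, rfl⟩
      have := hw i
      rwa [dvd_iff_mk_eq, mk_classRep] at this
  exact (Equiv.ofBijective E hE).tsum_eq
    (fun w => A.indicator (1 : (Fin (e + 1) → R) → ℝ≥0∞) (D.Dv M w))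

instance (N : Λ) : Countable (Λ ⧸ Ideal.span {N}) := Quotient.countable

variable {D}

lemma IsWeight.lintegral_sqd_le {e : ℕ} {φ : (Fin (e + 3) → Fin (e + 3) → R) → ℝ≥0∞}
    {φ' : (Fin (e + 2) → Fin (e + 2) → R) → ℝ≥0∞} (h : D.IsWeight φ) (h' : D.IsWeight φ')
    {N : Λ} (hN : N ≠ 0) (y : Fin (e + 3) → Λ) {A B : Set (Fin (e + 3) → R)}
    (hA : MeasurableSet A) (hB : MeasurableSet B) (hAt : volume A ≠ ∞) (hBt : volume B ≠ ∞)
    (hB0 : volume B ≠ 0) :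
    ∫⁻ M, φ M * sqd (D.cnt N y A M) (volume A / volume B * D.cnt N y B M) ≤
      D.mom φ' 1 * D.dep N (A.indicator 1) (A.indicator 1) +
        (volume A / volume B) ^ 2 * (D.mom φ' 1 * D.dep N (B.indicator 1) (B.indicator 1)) := by
  obtain ⟨φ'', h''⟩ := D.exists_isWeight e
  set t := volume A / volume B
  have htB : t * volume B = volume A := ENNReal.div_mul_cancel hB0 hBt
  let c := fun (Y : Fin (e + 3) → Λ ⧸ Ideal.span {N}) (A : Set (Fin (e + 3) → R))
    (M : Fin (e + 3) → Fin (e + 3) → R) => D.cnt N (classRep Y) A M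
  have hc : ∀ Y {A : Set (Fin (e + 3) → R)}, MeasurableSet A → Measurable (c Y A) :=
    fun Y A hA => D.measurable_cnt _ _ hA
  set a := (D.cmod (D.emb N))⁻¹ ^ (e + 3) * D.zeta (e + 3) * D.zeta (e + 2) * D.mom φ'' 2
  have ha : a ≠ ∞ := by
    refine ENNReal.mul_ne_top (ENNReal.mul_ne_top (ENNReal.mul_ne_top ?_ ?_) ?_) ?_
    · exact ENNReal.pow_ne_top (ENNReal.inv_ne_top.2 (D.cmod_ne_zero _ (D.isUnit_emb N hN)))
    · exact D.tsum_reps _ (by omega)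
    · exact D.tsum_reps _ (by omega)
    · exact h''.mom_le h''.lintegral_ne_top 2
  have hsm : ∀ {A B : Set (Fin (e + 3) → R)}, MeasurableSet A → MeasurableSet B →
      ∫⁻ M, φ M * ∑' Y, c Y A M * c Y B M = a * volume A * volume B +
        D.mom φ' 1 * D.dep N (A.indicator 1) (B.indicator 1) := by
    intro A B hA hB
    have := h.lintegral_secondMoment h' h'' (g := A.indicator 1) (g' := B.indicator 1)
      (measurable_one.indicator hA) (measurable_one.indicator hB) hN
    rw [lintegral_indicator_one hA, lintegral_indicator_one hB] at this
    rw [← this]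
    refine lintegral_congr fun M => ?_
    rw [D.tsum_mul_tsum_cong N A B M]
  have hmp : ∀ {A B : Set (Fin (e + 3) → R)}, MeasurableSet A → MeasurableSet B →
      Measurable fun M => φ M * ∑' Y, c Y A M * c Y B M := fun hA hB =>
    h.measurable.mul (Measurable.tsum fun Y => (hc Y hA).mul (hc Y hB))
  have hsq : Measurable fun M => φ M * ∑' Y, sqd (c Y A M) (t * c Y B M) :=
    h.measurable.mul (Measurable.tsum fun Y => (hc Y hA).sqd ((hc Y hB).const_mul _))
  have hid : (∫⁻ M, φ M * ∑' Y, sqd (c Y A M) (t * c Y B M)) +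
      2 * t * ∫⁻ M, φ M * ∑' Y, c Y A M * c Y B M =
      (∫⁻ M, φ M * ∑' Y, c Y A M * c Y A M) + t ^ 2 * ∫⁻ M, φ M * ∑' Y, c Y B M * c Y B M := by
    rw [← lintegral_const_mul _ (hmp hA hB), ← lintegral_const_mul _ (hmp hB hB),
      ← lintegral_add_left hsq, ← lintegral_add_left (hmp hA hA)]
    refine lintegral_congr fun M => ?_
    have e1 : (∑' Y, sqd (c Y A M) (t * c Y B M)) + 2 * t * ∑' Y, c Y A M * c Y B M =
        (∑' Y, c Y A M * c Y A M) + t ^ 2 * ∑' Y, c Y B M * c Y B M := by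
      rw [← ENNReal.tsum_mul_left, ← ENNReal.tsum_mul_left, ← ENNReal.tsum_add,
        ← ENNReal.tsum_add]
      refine tsum_congr fun Y => ?_
      have := sqd_add (c Y A M) (t * c Y B M)
      calc _ = sqd (c Y A M) (t * c Y B M) + 2 * (c Y A M * (t * c Y B M)) := by ring
        _ = _ := by rw [this]; ring
    calc _ = φ M * ((∑' Y, sqd (c Y A M) (t * c Y B M)) + 2 * t * ∑' Y, c Y A M * c Y B M) := by
          ring
      _ = _ := by rw [e1]; ring
  have hle : (∫⁻ M, φ M * ∑' Y, sqd (c Y A M) (t * c Y B M)) ≤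
      D.mom φ' 1 * D.dep N (A.indicator 1) (A.indicator 1) +
        t ^ 2 * (D.mom φ' 1 * D.dep N (B.indicator 1) (B.indicator 1)) := by
    rw [hsm hA hB, hsm hA hA, hsm hB hB] at hid
    have hfin : 2 * (a * volume A * volume A) ≠ ∞ :=
      ENNReal.mul_ne_top (by simp) (ENNReal.mul_ne_top (ENNReal.mul_ne_top ha hAt) hAt)
    refine (ENNReal.add_le_add_iff_right hfin).1 ?_
    calc _ ≤ (∫⁻ M, φ M * ∑' Y, sqd (c Y A M) (t * c Y B M)) +
          2 * t * (a * volume A * volume B +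
            D.mom φ' 1 * D.dep N (A.indicator 1) (B.indicator 1)) := by
          refine add_le_add le_rfl ?_
          calc 2 * (a * volume A * volume A) = 2 * t * (a * volume A * volume B) := by
                conv_lhs => rw [← htB]
                rw [← htB]
                ring
            _ ≤ _ := by gcongr; exact le_self_add
      _ = _ := by
          rw [hid, ← htB]
          ring
  refine le_trans (lintegral_mono fun M => ?_) hle
  refine mul_le_mul_right ?_ _
  have hY : ∀ C : Set (Fin (e + 3) → R), D.cnt N y C M =
      c (fun i => Ideal.Quotient.mk (Ideal.span {N}) (y i)) C M := fun C =>
    D.cnt_congr (fun i => by rw [dvd_iff_mk_eq, mk_classRep]) C M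
  rw [hY A, hY B]
  exact ENNReal.le_tsum (f := fun Y => sqd (c Y A M) (t * c Y B M)) _

theorem IsWeight.lintegral_sqd_volume_le {e : ℕ} {φ : (Fin (e + 3) → Fin (e + 3) → R) → ℝ≥0∞}
    {φ' : (Fin (e + 2) → Fin (e + 2) → R) → ℝ≥0∞} (h : D.IsWeight φ) (h' : D.IsWeight φ')
    {N : Λ} (hN : N ≠ 0) (y : Fin (e + 3) → Λ) {U : ℕ → Set (Fin (e + 3) → R)}
    (hU : D.IsExhaustion U) {K : ℝ≥0∞} (hK : K ≠ ∞)
    (hUK : ∀ l, D.dep N ((U l).indicator 1) ((U l).indicator 1) ≤ K * volume (U l))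
    {A : Set (Fin (e + 3) → R)} (hA : MeasurableSet A) (hAt : volume A ≠ ∞)
    (hAK : D.dep N (A.indicator 1) (A.indicator 1) ≤ K * volume A) :
    ∫⁻ M, φ M * sqd (D.cnt N y A M) ((D.cmod (D.emb N))⁻¹ ^ (e + 3) * volume A) ≤
      D.mom φ' 1 * K * volume A := by
  have hm : D.mom φ' 1 ≠ ∞ := h'.mom_le h'.lintegral_ne_top 1
  refine h.fatou (f := fun l M => sqd (D.cnt N y A M) (volume A / volume (U l) * D.cnt N y (U l) M))
    (B := fun l => D.mom φ' 1 * K * volume A +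
      volume A ^ 2 * (D.mom φ' 1 * K) * (1 / volume (U l)))
    (fun l => (D.measurable_cnt N y hA).sqd
      ((D.measurable_cnt N y (hU.measurableSet l)).const_mul _)) (fun M hM => ?_) (fun l => ?_) ?_
  · refine tendsto_sqd (ENNReal.mul_ne_top (ENNReal.pow_ne_top
      (ENNReal.inv_ne_top.2 (D.cmod_ne_zero _ (D.isUnit_emb N hN)))) hAt) ?_
    have := ENNReal.Tendsto.mul_const (b := volume A) (hU.tendsto_cnt hN y hM) (Or.inr hAt)
    refine this.congr fun l => ?_
    simp only [div_eq_mul_inv]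
    ring
  · refine (h.lintegral_sqd_le h' hN y hA (hU.measurableSet l) hAt (hU.volume_ne_top l)
      (hU.volume_ne_zero l)).trans (add_le_add ?_ ?_)
    · rw [mul_assoc]
      gcongr
    · calc _ ≤ (volume A / volume (U l)) ^ 2 * (D.mom φ' 1 * (K * volume (U l))) := by
            gcongr
            exact hUK l
        _ = volume A ^ 2 * (D.mom φ' 1 * K) * ((volume (U l))⁻¹ *
              ((volume (U l))⁻¹ * volume (U l))) := by
            simp only [div_eq_mul_inv]
            ring
        _ = _ := by
            rw [ENNReal.inv_mul_cancel (hU.volume_ne_zero l) (hU.volume_ne_top l), mul_one,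
              one_div]
  · have h2 : Filter.Tendsto (fun l => 1 / volume (U l)) Filter.atTop (nhds 0) := by
      simp only [one_div]
      rw [← ENNReal.inv_top]
      exact tendsto_inv_iff.2 hU.tendsto_volume
    have h3 := (ENNReal.Tendsto.const_mul (a := volume A ^ 2 * (D.mom φ' 1 * K)) h2
      (Or.inr (ENNReal.mul_ne_top (ENNReal.pow_ne_top hAt) (ENNReal.mul_ne_top hm hK)))).const_add
      (D.mom φ' 1 * K * volume A)
    simpa using h3

end LatticeRing

/-- A proper normed field with a Haar measure that multiplication scales by the norm. -/
class PlaceField (K : Type*) [NormedField K] [MeasureSpace K] : Prop extends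
    BorelSpace K, ProperSpace K where
  isAddHaarMeasure : (volume : Measure K).IsAddHaarMeasure
  map_mul : ∀ a : K, a ≠ 0 → (volume : Measure K).map (fun x => a * x) = ‖a‖ₑ⁻¹ • volume
  volume_zero : volume ({0} : Set K) = 0

attribute [instance] PlaceField.isAddHaarMeasure

lemma enorm_finset_prod {K κ : Type*} [NormedField K] (s : Finset κ) (f : κ → K) :
    ‖∏ i ∈ s, f i‖ₑ = ∏ i ∈ s, ‖f i‖ₑ := by
  classical
  induction s using Finset.induction_on with
  | empty => simp
  | insert a s ha ih => rw [Finset.prod_insert ha, Finset.prod_insert ha, enorm_mul, ih]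

section OnePlace

variable {K : Type*} [NormedField K] [MeasureSpace K] [PlaceField K]

lemma PlaceField.volume_preimage_mul {a : K} (ha : a ≠ 0) {S : Set K} (hS : MeasurableSet S) :
    volume ((fun x => a * x) ⁻¹' S) = ‖a‖ₑ⁻¹ * volume S := by
  rw [← Measure.map_apply (measurable_const_mul a) hS, PlaceField.map_mul a ha]
  rfl

variable {κ : Type*} [Fintype κ] [DecidableEq κ]

lemma measurable_toLin' (M : Matrix κ κ K) : Measurable (toLin' M) :=
  (LinearMap.continuous_on_pi _).measurable

lemma measurePreserving_transvectionStruct (t : TransvectionStruct κ K) :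
    MeasurePreserving (toLin' t.toMatrix) := by
  have ht := measurable_toLin' t.toMatrix
  refine ⟨ht, ?_⟩
  refine (Measure.pi_eq fun s hs ↦ ?_).symm
  have h2s : MeasurableSet (Set.univ.pi s) := .pi Set.countable_univ fun i _ ↦ hs i
  simp_rw [← Measure.pi_pi, ← lintegral_indicator_one h2s]
  rw [lintegral_map (measurable_one.indicator h2s) ht, volume_pi]
  refine lintegral_eq_of_lmarginal_eq {t.i} ((measurable_one.indicator h2s).comp ht)
    (measurable_one.indicator h2s) ?_
  simp_rw [lmarginal_singleton]
  ext x
  cases t with | mk t_i t_j t_hij t_c =>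
  simp [transvection, single_mulVec, t_hij.symm, ← Function.update_add,
    lintegral_add_right_eq_self fun xᵢ ↦ Set.indicator (Set.univ.pi s) 1 (Function.update x t_i xᵢ)]

lemma map_diagonal_volume {D : κ → K} (hD : det (diagonal D) ≠ 0) :
    Measure.map (toLin' (diagonal D)) volume = ‖det (diagonal D)‖ₑ⁻¹ • volume := by
  have hD' : ∀ i, D i ≠ 0 := by
    simpa [Finset.prod_ne_zero_iff] using hD
  have h0 : ‖det (diagonal D)‖ₑ ≠ 0 := by simpa using hD
  have key : (volume : Measure (κ → K)) =
      ‖det (diagonal D)‖ₑ • Measure.map (toLin' (diagonal D)) volume := by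
    refine Measure.pi_eq fun s hs => ?_
    have hpre : (toLin' (diagonal D) : (κ → K) → κ → K) ⁻¹' Set.univ.pi s =
        Set.univ.pi fun i => (fun x => D i * x) ⁻¹' s i := by
      ext x
      simp [mulVec_diagonal]
    rw [Measure.smul_apply, Measure.map_apply (measurable_toLin' _) (MeasurableSet.univ_pi hs), hpre,
      volume_pi_pi]
    simp_rw [fun i => PlaceField.volume_preimage_mul (hD' i) (hs i)]
    rw [Finset.prod_mul_distrib, smul_eq_mul, ← mul_assoc, det_diagonal]
    have : ‖∏ i, D i‖ₑ * ∏ i, ‖D i‖ₑ⁻¹ = 1 := by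
      rw [enorm_finset_prod, ← Finset.prod_mul_distrib]
      refine Finset.prod_eq_one fun i _ => ENNReal.mul_inv_cancel (by simpa using hD' i) enorm_ne_top
    rw [this, one_mul]
  conv_rhs => rw [key]
  rw [smul_smul, ENNReal.inv_mul_cancel h0 enorm_ne_top, one_smul]

lemma map_matrix_volume {M : Matrix κ κ K} (hM : det M ≠ 0) :
    Measure.map (toLin' M) volume = ‖det M‖ₑ⁻¹ • volume := by
  apply diagonal_transvection_induction_of_det_ne_zero _ M hM
  · intro D hD
    exact map_diagonal_volume hD
  · intro t
    rw [(measurePreserving_transvectionStruct t).map_eq]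
    simp
  · intro A B hA hB IHA IHB
    rw [toLin'_mul, det_mul, LinearMap.coe_comp, ← Measure.map_map (measurable_toLin' _)
      (measurable_toLin' _), IHB, Measure.map_smul, IHA, smul_smul, enorm_mul,
      ENNReal.mul_inv (Or.inr enorm_ne_top) (Or.inl enorm_ne_top), mul_comm]

end OnePlace

section Swap

variable {ι κ : Type*} [Fintype ι] [Fintype κ] {K : ι → Type*} [∀ v, MeasureSpace (K v)]
  [∀ v, SigmaFinite (volume : Measure (K v))]

/-- Exchanging the coordinate index and the place index. -/
def swapPlaces (x : κ → ∀ v, K v) : ∀ v, κ → K v := fun v j => x j v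

lemma measurable_swapPlaces : Measurable (swapPlaces : (κ → ∀ v, K v) → ∀ v, κ → K v) := by
  unfold swapPlaces
  fun_prop

lemma measurePreserving_swapPlaces :
    MeasurePreserving (swapPlaces : (κ → ∀ v, K v) → ∀ v, κ → K v) := by
  refine ⟨measurable_swapPlaces, ?_⟩
  symm
  refine Measure.pi_eq_generateFrom (C := fun v => Set.univ.pi '' Set.univ.pi fun _ : κ =>
      {s : Set (K v) | MeasurableSet s}) (fun v => generateFrom_pi)
    (fun v => isPiSystem_pi) (fun v => Measure.FiniteSpanningSetsIn.pi
      fun _ => (volume : Measure (K v)).toFiniteSpanningSetsIn) fun s hs => ?_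
  choose b hb hbs using hs
  obtain rfl : (fun v => Set.univ.pi (b v)) = s := funext hbs
  have hb' : ∀ v j, MeasurableSet (b v j) := fun v j => hb v j trivial
  have hms : MeasurableSet (Set.univ.pi fun v => Set.univ.pi (b v)) :=
    MeasurableSet.univ_pi fun v => MeasurableSet.univ_pi fun j => hb' v j
  refine (Measure.map_apply measurable_swapPlaces hms).trans ?_
  have hpre : (swapPlaces : (κ → ∀ v, K v) → ∀ v, κ → K v) ⁻¹'
      (Set.univ.pi fun v => Set.univ.pi (b v)) =
      Set.univ.pi fun j => Set.univ.pi fun v => b v j := by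
    ext x
    simp only [Set.mem_preimage, Set.mem_univ_pi, swapPlaces]
    exact forall_comm
  rw [hpre, volume_pi_pi]
  simp_rw [volume_pi_pi, Measure.pi_pi]
  exact Finset.prod_comm

end Swap

lemma ENNReal.tendsto_prod_of_ne_zero {κ : Type*} (s : Finset κ) {f : κ → ℕ → ℝ≥0∞} {a : κ → ℝ≥0∞}
    (h : ∀ k ∈ s, Filter.Tendsto (f k) Filter.atTop (nhds (a k))) (ha : ∀ k ∈ s, a k ≠ 0) :
    Filter.Tendsto (fun l => ∏ k ∈ s, f k l) Filter.atTop (nhds (∏ k ∈ s, a k)) := by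
  classical
  induction s using Finset.induction_on with
  | empty => simp
  | insert b s hb ih =>
    simp only [Finset.prod_insert hb]
    refine ENNReal.Tendsto.mul (h b (by simp)) (Or.inl (ha b (by simp)))
      (ih (fun k hk => h k (by simp [hk])) (fun k hk => ha k (by simp [hk]))) (Or.inl ?_)
    exact Finset.prod_ne_zero_iff.2 fun k hk => ha k (by simp [hk])

section Places

variable {ι : Type*} [Fintype ι] {K : ι → Type*} [∀ v, NormedField (K v)]
  [∀ v, MeasureSpace (K v)] [∀ v, PlaceField (K v)]

/-- The set of vectors whose component at each place `v` lies in `A v`. -/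
def rect {κ : Type*} (A : ∀ v, Set (κ → K v)) : Set (κ → ∀ v, K v) :=
  swapPlaces ⁻¹' Set.univ.pi A

lemma mem_rect {κ : Type*} {A : ∀ v, Set (κ → K v)} {x : κ → ∀ v, K v} :
    x ∈ rect A ↔ ∀ v, (fun j => x j v) ∈ A v := by
  simp only [rect, Set.mem_preimage, Set.mem_univ_pi]
  rfl

lemma measurableSet_rect {κ : Type*} [Fintype κ] {A : ∀ v, Set (κ → K v)}
    (hA : ∀ v, MeasurableSet (A v)) : MeasurableSet (rect A) :=
  measurable_swapPlaces (MeasurableSet.univ_pi hA)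

lemma volume_rect {κ : Type*} [Fintype κ] {A : ∀ v, Set (κ → K v)}
    (hA : ∀ v, MeasurableSet (A v)) : volume (rect A) = ∏ v, volume (A v) := by
  rw [rect, measurePreserving_swapPlaces.measure_preimage (MeasurableSet.univ_pi hA).nullMeasurableSet,
    volume_pi_pi]

/-- The product of the norms of the components. -/
def pmod (x : ∀ v, K v) : ℝ≥0∞ := ∏ v, ‖x v‖ₑ

lemma isUnit_iff_ne_zero_apply {x : ∀ v, K v} : IsUnit x ↔ ∀ v, x v ≠ 0 := by
  simp [Pi.isUnit_iff, isUnit_iff_ne_zero]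

lemma pmod_ne_zero {x : ∀ v, K v} (hx : IsUnit x) : pmod x ≠ 0 :=
  Finset.prod_ne_zero_iff.2 fun v _ => by simpa using isUnit_iff_ne_zero_apply.1 hx v

lemma pmod_ne_top (x : ∀ v, K v) : pmod x ≠ ∞ :=
  ENNReal.prod_ne_top fun _ _ => enorm_ne_top

lemma pmod_mul (x y : ∀ v, K v) : pmod (x * y) = pmod x * pmod y := by
  simp [pmod, enorm_mul, Finset.prod_mul_distrib]

lemma measurable_pmod : Measurable (pmod : (∀ v, K v) → ℝ≥0∞) :=
  Finset.measurable_prod _ fun v _ => (measurable_pi_apply v).enorm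

lemma det_apply_place {k : ℕ} (M : Fin k → Fin k → ∀ v, K v) (v : ι) :
    (Matrix.of M).det v = (Matrix.of fun i j => M i j v).det := by
  have := RingHom.map_det (Pi.evalRingHom K v) (Matrix.of M)
  exact this

lemma lintegral_vecMul_place {k : ℕ} {M : Fin k → Fin k → ∀ v, K v}
    (hM : IsUnit (Matrix.of M).det) {h : (Fin k → ∀ v, K v) → ℝ≥0∞} (hh : Measurable h) :
    pmod (Matrix.of M).det * ∫⁻ x : Fin k → ∀ v, K v, h (fun j => ∑ i, x i * M i j) = ∫⁻ x, h x := by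
  have hd : ∀ v, ((Matrix.of fun i j => M i j v)ᵀ).det ≠ 0 := fun v => by
    rw [det_transpose, ← det_apply_place]
    exact isUnit_iff_ne_zero_apply.1 hM v
  let F : (∀ v, Fin k → K v) → ∀ v, Fin k → K v :=
    fun x v => toLin' ((Matrix.of fun i j => M i j v)ᵀ) (x v)
  have hF : Measurable F := measurable_pi_lambda _ fun v =>
    (measurable_toLin' _).comp (measurable_pi_apply v)
  have key : (volume : Measure (∀ v, Fin k → K v)) =
      pmod (Matrix.of M).det • Measure.map F volume := by
    refine Measure.pi_eq fun s hs => ?_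
    have hpre : F ⁻¹' Set.univ.pi s =
        Set.univ.pi fun v => toLin' ((Matrix.of fun i j => M i j v)ᵀ) ⁻¹' s v := by
      ext x
      simp [F]
    rw [Measure.smul_apply, Measure.map_apply hF (MeasurableSet.univ_pi hs), hpre, volume_pi_pi]
    have h1 : ∀ v, volume (toLin' ((Matrix.of fun i j => M i j v)ᵀ) ⁻¹' s v) =
        ‖(Matrix.of M).det v‖ₑ⁻¹ * volume (s v) := fun v => by
      rw [← Measure.map_apply (measurable_toLin' _) (hs v), map_matrix_volume (hd v),
        det_transpose, ← det_apply_place]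
      rfl
    simp_rw [h1]
    rw [Finset.prod_mul_distrib, smul_eq_mul, ← mul_assoc, pmod, ← Finset.prod_mul_distrib,
      Finset.prod_eq_one, one_mul]
    exact fun v _ => ENNReal.mul_inv_cancel
      (by simpa using isUnit_iff_ne_zero_apply.1 hM v) enorm_ne_top
  let G : (∀ v, Fin k → K v) → Fin k → ∀ v, K v := fun x j v => x v j
  have hG : Measurable G := by fun_prop
  have e1 : ∀ f : (Fin k → ∀ v, K v) → ℝ≥0∞, Measurable f → ∫⁻ x, f x = ∫⁻ y, f (G y) := fun f hf =>
    (measurePreserving_swapPlaces.lintegral_comp (hf.comp hG)).symm.symm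
  have hV : Measurable fun x : Fin k → ∀ v, K v => fun j => ∑ i, x i * M i j := by fun_prop
  have hhV : Measurable fun x : Fin k → ∀ v, K v => h (fun j => ∑ i, x i * M i j) := hh.comp hV
  rw [e1 _ hhV, e1 _ hh]
  conv_rhs => rw [key]
  have hhG : Measurable fun y : ∀ v, Fin k → K v => h (G y) := hh.comp hG
  rw [lintegral_smul_measure, lintegral_map hhG hF, smul_eq_mul]
  congr 1
  refine lintegral_congr fun y => congrArg h ?_
  funext j v
  simp [F, G, mulVec, dotProduct, mul_comm]

lemma lintegral_mul_place {a : ∀ v, K v} (ha : IsUnit a) {h : (∀ v, K v) → ℝ≥0∞}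
    (hh : Measurable h) : pmod a * ∫⁻ x, h (a * x) = ∫⁻ x, h x := by
  have hm : Measurable fun x : ∀ v, K v => a * x := by fun_prop
  have ha' := isUnit_iff_ne_zero_apply.1 ha
  have key : (volume : Measure (∀ v, K v)) =
      pmod a • Measure.map (fun x : ∀ v, K v => a * x) volume := by
    refine Measure.pi_eq fun s hs => ?_
    have hpre : (fun x : ∀ v, K v => a * x) ⁻¹' Set.univ.pi s =
        Set.univ.pi fun v => (fun x => a v * x) ⁻¹' s v := by
      ext x
      simp
    rw [Measure.smul_apply, Measure.map_apply hm (MeasurableSet.univ_pi hs), hpre, volume_pi_pi]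
    simp_rw [fun v => PlaceField.volume_preimage_mul (ha' v) (hs v)]
    rw [Finset.prod_mul_distrib, smul_eq_mul, ← mul_assoc, pmod, ← Finset.prod_mul_distrib,
      Finset.prod_eq_one, one_mul]
    exact fun v _ => ENNReal.mul_inv_cancel (by simpa using ha' v) enorm_ne_top
  conv_rhs => rw [key]
  rw [lintegral_smul_measure, lintegral_map hh hm, smul_eq_mul]

lemma ae_isUnit_place : ∀ᵐ x : ∀ v, K v, IsUnit x := by
  simp only [isUnit_iff_ne_zero_apply]
  rw [ae_all_iff]
  intro v
  have : ∀ᵐ x : K v, x ≠ 0 := by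
    rw [ae_iff]
    simpa using PlaceField.volume_zero (K := K v)
  exact (Measure.quasiMeasurePreserving_eval (μ := fun v => (volume : Measure (K v))) v).ae this

lemma measurable_inverse_place : Measurable (Ring.inverse : (∀ v, K v) → ∀ v, K v) := by
  classical
  have : (Ring.inverse : (∀ v, K v) → ∀ v, K v) =
      fun x : ∀ v, K v => if ∀ v, x v ≠ 0 then fun v => (x v)⁻¹ else 0 := by
    funext x
    split_ifs with hx
    · have hu : IsUnit x := isUnit_iff_ne_zero_apply.2 hx
      have h1 : x * (fun v => (x v)⁻¹) = 1 := funext fun v => mul_inv_cancel₀ (hx v)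
      calc Ring.inverse x = Ring.inverse x * (x * (fun v => (x v)⁻¹)) := by rw [h1, mul_one]
        _ = _ := by rw [← mul_assoc, Ring.inverse_mul_cancel _ hu, one_mul]
    · exact Ring.inverse_non_unit _ fun hu => hx (isUnit_iff_ne_zero_apply.1 hu)
  rw [this]
  refine Measurable.ite ?_ (by fun_prop) measurable_const
  have : {x : ∀ v, K v | ∀ v, x v ≠ 0} = ⋂ v, (fun x => x v) ⁻¹' {0}ᶜ := by
    ext x; simp
  rw [this]
  exact MeasurableSet.iInter fun v => measurable_pi_apply v (measurableSet_singleton 0).compl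

/-- The box of vectors whose coordinates at each place `v` have norm at most `r v`. -/
def box (K : ι → Type*) [∀ v, NormedField (K v)] (κ : Type*) (r : ι → ℝ) : Set (κ → ∀ v, K v) :=
  Set.univ.pi fun _ => Set.univ.pi fun v => Metric.closedBall 0 (r v)

lemma mem_box {κ : Type*} {r : ι → ℝ} {x : κ → ∀ v, K v} :
    x ∈ box K κ r ↔ ∀ j v, ‖x j v‖ ≤ r v := by
  simp [box]

variable {κ : Type*} [Fintype κ]

lemma measurableSet_box (r : ι → ℝ) : MeasurableSet (box K κ r) :=
  MeasurableSet.univ_pi fun _ => MeasurableSet.univ_pi fun _ => Metric.isClosed_closedBall.measurableSet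

lemma volume_box (r : ι → ℝ) :
    volume (box K κ r) = ∏ _j : κ, ∏ v, volume (Metric.closedBall (0 : K v) (r v)) := by
  rw [box, volume_pi_pi]
  simp_rw [volume_pi_pi]

lemma volume_box_ne_top (r : ι → ℝ) : volume (box K κ r) ≠ ∞ := by
  rw [volume_box]
  exact ENNReal.prod_ne_top fun _ _ => ENNReal.prod_ne_top fun v _ =>
    (isCompact_closedBall (0 : K v) (r v)).measure_lt_top.ne

lemma volume_box_ne_zero {r : ι → ℝ} (hr : ∀ v, 0 < r v) : volume (box K κ r) ≠ 0 := by
  rw [volume_box]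
  exact Finset.prod_ne_zero_iff.2 fun _ _ => Finset.prod_ne_zero_iff.2 fun v _ =>
    (Metric.measure_closedBall_pos _ _ (hr v)).ne'

variable {Λ : Type*} [CommRing Λ] [Countable Λ]

lemma box_tsum_sandwich {emb : Λ →+* ∀ v, K v} {tile : Set (∀ v, K v)}
    (hT : IsTile emb.toAddMonoidHom tile) (h1 : volume tile = 1) {B : ℝ}
    (hB : ∀ x ∈ tile, ∀ v, ‖x v‖ ≤ B) {d : ℕ} (M : Fin d → Fin d → ∀ v, K v)
    (hM : IsUnit (Matrix.of M).det) : ∃ C : ℝ, ∀ (z : Fin d → ∀ v, K v) (r : ι → ℝ),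
      (pmod (Matrix.of M).det)⁻¹ * volume (box K (Fin d) fun v => r v - C) ≤
        ∑' w : Fin d → Λ, (box K (Fin d) r).indicator (1 : (Fin d → ∀ v, K v) → ℝ≥0∞)
          (fun j => z j + ∑ i, emb (w i) * M i j) ∧
      ∑' w : Fin d → Λ, (box K (Fin d) r).indicator (1 : (Fin d → ∀ v, K v) → ℝ≥0∞)
          (fun j => z j + ∑ i, emb (w i) * M i j) ≤
        (pmod (Matrix.of M).det)⁻¹ * volume (box K (Fin d) fun v => r v + C) := by
  have hTd := hT.pi (κ := Fin d)
  set T : Set (Fin d → ∀ v, K v) := Set.univ.pi fun _ => tile with hTdef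
  have hT1 : volume T = 1 := by
    rw [hTdef, volume_pi_pi]
    simp [h1]
  let L : (Fin d → ∀ v, K v) → Fin d → ∀ v, K v := fun t j => ∑ i, t i * M i j
  obtain ⟨C, hC⟩ : ∃ C : ℝ, ∀ t ∈ T, ∀ j v, ‖L t j v‖ ≤ C := by
    refine ⟨∑ j, ∑ v, ∑ i, |B| * ‖M i j v‖, fun t ht j v => ?_⟩
    calc ‖L t j v‖ = ‖∑ i, t i v * M i j v‖ := by simp [L]
      _ ≤ ∑ i, |B| * ‖M i j v‖ := by
          refine (norm_sum_le _ _).trans (Finset.sum_le_sum fun i _ => ?_)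
          rw [norm_mul]
          exact mul_le_mul_of_nonneg_right ((hB _ (ht i trivial) v).trans (le_abs_self B))
            (norm_nonneg _)
      _ ≤ ∑ v, ∑ i, |B| * ‖M i j v‖ := Finset.single_le_sum
          (f := fun v => ∑ i, |B| * ‖M i j v‖)
          (fun v _ => Finset.sum_nonneg fun i _ => by positivity) (Finset.mem_univ v)
      _ ≤ _ := Finset.single_le_sum
          (f := fun j => ∑ v, ∑ i, |B| * ‖M i j v‖)
          (fun j _ => Finset.sum_nonneg fun v _ => Finset.sum_nonneg fun i _ => by positivity)
          (Finset.mem_univ j)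
  have hLm : Measurable L := by fun_prop
  have hp0 := pmod_ne_zero hM
  have hpt := pmod_ne_top (Matrix.of M).det
  have havg : ∀ (z : Fin d → ∀ v, K v) (r : ι → ℝ),
      ∫⁻ t, T.indicator 1 t * ∑' w : Fin d → Λ, (box K (Fin d) r).indicator
        (1 : (Fin d → ∀ v, K v) → ℝ≥0∞) (fun j => z j + L t j + ∑ i, emb (w i) * M i j) =
      (pmod (Matrix.of M).det)⁻¹ * volume (box K (Fin d) r) := by
    intro z r
    have hb : Measurable ((box K (Fin d) r).indicator (1 : (Fin d → ∀ v, K v) → ℝ≥0∞)) :=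
      measurable_one.indicator (measurableSet_box r)
    have hb1 : Measurable fun y : Fin d → ∀ v, K v =>
        (box K (Fin d) r).indicator (1 : (Fin d → ∀ v, K v) → ℝ≥0∞) (z + y) :=
      hb.comp (measurable_const_add z)
    have e1 := hTd.lintegral_unfold (hb1.comp hLm)
    have e2 := lintegral_vecMul_place hM hb1
    rw [lintegral_add_left_eq_self, lintegral_indicator_one (measurableSet_box r)] at e2
    rw [← e2, ← mul_assoc, ENNReal.inv_mul_cancel hp0 hpt, one_mul]
    refine Eq.trans (lintegral_congr fun t => ?_) e1
    congr 1
    refine tsum_congr fun w => congrArg _ ?_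
    funext j
    simp [L, add_mul, Finset.sum_add_distrib, add_assoc]
  have hone : ∀ c : ℝ≥0∞, ∫⁻ t, T.indicator 1 t * c = c := fun c => by
    have : Measurable fun t => T.indicator (1 : (Fin d → ∀ v, K v) → ℝ≥0∞) t :=
      measurable_one.indicator hTd.measurableSet
    rw [lintegral_mul_const _ this, lintegral_indicator_one hTd.measurableSet, hT1, one_mul]
  have hmono : ∀ (r r' : ι → ℝ) (x y : Fin d → ∀ v, K v), (∀ j v, ‖y j v‖ ≤ r' v - r v) →
      (box K (Fin d) r).indicator (1 : (Fin d → ∀ v, K v) → ℝ≥0∞) x ≤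
      (box K (Fin d) r').indicator (1 : (Fin d → ∀ v, K v) → ℝ≥0∞) (x + y) := by
    intro r r' x y hy
    by_cases hx : x ∈ box K (Fin d) r
    · rw [Set.indicator_of_mem hx, Set.indicator_of_mem]
      · rfl
      · rw [mem_box] at hx ⊢
        intro j v
        refine (norm_add_le (x j v) (y j v)).trans ?_
        linarith [hx j v, hy j v]
    · rw [Set.indicator_of_notMem hx]
      exact zero_le
  refine ⟨C, fun z r => ⟨?_, ?_⟩⟩
  · rw [← havg z, ← hone (∑' _, _)]
    refine lintegral_mono fun t => ?_
    by_cases ht : t ∈ T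
    · refine mul_le_mul_right (ENNReal.tsum_le_tsum fun w => ?_) _
      refine (hmono _ r _ (-L t) fun j v => ?_).trans_eq (congrArg _ ?_)
      · simpa using hC t ht j v
      · funext j
        simp only [Pi.add_apply, Pi.neg_apply]
        abel
    · simp [Set.indicator_of_notMem ht]
  · rw [← havg z, ← hone (∑' _, _)]
    refine lintegral_mono fun t => ?_
    by_cases ht : t ∈ T
    · refine mul_le_mul_right (ENNReal.tsum_le_tsum fun w => ?_) _
      refine (hmono _ (fun v => r v + C) _ (L t) fun j v => ?_).trans_eq (congrArg _ ?_)
      · simpa using hC t ht j v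
      · funext j
        simp only [Pi.add_apply]
        abel
    · simp [Set.indicator_of_notMem ht]

lemma box_exhaustion [Nonempty ι] {emb : Λ →+* ∀ v, K v} {tile : Set (∀ v, K v)}
    (hT : IsTile emb.toAddMonoidHom tile) (h1 : volume tile = 1) {B : ℝ}
    (hB : ∀ x ∈ tile, ∀ v, ‖x v‖ ≤ B) {ρ : ι → ℕ → ℝ} (hρ0 : ∀ v l, 0 < ρ v l)
    (hρ : ∀ v, Filter.Tendsto (ρ v) Filter.atTop Filter.atTop)
    (hvol : ∀ v, Filter.Tendsto (fun l => volume (Metric.closedBall (0 : K v) (ρ v l)))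
      Filter.atTop (nhds ∞))
    (hratio : ∀ v C, Filter.Tendsto (fun l => volume (Metric.closedBall (0 : K v) (ρ v l + C)) /
      volume (Metric.closedBall (0 : K v) (ρ v l))) Filter.atTop (nhds 1)) (d : ℕ) :
    ∃ U : ℕ → Set (Fin (d + 1) → ∀ v, K v), (∀ l, U l = box K (Fin (d + 1)) fun v => ρ v l) ∧
    (∀ l, MeasurableSet (U l)) ∧
    (∀ l, volume (U l) ≠ 0) ∧ (∀ l, volume (U l) ≠ ∞) ∧
    Filter.Tendsto (fun l => volume (U l)) Filter.atTop (nhds ∞) ∧ (∀ x, ∃ l, x ∈ U l) ∧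
    ∀ M : Fin (d + 1) → Fin (d + 1) → ∀ v, K v, IsUnit (Matrix.det (Matrix.of M)) →
      ∀ z : Fin (d + 1) → ∀ v, K v, (∀ l, ∑' w : Fin (d + 1) → Λ,
        (U l).indicator (1 : (Fin (d + 1) → ∀ v, K v) → ℝ≥0∞) (fun j => z j + ∑ i, emb (w i) * M i j) ≠ ∞) ∧
      Filter.Tendsto (fun l => (∑' w : Fin (d + 1) → Λ,
        (U l).indicator (1 : (Fin (d + 1) → ∀ v, K v) → ℝ≥0∞) (fun j => z j + ∑ i, emb (w i) * M i j)) / volume (U l))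
        Filter.atTop (nhds (pmod (Matrix.det (Matrix.of M)))⁻¹) := by
  refine ⟨fun l => box K (Fin (d + 1)) fun v => ρ v l, fun l => rfl, fun l => measurableSet_box _,
    fun l => volume_box_ne_zero fun v => hρ0 v l, fun l => volume_box_ne_top _, ?_, fun x => ?_,
    fun M hM z => ?_⟩
  · simp_rw [volume_box]
    have := ENNReal.tendsto_prod_of_ne_zero (Finset.univ : Finset (Fin (d + 1)))
      (fun _ _ => ENNReal.tendsto_prod_of_ne_zero (Finset.univ : Finset ι) (fun v _ => hvol v)
        (fun v _ => ENNReal.top_ne_zero))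
      (fun _ _ => Finset.prod_ne_zero_iff.2 fun v _ => ENNReal.top_ne_zero)
    convert this using 2
    simp [Finset.prod_const, ENNReal.top_pow, Fintype.card_ne_zero]
  · have : ∀ᶠ l in Filter.atTop, ∀ j v, ‖x j v‖ ≤ ρ v l := by
      rw [Filter.eventually_all]
      intro j
      rw [Filter.eventually_all]
      exact fun v => (hρ v).eventually_ge_atTop _
    obtain ⟨l, hl⟩ := this.exists
    exact ⟨l, mem_box.2 hl⟩
  · obtain ⟨C, hC⟩ := box_tsum_sandwich hT h1 hB M hM
    have hp0 := pmod_ne_zero hM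
    refine ⟨fun l => ne_top_of_le_ne_top (ENNReal.mul_ne_top (ENNReal.inv_ne_top.2 hp0)
      (volume_box_ne_top _)) (hC z _).2, ?_⟩
    have hr : ∀ C : ℝ, Filter.Tendsto (fun l => (pmod (Matrix.det (Matrix.of M)))⁻¹ *
        volume (box K (Fin (d + 1)) fun v => ρ v l + C) / volume (box K (Fin (d + 1)) fun v => ρ v l))
        Filter.atTop (nhds (pmod (Matrix.det (Matrix.of M)))⁻¹) := by
      intro C
      have h2 := ENNReal.tendsto_prod_of_ne_zero (Finset.univ : Finset (Fin (d + 1)))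
        (fun _ _ => ENNReal.tendsto_prod_of_ne_zero (Finset.univ : Finset ι)
          (fun v _ => hratio v C) (fun v _ => one_ne_zero)) (fun _ _ => by simp)
      have h3 := ENNReal.Tendsto.const_mul (a := (pmod (Matrix.det (Matrix.of M)))⁻¹) h2
        (Or.inl (by simp))
      simp only [Finset.prod_const_one, mul_one] at h3
      refine h3.congr fun l => ?_
      rw [mul_div_assoc]
      congr 1
      rw [volume_box, volume_box, div_eq_mul_inv]
      rw [ENNReal.prod_inv_distrib]
      · rw [← Finset.prod_mul_distrib]
        refine Finset.prod_congr rfl fun j _ => ?_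
        rw [ENNReal.prod_inv_distrib, ← Finset.prod_mul_distrib]
        · rfl
        · intro v _ v' _ _
          exact Or.inl (Metric.measure_closedBall_pos _ _ (hρ0 v l)).ne'
      · intro j _ j' _ _
        refine Or.inl (Finset.prod_ne_zero_iff.2 fun v _ => ?_)
        exact (Metric.measure_closedBall_pos _ _ (hρ0 v l)).ne'
    refine tendsto_of_tendsto_of_tendsto_of_le_of_le (hr (-C)) (hr C) (fun l => ?_) (fun l => ?_)
    · exact ENNReal.div_le_div_right (hC z _).1 _
    · exact ENNReal.div_le_div_right (hC z _).2 _

end Places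

section Padic

variable {p : ℕ} [hp : Fact p.Prime]

lemma padic_exists_digit {a x : ℚ_[p]} (ha : a ≠ 0) (hx : ‖x‖ ≤ ‖a‖) :
    ∃ n ∈ Finset.range p, ‖x - n * a‖ ≤ ‖a‖ / p := by
  have h1 : ‖x / a‖ ≤ 1 := by
    rw [norm_div]; exact div_le_one_of_le₀ hx (norm_nonneg _)
  obtain ⟨n, hn, hm⟩ := PadicInt.exists_mem_range (⟨x / a, h1⟩ : ℤ_[p])
  refine ⟨n, Finset.mem_range.2 hn, ?_⟩
  have h2 : ‖(⟨x / a, h1⟩ - n : ℤ_[p])‖ ≤ (p : ℝ) ^ (-(1 : ℕ) : ℤ) := by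
    rw [PadicInt.norm_le_pow_iff_mem_span_pow, pow_one, ← PadicInt.maximalIdeal_eq_span_p]
    exact hm
  rw [PadicInt.norm_def] at h2
  have h3 : x - n * a = (x / a - n) * a := by field_simp
  have h4 : ‖x / a - n‖ ≤ (p : ℝ)⁻¹ := by
    rw [Nat.cast_one, _root_.zpow_neg_one] at h2
    exact h2
  rw [h3, norm_mul, div_eq_inv_mul ‖a‖]
  exact mul_le_mul_of_nonneg_right h4 (norm_nonneg a)

lemma padic_digit_unique {a x : ℚ_[p]} (ha : a ≠ 0) {n n' : ℕ} (hn : n < p) (hn' : n' < p)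
    (h : ‖x - n * a‖ ≤ ‖a‖ / p) (h' : ‖x - n' * a‖ ≤ ‖a‖ / p) : n = n' := by
  have h1 : ‖(((n : ℤ) - n' : ℤ) : ℚ_[p]) * a‖ ≤ ‖a‖ / p := by
    have : (((n : ℤ) - n' : ℤ) : ℚ_[p]) * a = (x - n' * a) + -(x - n * a) := by
      push_cast; ring
    rw [this]
    refine (Padic.nonarchimedean _ _).trans (max_le h' ?_)
    rwa [norm_neg]
  have ha' : 0 < ‖a‖ := norm_pos_iff.2 ha
  have h2 : ‖(((n : ℤ) - n' : ℤ) : ℚ_[p])‖ ≤ (p : ℝ) ^ (-(1 : ℕ) : ℤ) := by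
    rw [norm_mul, div_eq_inv_mul] at h1
    simpa using le_of_mul_le_mul_right h1 ha'
  rw [Padic.norm_int_le_pow_iff_dvd, pow_one] at h2
  have h4 : |(n : ℤ) - n'| < p := by rw [abs_lt]; omega
  have := Int.eq_zero_of_abs_lt_dvd h2 h4
  omega

lemma padic_ball_eq {a : ℚ_[p]} (ha : a ≠ 0) : Metric.closedBall (0 : ℚ_[p]) ‖a‖ =
    ⋃ n ∈ Finset.range p, (fun x => x + -(n * a)) ⁻¹' Metric.closedBall (0 : ℚ_[p]) (‖a‖ / p) := by
  ext x
  simp only [mem_closedBall_zero_iff, Set.mem_iUnion, Set.mem_preimage, ← sub_eq_add_neg]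
  constructor
  · intro hx
    obtain ⟨n, hn, h⟩ := padic_exists_digit ha hx
    exact ⟨n, hn, h⟩
  · rintro ⟨n, -, h⟩
    have h1 : x = (x - n * a) + n * a := by ring
    have h2 : ‖(n : ℚ_[p]) * a‖ ≤ ‖a‖ := by
      rw [norm_mul]
      refine mul_le_of_le_one_left (norm_nonneg _) ?_
      exact_mod_cast Padic.norm_int_le_one (n : ℤ)
    rw [h1]
    refine (Padic.nonarchimedean _ _).trans (max_le (h.trans ?_) h2)
    exact div_le_self (norm_nonneg _) (by exact_mod_cast hp.out.one_le)

variable [MeasurableSpace ℚ_[p]] [BorelSpace ℚ_[p]]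

lemma padic_ball_step (μ : Measure ℚ_[p]) [μ.IsAddHaarMeasure] {a : ℚ_[p]} (ha : a ≠ 0) :
    μ (Metric.closedBall 0 ‖a‖) = p * μ (Metric.closedBall 0 (‖a‖ / p)) := by
  rw [padic_ball_eq ha, measure_biUnion_finset]
  · simp only [measure_preimage_add_right, Finset.sum_const, Finset.card_range, nsmul_eq_mul]
  · intro n hn n' hn' hne
    rw [Function.onFun, Set.disjoint_left]
    intro x hx hx'
    simp only [Set.mem_preimage, mem_closedBall_zero_iff, ← sub_eq_add_neg] at hx hx'
    exact hne (padic_digit_unique ha (Finset.mem_range.1 (by simpa using hn))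
      (Finset.mem_range.1 (by simpa using hn')) hx hx')
  · intro n _
    exact (measurable_id.add_const _) Metric.isClosed_closedBall.measurableSet

lemma padic_ball_zpow (μ : Measure ℚ_[p]) [μ.IsAddHaarMeasure] (k : ℤ) :
    μ (Metric.closedBall 0 ((p : ℝ) ^ k)) = (p : ℝ≥0∞) ^ k * μ (Metric.closedBall 0 1) := by
  have hp0 : (p : ℝ≥0∞) ≠ 0 := by exact_mod_cast hp.out.ne_zero
  have hpr : (p : ℝ) ≠ 0 := by exact_mod_cast hp.out.ne_zero
  have hpt : (p : ℝ≥0∞) ≠ ∞ := ENNReal.natCast_ne_top p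
  have step : ∀ k : ℤ, μ (Metric.closedBall 0 ((p : ℝ) ^ (k + 1))) =
      p * μ (Metric.closedBall 0 ((p : ℝ) ^ k)) := by
    intro k
    have hq : (p : ℚ_[p]) ≠ 0 := by exact_mod_cast hp.out.ne_zero
    have := padic_ball_step μ (a := (p : ℚ_[p]) ^ (-(k + 1))) (zpow_ne_zero _ hq)
    rw [Padic.norm_p_zpow, neg_neg] at this
    rw [this, zpow_add_one₀ hpr, mul_div_assoc, div_self hpr, mul_one]
  induction k using Int.induction_on with
  | zero => simp
  | succ k ih => rw [step, ih, ENNReal.zpow_add hp0 hpt, zpow_one, ← mul_assoc, mul_comm (p : ℝ≥0∞)]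
  | pred k ih =>
    have h1 := step (-(k : ℤ) - 1)
    rw [sub_add_cancel, ih] at h1
    have h2 : (p : ℝ≥0∞) ^ (-(k : ℤ)) = p * (p : ℝ≥0∞) ^ (-(k : ℤ) - 1) := by
      conv_lhs => rw [← sub_add_cancel (-(k : ℤ)) 1]
      rw [ENNReal.zpow_add hp0 hpt, zpow_one, mul_comm]
    rw [h2, mul_assoc] at h1
    exact ((ENNReal.mul_right_inj hp0 hpt).1 h1).symm

lemma enorm_padic_eq_zpow {a : ℚ_[p]} (ha : a ≠ 0) :
    ∃ k : ℤ, ‖a‖ = (p : ℝ) ^ k ∧ ‖a‖ₑ = (p : ℝ≥0∞) ^ k := by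
  obtain ⟨k, hk⟩ := Padic.norm_eq_zpow_neg_valuation ha ▸ (⟨_, rfl⟩ : ∃ k : ℤ, (p : ℝ) ^ (-a.valuation) = (p : ℝ) ^ k)
  refine ⟨k, hk, ?_⟩
  have hp0 : (p : NNReal) ≠ 0 := by exact_mod_cast hp.out.ne_zero
  have h1 : ‖a‖₊ = (p : NNReal) ^ k := NNReal.eq (by simpa using hk)
  rw [enorm_eq_nnnorm, h1, ENNReal.coe_zpow hp0, ENNReal.coe_natCast]

variable (p) in
/-- The Haar measure on `ℚ_[p]` for which the unit ball has measure one. -/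
def padicHaar : Measure ℚ_[p] :=
  Measure.addHaarMeasure ⟨⟨Metric.closedBall 0 1, isCompact_closedBall _ _⟩,
    ⟨0, Metric.ball_subset_interior_closedBall (Metric.mem_ball_self one_pos)⟩⟩

instance : (padicHaar p).IsAddHaarMeasure := by
  unfold padicHaar; infer_instance

lemma padicHaar_unitBall : padicHaar p (Metric.closedBall 0 1) = 1 := Measure.addHaarMeasure_self

lemma padicHaar_map_mul {a : ℚ_[p]} (ha : a ≠ 0) :
    (padicHaar p).map (fun x => a * x) = ‖a‖ₑ⁻¹ • padicHaar p := by
  have hcont : Continuous fun x : ℚ_[p] => a * x := continuous_const.mul continuous_id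
  let e : ℚ_[p] ≃+ ℚ_[p] := AddEquiv.mk' (Equiv.mulLeft₀ a ha) (fun x y => mul_add a x y)
  have h1 : ((padicHaar p).map (fun x => a * x)).IsAddHaarMeasure :=
    e.isAddHaarMeasure_map (padicHaar p) hcont (continuous_const.mul continuous_id)
  have h2 := Measure.isAddLeftInvariant_eq_smul ((padicHaar p).map (fun x => a * x)) (padicHaar p)
  set c := Measure.addHaarScalarFactor ((padicHaar p).map (fun x => a * x)) (padicHaar p)
  have h3 : ((padicHaar p).map (fun x => a * x)) (Metric.closedBall 0 1) = ‖a‖ₑ⁻¹ := by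
    rw [Measure.map_apply hcont.measurable Metric.isClosed_closedBall.measurableSet]
    obtain ⟨k, hk, hk'⟩ := enorm_padic_eq_zpow ha
    have : (fun x => a * x) ⁻¹' Metric.closedBall 0 1 = Metric.closedBall 0 ((p : ℝ) ^ (-k)) := by
      ext x
      have hp' : (0 : ℝ) < (p : ℝ) ^ k := zpow_pos (by exact_mod_cast hp.out.pos) _
      simp only [Set.mem_preimage, mem_closedBall_zero_iff, norm_mul, hk]
      rw [_root_.zpow_neg, ← one_div, le_div_iff₀ hp', mul_comm]
    rw [this, padic_ball_zpow, padicHaar_unitBall, mul_one, hk', ENNReal.zpow_neg]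
  rw [h2] at h3
  rw [h2]
  have h4 : (c : ℝ≥0∞) = ‖a‖ₑ⁻¹ := by
    rw [← h3]
    change (c : ℝ≥0∞) = (c : ℝ≥0∞) * padicHaar p (Metric.closedBall 0 1)
    rw [padicHaar_unitBall, mul_one]
  rw [← h4]
  rfl

end Padic

instance : PlaceField ℝ where
  isAddHaarMeasure := inferInstance
  map_mul a ha := by
    rw [Real.map_volume_mul_left ha]
    congr 1
    rw [Real.enorm_eq_ofReal_abs, abs_inv, ENNReal.ofReal_inv_of_pos (abs_pos.2 ha)]
  volume_zero := by simp

section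

variable {s : ℕ} (p : Fin s → ℕ) [∀ i, Fact (p i).Prime]

/-- The local fields `ℝ` and `ℚ_[p i]`. -/
def PF : Option (Fin s) → Type
  | none => ℝ
  | some i => ℚ_[p i]

instance PF.normedField : ∀ v, NormedField (PF p v)
  | none => inferInstanceAs (NormedField ℝ)
  | some i => inferInstanceAs (NormedField ℚ_[p i])

instance PF.charZero : ∀ v, CharZero (PF p v)
  | none => inferInstanceAs (CharZero ℝ)
  | some i => inferInstanceAs (CharZero ℚ_[p i])

variable [∀ i, MeasurableSpace ℚ_[p i]] [∀ i, BorelSpace ℚ_[p i]]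

instance PF.measureSpace : ∀ v, MeasureSpace (PF p v)
  | none => inferInstanceAs (MeasureSpace ℝ)
  | some i => @MeasureSpace.mk ℚ_[p i] inferInstance (padicHaar (p i))

instance PF.placeField : ∀ v, PlaceField (PF p v)
  | none => inferInstanceAs (PlaceField ℝ)
  | some i =>
    { toBorelSpace := inferInstanceAs (BorelSpace ℚ_[p i])
      toProperSpace := inferInstanceAs (ProperSpace ℚ_[p i])
      isAddHaarMeasure := inferInstanceAs (padicHaar (p i)).IsAddHaarMeasure
      map_mul := fun a ha => padicHaar_map_mul (p := p i) (a := a) ha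
      volume_zero := measure_singleton (μ := padicHaar (p i)) 0 }

end

section SIntegers

variable {s : ℕ} (p : Fin s → ℕ) [hp : ∀ i, Fact (p i).Prime]

/-- The ring of `S`-integers. -/
def ZS : Subring ℚ where
  carrier := {z | IsZS (∏ i, p i) z}
  mul_mem' := by
    rintro x y ⟨a, k, rfl⟩ ⟨b, l, rfl⟩
    refine ⟨a * b, k + l, ?_⟩
    rw [pow_add]; push_cast; rw [div_mul_div_comm]
  one_mem' := ⟨1, 0, by simp⟩
  add_mem' := by
    rintro x y ⟨a, k, rfl⟩ ⟨b, l, rfl⟩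
    have hP : ((∏ i, p i : ℕ) : ℚ) ≠ 0 := by
      exact_mod_cast Finset.prod_ne_zero_iff.2 fun i _ => (hp i).out.ne_zero
    refine ⟨a * (∏ i, p i : ℕ) ^ l + b * (∏ i, p i : ℕ) ^ k, k + l, ?_⟩
    rw [pow_add, div_add_div _ _ (pow_ne_zero _ hP) (pow_ne_zero _ hP)]
    push_cast
    ring
  zero_mem' := ⟨0, 0, by simp⟩
  neg_mem' := by
    rintro x ⟨a, k, rfl⟩
    exact ⟨-a, k, by push_cast; rw [neg_div]⟩

/-- The diagonal embedding of the `S`-integers. -/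
def embS : ZS p →+* ∀ v, PF p v :=
  RingHom.pi fun v => (Rat.castHom (PF p v)).comp (ZS p).subtype

lemma norm_embS_none (z : ZS p) : ‖embS p z none‖ = |((z : ℚ) : ℝ)| := rfl

lemma norm_embS_some (z : ZS p) (i : Fin s) : ‖embS p z (some i)‖ = ‖((z : ℚ) : ℚ_[p i])‖ := rfl

lemma isUnit_embS {z : ZS p} (hz : z ≠ 0) : IsUnit (embS p z) := by
  rw [Pi.isUnit_iff]
  intro v
  rw [isUnit_iff_ne_zero]
  have : ((z : ℚ) : PF p v) ≠ 0 := by exact_mod_cast fun h => hz (Subtype.ext h)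
  exact this

variable {p}

lemma norm_prod_prime (hinj : Function.Injective p) (i : Fin s) : ‖((∏ j, p j : ℕ) : ℚ_[p i])‖ = (p i : ℝ)⁻¹ := by
  rw [← Finset.mul_prod_erase _ _ (Finset.mem_univ i), Nat.cast_mul, norm_mul, Padic.norm_p]
  convert mul_one _
  rw [Padic.norm_natCast_eq_one_iff]
  refine Nat.Coprime.prod_right fun j hj => ?_
  exact (Nat.coprime_primes (hp i).out (hp j).out).2 fun h => (Finset.ne_of_mem_erase hj) (hinj h.symm)

lemma exists_int_of_norm_le_one (hinj : Function.Injective p) {z : ZS p} (hz : ∀ i, ‖((z : ℚ) : ℚ_[p i])‖ ≤ 1) :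
    ∃ a : ℤ, (z : ℚ) = a := by
  obtain ⟨z, a, k, rfl⟩ := z
  have hP : ((∏ i, p i : ℕ) : ℚ) ≠ 0 := by
    exact_mod_cast Finset.prod_ne_zero_iff.2 fun i _ => (hp i).out.ne_zero
  have h1 : ∀ i, ((p i ^ k : ℕ) : ℤ) ∣ a := by
    intro i
    rw [Nat.cast_pow, ← Padic.norm_int_le_pow_iff_dvd]
    have h2 := hz i
    have hpi : (0 : ℝ) < p i := by exact_mod_cast (hp i).out.pos
    push_cast at h2
    rw [norm_div, norm_pow] at h2
    have h3 := norm_prod_prime hinj i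
    push_cast at h3
    rw [h3, inv_pow, div_inv_eq_mul] at h2
    rw [_root_.zpow_neg, zpow_natCast, ← one_div, le_div_iff₀ (pow_pos hpi _)]
    exact h2
  have h2 : (∏ i, ((p i ^ k : ℕ) : ℤ)) ∣ a := by
    refine Finset.prod_dvd_of_coprime (fun i _ j _ hij => ?_) fun i _ => h1 i
    rw [Function.onFun, Nat.isCoprime_iff_coprime]
    exact Nat.Coprime.pow _ _ ((Nat.coprime_primes (hp i).out (hp j).out).2 fun h => hij (hinj h))
  obtain ⟨b, rfl⟩ := h2
  refine ⟨b, ?_⟩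
  rw [div_eq_iff (pow_ne_zero _ hP)]
  push_cast
  rw [Finset.prod_pow, mul_comm]

lemma exists_ZS_approx (hinj : Function.Injective p) (x : ∀ i, ℚ_[p i]) : ∃ z : ZS p, ∀ i, ‖x i + ((z : ℚ) : ℚ_[p i])‖ ≤ 1 := by
  have hex : ∃ k : ℕ, ∀ i, ‖((∏ j, p j : ℕ) : ℚ_[p i]) ^ k * x i‖ ≤ 1 := by
    have : ∀ᶠ k : ℕ in Filter.atTop, ∀ i, ‖((∏ j, p j : ℕ) : ℚ_[p i]) ^ k * x i‖ ≤ 1 := by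
      rw [Filter.eventually_all]
      intro i
      have h1 : Filter.Tendsto (fun k : ℕ => ‖((∏ j, p j : ℕ) : ℚ_[p i]) ^ k * x i‖) Filter.atTop
          (nhds (0 * ‖x i‖)) := by
        simp only [norm_mul, norm_pow, norm_prod_prime hinj]
        refine Filter.Tendsto.mul_const _ (tendsto_pow_atTop_nhds_zero_of_lt_one (by positivity) ?_)
        exact inv_lt_one_of_one_lt₀ (by exact_mod_cast (hp i).out.one_lt)
      rw [zero_mul] at h1
      exact (h1.eventually_lt_const one_pos).mono fun k hk => hk.le
    exact this.exists
  obtain ⟨k, hk⟩ := hex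
  let y : ∀ i, ℤ_[p i] := fun i => ⟨_, hk i⟩
  obtain ⟨n, hn⟩ := Nat.chineseRemainderOfFinset (fun i => (y i).appr k) (fun i => p i ^ k) Finset.univ
    (fun i _ => pow_ne_zero _ (hp i).out.ne_zero) (fun i _ j _ hij =>
      Nat.Coprime.pow _ _ ((Nat.coprime_primes (hp i).out (hp j).out).2 fun h => hij (hinj h)))
  refine ⟨⟨((-(n : ℤ) : ℤ) : ℚ) / ((∏ j, p j : ℕ) : ℚ) ^ k, -n, k, rfl⟩, fun i => ?_⟩
  have hpi : (0 : ℝ) < p i := by exact_mod_cast (hp i).out.pos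
  have hP : ((∏ j, p j : ℕ) : ℚ_[p i]) ≠ 0 := by
    exact_mod_cast Finset.prod_ne_zero_iff.2 fun i _ => (hp i).out.ne_zero
  have h1 : ‖(y i : ℚ_[p i]) - n‖ ≤ (p i : ℝ) ^ (-(k : ℕ) : ℤ) := by
    have e1 : ‖(y i : ℚ_[p i]) - (y i).appr k‖ ≤ (p i : ℝ) ^ (-(k : ℕ) : ℤ) := by
      have := ((y i - (y i).appr k).norm_le_pow_iff_mem_span_pow k).mpr ((y i).appr_spec k)
      rw [PadicInt.norm_def] at this
      exact_mod_cast this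
    have e2 : ‖(((y i).appr k : ℤ) - (n : ℤ) : ℚ_[p i])‖ ≤ (p i : ℝ) ^ (-(k : ℕ) : ℤ) := by
      have := (Padic.norm_int_le_pow_iff_dvd (p := p i) (((y i).appr k : ℤ) - (n : ℤ)) k).2
        (by exact_mod_cast (Nat.modEq_iff_dvd.1 (hn i (Finset.mem_univ i))))
      exact_mod_cast this
    have e3 : (y i : ℚ_[p i]) - n = ((y i : ℚ_[p i]) - (y i).appr k) + (((y i).appr k : ℤ) - (n : ℤ) : ℚ_[p i]) := by
      push_cast; ring
    rw [e3]
    exact (Padic.nonarchimedean _ _).trans (max_le e1 e2)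
  have h2 : x i + ((((-(n : ℤ) : ℤ) : ℚ) / ((∏ j, p j : ℕ) : ℚ) ^ k : ℚ) : ℚ_[p i]) =
      ((y i : ℚ_[p i]) - n) / ((∏ j, p j : ℕ) : ℚ_[p i]) ^ k := by
    have : (y i : ℚ_[p i]) = ((∏ j, p j : ℕ) : ℚ_[p i]) ^ k * x i := rfl
    rw [this, eq_div_iff (pow_ne_zero _ hP)]
    push_cast at hP ⊢
    rw [add_mul, div_mul_cancel₀ _ (pow_ne_zero _ hP)]
    ring
  change ‖x i + ((((-(n : ℤ) : ℤ) : ℚ) / ((∏ j, p j : ℕ) : ℚ) ^ k : ℚ) : ℚ_[p i])‖ ≤ 1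
  rw [h2, norm_div, norm_pow, norm_prod_prime hinj, inv_pow, div_inv_eq_mul]
  rw [_root_.zpow_neg, zpow_natCast, ← one_div, le_div_iff₀ (pow_pos hpi _)] at h1
  exact h1

end SIntegers

section Rows

variable {Λ : Type*} [CommRing Λ]

/-- Vectors over a Bézout ring are multiples of first rows of unimodular matrices. -/
lemma exists_mul_firstRow
    (hb : ∀ a b : Λ, ∃ g x y u v : Λ, a = g * x ∧ b = g * y ∧ x * v - y * u = 1) :
    ∀ (d : ℕ) (w : Fin (d + 1) → Λ), ∃ (g : Λ) (A : Matrix (Fin (d + 1)) (Fin (d + 1)) Λ),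
      A.det = 1 ∧ ∀ j, w j = g * A 0 j
  | 0, w => ⟨w 0, 1, by simp, fun j => by
    have : j = 0 := Fin.ext (by omega)
    subst this; simp⟩
  | d + 1, w => by
    obtain ⟨g', A, hA, hw⟩ := exists_mul_firstRow hb d (fun j => w j.succ)
    obtain ⟨g, x, y, u, v, h0, h1, h2⟩ := hb (w 0) g'
    let B : Matrix (Fin (d + 2)) (Fin (d + 2)) Λ := Matrix.of fun i => Fin.cons
      ((Fin.cons x (Fin.cons u fun _ => 0) : Fin (d + 2) → Λ) i)
      ((Fin.cons (y • A 0) (A.updateRow 0 (v • A 0)) : Fin (d + 2) → Fin (d + 1) → Λ) i)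
    refine ⟨g, B, ?_, ?_⟩
    · rw [det_succ_column_zero, Fin.sum_univ_succ, Fin.sum_univ_succ]
      have e0 : (B.submatrix (Fin.succAbove 0) Fin.succ) = A.updateRow 0 (v • A 0) := by
        ext i j; rfl
      have e1 : (B.submatrix (Fin.succAbove (Fin.succ 0)) Fin.succ) = A.updateRow 0 (y • A 0) := by
        ext i j
        refine Fin.cases ?_ (fun i => ?_) i
        · rw [updateRow_self]; rfl
        · have : (Fin.succ (0 : Fin (d + 1))).succAbove i.succ = i.succ.succ := by
            rw [Fin.succ_succAbove_succ]; simp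
          rw [submatrix_apply, this, updateRow_ne (Fin.succ_ne_zero i)]
          change A.updateRow 0 (v • A 0) i.succ j = _
          rw [updateRow_ne (Fin.succ_ne_zero i)]
      rw [e0, e1, det_updateRow_smul, det_updateRow_smul]
      simp [B, hA, updateRow_eq_self]
      rw [← h2]; ring
    · intro j
      refine Fin.cases ?_ (fun j => ?_) j
      · simpa [B] using h0
      · rw [hw j, h1]
        exact mul_assoc _ _ _

end Rows

section

variable {s : ℕ} {p : Fin s → ℕ} [hp : ∀ i, Fact (p i).Prime]

lemma ZS_prod_ne_zero : ((∏ i, p i : ℕ) : ℚ) ≠ 0 := by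
  exact_mod_cast Finset.prod_ne_zero_iff.2 fun i _ => (hp i).out.ne_zero

lemma isUnit_ZS_of_dvd {q : ℕ} (hq : q ∣ ∏ i, p i) : IsUnit (q : ZS p) := by
  obtain ⟨r, hr⟩ := hq
  have hP := ZS_prod_ne_zero (p := p)
  refine IsUnit.of_mul_eq_one ⟨(r : ℚ) / (∏ i, p i : ℕ), r, 1, by simp⟩ (Subtype.ext ?_)
  change (q : ℚ) * ((r : ℚ) / (∏ i, p i : ℕ)) = 1
  rw [hr] at hP ⊢
  push_cast at hP ⊢
  rw [← mul_div_assoc, div_self hP]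

lemma ZS_bezout (a b : ZS p) :
    ∃ g x y u v : ZS p, a = g * x ∧ b = g * y ∧ x * v - y * u = 1 := by
  have key : ∀ a b : ℤ, ∃ g x y u v : ℤ, a = g * x ∧ b = g * y ∧ x * v - y * u = 1 := by
    intro a b
    by_cases h : a = 0 ∧ b = 0
    · exact ⟨0, 1, 0, 0, 1, by simp [h.1], by simp [h.2], by simp⟩
    · have hg : (Int.gcd a b : ℤ) ≠ 0 := by
        simpa [Int.gcd_eq_zero_iff] using h
      obtain ⟨x, hx⟩ := Int.gcd_dvd_left a b
      obtain ⟨y, hy⟩ := Int.gcd_dvd_right a b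
      refine ⟨Int.gcd a b, x, y, -Int.gcdB a b, Int.gcdA a b, hx, hy, ?_⟩
      have := Int.gcd_eq_gcd_ab a b
      refine mul_left_cancel₀ hg ?_
      calc (Int.gcd a b : ℤ) * (x * Int.gcdA a b - y * -Int.gcdB a b)
          = (Int.gcd a b * x) * Int.gcdA a b + (Int.gcd a b * y) * Int.gcdB a b := by ring
        _ = Int.gcd a b * 1 := by rw [← hx, ← hy, ← this, mul_one]
  have hu : IsUnit ((∏ i, p i : ℕ) : ZS p) := isUnit_ZS_of_dvd dvd_rfl
  have clear : ∀ a : ZS p, ∃ (k : ℕ) (c : ℤ), a * ((∏ i, p i : ℕ) : ZS p) ^ k = c := by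
    rintro ⟨a, c, k, rfl⟩
    refine ⟨k, c, Subtype.ext ?_⟩
    change (c : ℚ) / ((∏ i, p i : ℕ) : ℚ) ^ k * ((∏ i, p i : ℕ) : ℚ) ^ k = c
    rw [div_mul_cancel₀ _ (pow_ne_zero _ ZS_prod_ne_zero)]
  obtain ⟨k, c, hc⟩ := clear a
  obtain ⟨l, e, he⟩ := clear b
  obtain ⟨t, ht⟩ := (hu.pow (k + l)).exists_right_inv
  obtain ⟨g, x, y, u, v, h1, h2, h3⟩ := key (c * (∏ i, p i : ℕ) ^ l) (e * (∏ i, p i : ℕ) ^ k)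
  have h1' := congrArg (Int.cast : ℤ → ZS p) h1
  have h2' := congrArg (Int.cast : ℤ → ZS p) h2
  push_cast at h1' h2' hc he ht
  refine ⟨g * t, x, y, u, v, ?_, ?_, by exact_mod_cast congrArg (Int.cast : ℤ → ZS p) h3⟩
  · rw [mul_right_comm, ← h1', ← hc, mul_assoc a, ← pow_add, mul_assoc, ht, mul_one]
  · rw [mul_right_comm, ← h2', ← he, mul_assoc b, ← pow_add, add_comm l, mul_assoc, ht, mul_one]

variable (p) in
/-- Positive integers prime to all `p i`. -/
def repsS : Set (ZS p) := {k | ∃ n : ℕ, 0 < n ∧ n.Coprime (∏ i, p i) ∧ k = n}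

lemma zero_notMem_repsS : (0 : ZS p) ∉ repsS p := by
  rintro ⟨n, hn, -, h⟩
  have : (n : ZS p) = 0 := h.symm
  rw [Nat.cast_eq_zero] at this
  omega

lemma exists_reps_mul_unit {g : ZS p} (hg : g ≠ 0) : ∃ k ∈ repsS p, ∃ η : (ZS p)ˣ, g = k * η := by
  have key : ∀ n : ℕ, 0 < n → ∃ k ∈ repsS p, ∃ η : (ZS p)ˣ, (n : ZS p) = k * η := by
    intro n
    induction n using Nat.strong_induction_on with
    | _ n ih =>
      intro hn
      by_cases hc : n.Coprime (∏ i, p i)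
      · exact ⟨n, ⟨n, hn, hc, rfl⟩, 1, by simp⟩
      · obtain ⟨m, hm⟩ := Nat.gcd_dvd_left n (∏ i, p i)
        have hq : 0 < Nat.gcd n (∏ i, p i) := Nat.gcd_pos_of_pos_left _ hn
        have hm0 : 0 < m := Nat.pos_of_ne_zero fun h => by rw [h, mul_zero] at hm; omega
        have hlt : m < n := by
          have : 2 ≤ Nat.gcd n (∏ i, p i) := by
            have : Nat.gcd n (∏ i, p i) ≠ 1 := hc
            omega
          calc m < 2 * m := by omega
            _ ≤ Nat.gcd n (∏ i, p i) * m := Nat.mul_le_mul_right _ this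
            _ = n := hm.symm
        obtain ⟨k, hk, η, h⟩ := ih m hlt hm0
        obtain ⟨ε, hε⟩ := isUnit_ZS_of_dvd (p := p) (Nat.gcd_dvd_right n (∏ i, p i))
        refine ⟨k, hk, ε * η, ?_⟩
        conv_lhs => rw [hm]
        rw [Nat.cast_mul, h, Units.val_mul, hε]
        ring
  obtain ⟨g, c, k, rfl⟩ := g
  have hc : c ≠ 0 := by
    rintro rfl
    exact hg (Subtype.ext (by simp))
  obtain ⟨t, ht⟩ := (isUnit_ZS_of_dvd (p := p) (dvd_refl (∏ i, p i))).pow k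
  obtain ⟨k', hk', η, h⟩ := key c.natAbs (Int.natAbs_pos.2 hc)
  have h1 : (⟨(c : ℚ) / ((∏ i, p i : ℕ) : ℚ) ^ k, c, k, rfl⟩ : ZS p) * t = c := by
    rw [ht]
    refine Subtype.ext ?_
    change (c : ℚ) / ((∏ i, p i : ℕ) : ℚ) ^ k * ((∏ i, p i : ℕ) : ℚ) ^ k = c
    rw [div_mul_cancel₀ _ (pow_ne_zero _ ZS_prod_ne_zero)]
  have h2 : ∃ ε : (ZS p)ˣ, (c : ZS p) = k' * ε := by
    have h' : ((c.natAbs : ℤ) : ZS p) = k' * η := by rw [Int.cast_natCast]; exact h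
    rcases abs_choice c with hh | hh
    · rw [Int.natCast_natAbs, hh] at h'; exact ⟨η, h'⟩
    · rw [Int.natCast_natAbs, hh] at h'
      refine ⟨-η, ?_⟩
      push_cast at h' ⊢
      rw [mul_neg, ← h', neg_neg]
  obtain ⟨ε, h2⟩ := h2
  refine ⟨k', hk', ε * t⁻¹, ?_⟩
  rw [Units.val_mul, ← mul_assoc, ← h2, ← h1, Units.mul_inv_cancel_right]

lemma reps_eq_of_dvd {k k' : ZS p} (hk : k ∈ repsS p) (hk' : k' ∈ repsS p) (h : k ∣ k')
    (h' : k' ∣ k) : k = k' := by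
  have key : ∀ n m : ℕ, m.Coprime (∏ i, p i) → (m : ZS p) ∣ n → m ∣ n := by
    rintro n m hm ⟨⟨q, a, l, rfl⟩, hq⟩
    have hq' : (n : ℚ) = m * ((a : ℚ) / ((∏ i, p i : ℕ) : ℚ) ^ l) := congrArg Subtype.val hq
    rw [← mul_div_assoc, eq_div_iff (pow_ne_zero _ ZS_prod_ne_zero)] at hq'
    have h1 : (n : ℤ) * ((∏ i, p i : ℕ) : ℤ) ^ l = m * a := by exact_mod_cast hq'
    have h2 : (m : ℤ) ∣ ((n * (∏ i, p i) ^ l : ℕ) : ℤ) := ⟨a, by exact_mod_cast h1⟩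
    exact (hm.pow_right l).dvd_of_dvd_mul_right (Int.natCast_dvd_natCast.1 h2)
  obtain ⟨n, -, hn, rfl⟩ := hk
  obtain ⟨n', -, hn', rfl⟩ := hk'
  rw [Nat.dvd_antisymm (key _ _ hn h) (key _ _ hn' h')]

lemma existsUnique_repsS (d : ℕ) (w : Fin (d + 2) → ZS p) (hw : w ≠ 0) :
    ∃! ku : repsS p × firstRows (ZS p) (d + 1),
      w = fun i => (ku.1 : ZS p) * (ku.2 : Fin (d + 2) → ZS p) i := by
  obtain ⟨g, A, hA, hwA⟩ := exists_mul_firstRow ZS_bezout (d + 1) w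
  have hg : g ≠ 0 := fun h => hw (by funext j; simp [hwA j, h])
  obtain ⟨k, hk, η, rfl⟩ := exists_reps_mul_unit hg
  have hdet : (diagonal (Fin.cons (η : ZS p) (Fin.cons (↑η⁻¹ : ZS p) 1) : Fin (d + 2) → ZS p) * A).det = 1 := by
    rw [det_mul, det_diagonal, hA, Fin.prod_univ_succ, Fin.prod_univ_succ]
    simp
  refine ⟨⟨⟨k, hk⟩, ⟨_, ⟨⟨_, hdet⟩, rfl⟩⟩⟩, ?_, ?_⟩
  · funext j
    rw [hwA j]
    change k * η * A 0 j = k * (diagonal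
      (Fin.cons (η : ZS p) (Fin.cons (↑η⁻¹ : ZS p) 1) : Fin (d + 2) → ZS p) * A) 0 j
    rw [diagonal_mul, Fin.cons_zero, mul_assoc]
  · have dvd : ∀ k k' : ZS p, ∀ u ∈ firstRows (ZS p) (d + 1), ∀ u' : Fin (d + 2) → ZS p,
        (∀ j, k * u j = k' * u' j) → k' ∣ k := by
      rintro k k' u ⟨γ, rfl⟩ u' h
      have h1 : ∑ j, ent γ 0 j * ent γ⁻¹ j 0 = 1 := by
        have h2 : (γ : Matrix (Fin (d + 2)) (Fin (d + 2)) (ZS p)) *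
            ((γ⁻¹ : SpecialLinearGroup (Fin (d + 2)) (ZS p)) : Matrix (Fin (d + 2)) (Fin (d + 2)) (ZS p)) = 1 := by
          refine (Matrix.SpecialLinearGroup.coe_mul γ γ⁻¹).symm.trans ?_
          rw [mul_inv_cancel]
          exact Matrix.SpecialLinearGroup.coe_one
        have h3 := congrFun (congrFun h2 0) 0
        rw [mul_apply, one_apply_eq] at h3
        exact h3
      refine ⟨∑ j, u' j * ent γ⁻¹ j 0, ?_⟩
      calc k = k * ∑ j, ent γ 0 j * ent γ⁻¹ j 0 := by rw [h1, mul_one]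
        _ = _ := by
          rw [Finset.mul_sum, Finset.mul_sum]
          exact Finset.sum_congr rfl fun j _ => by rw [← mul_assoc, h j, mul_assoc]
    rintro ⟨⟨k', hk'⟩, ⟨u', hu'⟩⟩ hw'
    have hrow : ent (⟨_, hdet⟩ : SpecialLinearGroup (Fin (d + 2)) (ZS p)) 0 ∈ firstRows (ZS p) (d + 1) :=
      ⟨_, rfl⟩
    have hw1 : ∀ j, w j = k * ent (⟨_, hdet⟩ : SpecialLinearGroup (Fin (d + 2)) (ZS p)) 0 j := by
      intro j
      rw [hwA j]
      change k * η * A 0 j = k * (diagonal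
      (Fin.cons (η : ZS p) (Fin.cons (↑η⁻¹ : ZS p) 1) : Fin (d + 2) → ZS p) * A) 0 j
      rw [diagonal_mul, Fin.cons_zero, mul_assoc]
    have hw2 : ∀ j, w j = k' * u' j := fun j => congrFun hw' j
    have hkk : k' = k := reps_eq_of_dvd hk' hk
      (dvd k k' _ hrow u' fun j => (hw1 j).symm.trans (hw2 j))
      (dvd k' k u' hu' _ fun j => (hw2 j).symm.trans (hw1 j))
    subst hkk
    have hk0 : k' ≠ 0 := fun h => zero_notMem_repsS (h ▸ hk')
    have huu : u' = ent (⟨_, hdet⟩ : SpecialLinearGroup (Fin (d + 2)) (ZS p)) 0 := by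
      funext j
      exact mul_left_cancel₀ hk0 ((hw2 j).symm.trans (hw1 j))
    subst huu
    rfl

end

section

variable {s : ℕ} (p : Fin s → ℕ) [hp : ∀ i, Fact (p i).Prime]

/-- The local components of the fundamental domain. -/
def tileAt : ∀ v, Set (PF p v)
  | none => (Set.Ico (0 : ℝ) 1 : Set ℝ)
  | some i => (Metric.closedBall 0 1 : Set ℚ_[p i])

/-- A fundamental domain for the `S`-integers. -/
def tileS : Set (∀ v, PF p v) := Set.univ.pi (tileAt p)

variable {p}

/-- The real component. -/
def rc (x : ∀ v, PF p v) : ℝ := x none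

/-- The `p i`-adic component. -/
def pc (i : Fin s) (x : ∀ v, PF p v) : ℚ_[p i] := x (some i)

lemma mem_tileS {x : ∀ v, PF p v} : x ∈ tileS p ↔
    (0 ≤ rc x ∧ rc x < 1) ∧ ∀ i, ‖pc i x‖ ≤ 1 := by
  rw [tileS, Set.mem_univ_pi, Option.forall]
  refine and_congr Iff.rfl (forall_congr' fun i => ?_)
  change pc i x ∈ Metric.closedBall (0 : ℚ_[p i]) 1 ↔ _
  rw [mem_closedBall_zero_iff]

lemma rc_add (x y : ∀ v, PF p v) : rc (x + y) = rc x + rc y := rfl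

lemma pc_add (i : Fin s) (x y : ∀ v, PF p v) : pc i (x + y) = pc i x + pc i y := rfl

lemma rc_embS (z : ZS p) : rc (embS p z) = ((z : ℚ) : ℝ) := rfl

lemma pc_embS (i : Fin s) (z : ZS p) : pc i (embS p z) = ((z : ℚ) : ℚ_[p i]) := rfl

lemma norm_lt_of_mem_tileS {x : ∀ v, PF p v} (hx : x ∈ tileS p) : ∀ v, ‖x v‖ ≤ 1
  | none => by
    have := (mem_tileS.1 hx).1
    change |rc x| ≤ 1
    rw [abs_of_nonneg this.1]
    exact this.2.le
  | some i => (mem_tileS.1 hx).2 i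

variable [∀ i, MeasurableSpace ℚ_[p i]] [∀ i, BorelSpace ℚ_[p i]]

lemma measurableSet_tileAt : ∀ v, MeasurableSet (tileAt p v)
  | none => (measurableSet_Ico : MeasurableSet (Set.Ico (0 : ℝ) 1))
  | some i => (Metric.isClosed_closedBall.measurableSet :
      MeasurableSet (Metric.closedBall (0 : ℚ_[p i]) 1))

lemma volume_tileS : volume (tileS p) = 1 := by
  rw [tileS, volume_pi_pi, Fintype.prod_option]
  have h1 : volume (tileAt p none) = 1 := by
    change volume (Set.Ico (0 : ℝ) 1) = 1
    simp
  have h2 : ∀ i, volume (tileAt p (some i)) = 1 := fun i => padicHaar_unitBall (p := p i)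
  simp [h1, h2]

lemma isTile_tileS (hinj : Function.Injective p) :
    IsTile (embS p).toAddMonoidHom (tileS p) where
  measurableSet := MeasurableSet.univ_pi measurableSet_tileAt
  existsUnique x := by
    change ∃! a, x + embS p a ∈ tileS p
    obtain ⟨z, hz⟩ := exists_ZS_approx hinj (fun i => pc i x)
    let y : ℝ := rc x + ((z : ℚ) : ℝ)
    refine existsUnique_of_exists_of_unique ⟨z - (⌊y⌋ : ZS p), ?_⟩ ?_
    · rw [mem_tileS]
      refine ⟨?_, fun i => ?_⟩
      · have h0 : rc (x + embS p (z - (⌊y⌋ : ZS p))) = y - ⌊y⌋ := by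
          rw [rc_add, rc_embS]
          push_cast
          ring
        rw [h0]
        exact ⟨by linarith [Int.floor_le y], by linarith [Int.lt_floor_add_one y]⟩
      · have h0 : pc i (x + embS p (z - (⌊y⌋ : ZS p))) =
            (pc i x + ((z : ℚ) : ℚ_[p i])) + ((-⌊y⌋ : ℤ) : ℚ_[p i]) := by
          rw [pc_add, pc_embS]
          push_cast
          ring
        rw [h0]
        exact (Padic.nonarchimedean _ _).trans (max_le (hz i) (Padic.norm_int_le_one _))
    · intro a b ha hb
      rw [mem_tileS, rc_add, rc_embS] at ha hb
      have h1 : ∀ i, ‖(((a - b : ZS p) : ℚ) : ℚ_[p i])‖ ≤ 1 := by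
        intro i
        have e : (((a - b : ZS p) : ℚ) : ℚ_[p i]) =
            pc i (x + embS p a) + -pc i (x + embS p b) := by
          rw [pc_add, pc_add, pc_embS, pc_embS]; push_cast; ring
        rw [e]
        refine (Padic.nonarchimedean _ _).trans (max_le (ha.2 i) ?_)
        rw [norm_neg]; exact hb.2 i
      obtain ⟨c, hc⟩ := exists_int_of_norm_le_one hinj h1
      have h2 : ((c : ℚ) : ℝ) = ((a : ℚ) : ℝ) - ((b : ℚ) : ℝ) := by rw [← hc]; push_cast; rfl
      have h3 : |(c : ℝ)| < 1 := by
        push_cast at h2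
        rw [h2, abs_lt]
        constructor <;> linarith [ha.1.1, ha.1.2, hb.1.1, hb.1.2]
      have h4 : c = 0 := by
        rw [← Int.abs_lt_one_iff]; exact_mod_cast h3
      rw [h4, Int.cast_zero] at hc
      exact sub_eq_zero.1 (Subtype.ext hc)

variable (p) in
/-- The elements whose components have norm between `1 / 2` and `2`. -/
def shellS : Set (∀ v, PF p v) := {x | ∀ v, 1 / 2 ≤ ‖x v‖ ∧ ‖x v‖ ≤ 2}

lemma measurableSet_shellS : MeasurableSet (shellS p) := by
  have : shellS p = ⋂ v, {x | 1 / 2 ≤ ‖x v‖ ∧ ‖x v‖ ≤ 2} := by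
    ext x; simp [shellS]
  rw [this]
  refine MeasurableSet.iInter fun v => ?_
  have h : Measurable fun x : ∀ v, PF p v => ‖x v‖ := (measurable_pi_apply v).norm
  exact (measurableSet_le measurable_const h).inter (measurableSet_le h measurable_const)

lemma volume_shellS : volume (shellS p) ≠ ∞ := by
  have : shellS p ⊆ Set.univ.pi fun v => Metric.closedBall (0 : PF p v) 2 := fun x hx v _ => by
    rw [mem_closedBall_zero_iff]; exact (hx v).2
  refine ne_top_of_le_ne_top ?_ (measure_mono this)
  rw [volume_pi_pi]
  exact ENNReal.prod_ne_top fun v _ => (isCompact_closedBall (0 : PF p v) 2).measure_lt_top.ne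

lemma pmod_le_of_mem_shellS {x : ∀ v, PF p v} (hx : x ∈ shellS p) :
    pmod x ≤ 2 ^ Fintype.card (Option (Fin s)) := by
  rw [pmod, ← Finset.card_univ, ← Finset.prod_const]
  refine Finset.prod_le_prod' fun v _ => ?_
  rw [← ofReal_norm, ← ENNReal.ofReal_ofNat 2]
  exact ENNReal.ofReal_le_ofReal (hx v).2

lemma norm_embS_some_le {k : ZS p} (hk : k ∈ repsS p) (i : Fin s) : ‖embS p k (some i)‖ = 1 := by
  obtain ⟨n, -, hn, rfl⟩ := hk
  rw [norm_embS_some]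
  have : (((n : ZS p) : ℚ) : ℚ_[p i]) = (n : ℚ_[p i]) := by push_cast; rfl
  rw [this, Padic.norm_natCast_eq_one_iff]
  exact (Nat.Coprime.coprime_dvd_right (Finset.dvd_prod_of_mem _ (Finset.mem_univ i)) hn).symm

lemma pmod_embS_natCast {n : ℕ} (hn0 : 0 < n) (hn : n.Coprime (∏ i, p i)) :
    pmod (embS p n) = n := by
  rw [pmod, Fintype.prod_option, Finset.prod_eq_one, mul_one]
  · rw [← ofReal_norm, norm_embS_none]
    simp
  · intro i _
    rw [← ofReal_norm, norm_embS_some_le ⟨n, hn0, hn, rfl⟩, ENNReal.ofReal_one]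

lemma tsum_repsS {j : ℕ} (hj : 2 ≤ j) : ∑' k : repsS p, ((pmod (embS p k))⁻¹) ^ j ≠ ∞ := by
  have hsum : ∑' n : ℕ, (((n + 1 : ℕ) : ℝ≥0∞)⁻¹) ^ j ≠ ∞ := by
    have h1 : Summable fun n : ℕ => (((n + 1 : ℕ) : ℝ) ^ j)⁻¹ :=
      (summable_nat_add_iff 1).2 (Real.summable_nat_pow_inv.2 (by omega))
    convert h1.tsum_ofReal_ne_top with n
    rw [ENNReal.ofReal_inv_of_pos (by positivity), ENNReal.ofReal_pow (by positivity),
      ENNReal.ofReal_natCast, ENNReal.inv_pow]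
  choose f hf0 hfc hf using fun k : repsS p => k.2
  refine ne_top_of_le_ne_top hsum ?_
  have hinj : Function.Injective fun k => f k - 1 := by
    intro k k' h
    have h0 := hf0 k
    have h1 := hf0 k'
    have h2 : f k = f k' := by
      have : f k - 1 = f k' - 1 := h
      omega
    exact Subtype.ext (by rw [hf k, hf k', h2])
  refine le_trans (le_of_eq ?_) (ENNReal.tsum_comp_le_tsum_of_injective hinj
    fun n : ℕ => (((n + 1 : ℕ) : ℝ≥0∞)⁻¹) ^ j)
  refine tsum_congr fun k => ?_
  have h0 := hf0 k
  rw [hf k, pmod_embS_natCast h0 (hfc k)]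
  simp only [Nat.sub_add_cancel h0]

variable (p) in
/-- Radii of an exhausting sequence of balls. -/
def rad : Option (Fin s) → ℕ → ℝ
  | none, l => l + 1
  | some i, l => (p i : ℝ) ^ l * ((p i + 1) / 2)

lemma padic_closedBall_eq (i : Fin s) {l : ℕ} {r : ℝ} (h1 : (p i : ℝ) ^ l ≤ r)
    (h2 : r < (p i : ℝ) ^ (l + 1)) :
    Metric.closedBall (0 : ℚ_[p i]) r = Metric.closedBall 0 ((p i : ℝ) ^ (l : ℤ)) := by
  ext x
  rw [mem_closedBall_zero_iff, mem_closedBall_zero_iff]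
  refine ⟨fun h => ?_, fun h => ?_⟩
  · rw [Padic.norm_le_pow_iff_norm_lt_pow_add_one]
    exact_mod_cast h.trans_lt h2
  · rw [zpow_natCast] at h
    exact h.trans h1

lemma volume_padic_ball (i : Fin s) {l : ℕ} {r : ℝ} (h1 : (p i : ℝ) ^ l ≤ r)
    (h2 : r < (p i : ℝ) ^ (l + 1)) :
    volume (Metric.closedBall (0 : PF p (some i)) r) = (p i : ℝ≥0∞) ^ l := by
  change padicHaar (p i) (Metric.closedBall (0 : ℚ_[p i]) r) = _
  rw [padic_closedBall_eq i h1 h2, padic_ball_zpow, padicHaar_unitBall, mul_one, zpow_natCast]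

lemma eventually_rad (i : Fin s) (C : ℝ) : ∀ᶠ l in Filter.atTop,
    (p i : ℝ) ^ l ≤ rad p (some i) l + C ∧ rad p (some i) l + C < (p i : ℝ) ^ (l + 1) := by
  have hp2 : (2 : ℝ) ≤ p i := by exact_mod_cast (hp i).out.two_le
  have ht : Filter.Tendsto (fun l : ℕ => (p i : ℝ) ^ l) Filter.atTop Filter.atTop :=
    tendsto_pow_atTop_atTop_of_one_lt (by linarith)
  filter_upwards [ht.eventually_gt_atTop (2 * |C|)] with l hl
  have hC := abs_le.1 (le_refl |C|)
  rw [rad, pow_succ]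
  constructor <;> nlinarith

lemma rad_pos : ∀ v l, 0 < rad p v l
  | none, l => by rw [rad]; positivity
  | some i, l => by
    have : (0 : ℝ) < p i := by exact_mod_cast (hp i).out.pos
    rw [rad]; positivity

lemma tendsto_rad : ∀ v, Filter.Tendsto (rad p v) Filter.atTop Filter.atTop
  | none => Filter.tendsto_atTop_add_const_right _ _ tendsto_natCast_atTop_atTop
  | some i => by
    have hp2 : (2 : ℝ) ≤ p i := by exact_mod_cast (hp i).out.two_le
    exact (tendsto_pow_atTop_atTop_of_one_lt (by linarith)).atTop_mul_const (by positivity)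

lemma volume_real_ball (r : ℝ) :
    volume (Metric.closedBall (0 : PF p none) r) = ENNReal.ofReal (2 * r) :=
  Real.volume_closedBall (0 : ℝ) r

lemma tendsto_volume_ball_rad : ∀ v, Filter.Tendsto
    (fun l => volume (Metric.closedBall (0 : PF p v) (rad p v l))) Filter.atTop (nhds ∞)
  | none => by
    simp only [volume_real_ball]
    exact ENNReal.tendsto_ofReal_nhds_top.2
      (Filter.Tendsto.const_mul_atTop two_pos (tendsto_rad none))
  | some i => by
    have h : ∀ᶠ l in Filter.atTop, (p i : ℝ≥0∞) ^ l =
        volume (Metric.closedBall (0 : PF p (some i)) (rad p (some i) l)) := by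
      filter_upwards [eventually_rad (p := p) i 0] with l hl
      rw [add_zero] at hl
      rw [volume_padic_ball i hl.1 hl.2]
    refine Filter.Tendsto.congr' h ?_
    have h1 := ENNReal.tendsto_ofReal_nhds_top.2
      (tendsto_pow_atTop_atTop_of_one_lt (r := (p i : ℝ)) (by exact_mod_cast (hp i).out.one_lt))
    refine h1.congr fun l => ?_
    rw [ENNReal.ofReal_pow (by positivity), ENNReal.ofReal_natCast]

lemma tendsto_volume_ball_ratio : ∀ v C, Filter.Tendsto
    (fun l => volume (Metric.closedBall (0 : PF p v) (rad p v l + C)) /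
      volume (Metric.closedBall (0 : PF p v) (rad p v l))) Filter.atTop (nhds 1)
  | none, C => by
    simp only [volume_real_ball]
    have h1 : Filter.Tendsto (fun l => ENNReal.ofReal (1 + C / rad p none l)) Filter.atTop
        (nhds (ENNReal.ofReal (1 + 0))) :=
      ENNReal.tendsto_ofReal (tendsto_const_nhds.add ((tendsto_rad (p := p) none).const_div_atTop C))
    rw [add_zero, ENNReal.ofReal_one] at h1
    refine h1.congr fun l => ?_
    have := rad_pos (p := p) none l
    rw [← ENNReal.ofReal_div_of_pos (by positivity)]
    congr 1
    field_simp
  | some i, C => by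
    refine Filter.Tendsto.congr' ?_ tendsto_const_nhds
    filter_upwards [eventually_rad (p := p) i 0, eventually_rad (p := p) i C] with l hl hC
    rw [add_zero] at hl
    rw [volume_padic_ball i hl.1 hl.2, volume_padic_ball i hC.1 hC.2]
    refine (ENNReal.div_self (pow_ne_zero _ ?_) (ENNReal.pow_ne_top (ENNReal.natCast_ne_top _))).symm
    exact_mod_cast (hp i).out.ne_zero

/-- The `S`-integers as a lattice in the product of the local fields. -/
def latticeS (hinj : Function.Injective p) : LatticeRing (ZS p) (∀ v, PF p v) where
  emb := embS p
  tile := tileS p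
  isTile := isTile_tileS hinj
  volume_tile := volume_tileS
  isUnit_emb _ ha := isUnit_embS p ha
  ae_isUnit := ae_isUnit_place
  measurable_inv := measurable_inverse_place
  cmod := pmod
  measurable_cmod := measurable_pmod
  cmod_ne_zero _ ha := pmod_ne_zero ha
  cmod_ne_top := pmod_ne_top
  lintegral_mul _ ha _ hh := lintegral_mul_place ha hh
  shell := shellS p
  measurableSet_shell := measurableSet_shellS
  isUnit_of_mem_shell a ha := by
    rw [isUnit_iff_ne_zero_apply]
    intro v h
    have := (ha v).1
    rw [h, norm_zero] at this
    linarith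
  volume_shell := volume_shellS
  cmod_le := ⟨2 ^ Fintype.card (Option (Fin s)), by simp, fun _ => pmod_le_of_mem_shellS⟩
  reps := repsS p
  zero_notMem_reps := zero_notMem_repsS
  existsUnique_reps := existsUnique_repsS
  tsum_reps _ hj := tsum_repsS hj
  cmod_mul := pmod_mul
  exists_exhaustion d := by
    obtain ⟨U, -, h⟩ := box_exhaustion (isTile_tileS hinj) volume_tileS
      (fun _ => norm_lt_of_mem_tileS) rad_pos tendsto_rad tendsto_volume_ball_rad
      tendsto_volume_ball_ratio d
    exact ⟨U, h⟩

lemma exists_box_isExhaustion (hinj : Function.Injective p) (d : ℕ) :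
    (latticeS hinj).IsExhaustion (fun l => box (PF p) (Fin (d + 1)) fun v => rad p v l) := by
  obtain ⟨U, hU, h1, h2, h3, h4, -, h5⟩ := box_exhaustion (isTile_tileS hinj) volume_tileS
      (fun _ => norm_lt_of_mem_tileS) rad_pos tendsto_rad tendsto_volume_ball_rad
      tendsto_volume_ball_ratio d
  have hU' : (fun l => box (PF p) (Fin (d + 1)) fun v => rad p v l) = U := (funext hU).symm
  rw [hU']
  exact ⟨h1, h2, h3, h4, fun M hM z => (h5 M hM z).1, fun M hM z => (h5 M hM z).2⟩

end

section

variable {s : ℕ} {p : Fin s → ℕ} [hp : ∀ i, Fact (p i).Prime]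

lemma nat_le_prod_pow_factorization (hinj : Function.Injective p) {e k : ℕ}
    (he : e ∣ (∏ i, p i) ^ k) : e ≤ ∏ i, p i ^ e.factorization (p i) := by
  have hP : (∏ i, p i) ^ k ≠ 0 :=
    pow_ne_zero _ (Finset.prod_ne_zero_iff.2 fun i _ => (hp i).out.ne_zero)
  have he0 : e ≠ 0 := fun h => hP (by rwa [h, zero_dvd_iff] at he)
  have hsub : e.primeFactors ⊆ Finset.univ.image p := by
    intro q hq
    have hqp := Nat.prime_of_mem_primeFactors hq
    have h1 := hqp.dvd_of_dvd_pow ((Nat.dvd_of_mem_primeFactors hq).trans he)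
    obtain ⟨i, -, hi⟩ := (Nat.Prime.prime hqp).exists_mem_finset_dvd h1
    exact Finset.mem_image.2 ⟨i, Finset.mem_univ _,
      ((Nat.prime_dvd_prime_iff_eq hqp (hp i).out).1 hi).symm⟩
  calc e = ∏ q ∈ e.primeFactors, q ^ e.factorization q :=
        (Nat.prod_factorization_pow_eq_self he0).symm
    _ ≤ ∏ q ∈ Finset.univ.image p, q ^ e.factorization q := by
        refine Finset.prod_le_prod_of_subset_of_one_le' hsub fun q hq _ => ?_
        obtain ⟨i, -, rfl⟩ := Finset.mem_image.1 hq
        exact Nat.one_le_pow _ _ (hp i).out.pos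
    _ = _ := Finset.prod_image fun i _ j _ h => hinj h

lemma pow_factorization_den_le (α : ℚ) (i : Fin s) :
    ((p i : ℝ) ^ α.den.factorization (p i)) ≤ max 1 ‖(α : ℚ_[p i])‖ := by
  have hp1 : (1 : ℝ) < p i := by exact_mod_cast (hp i).out.one_lt
  by_cases h0 : α.den.factorization (p i) = 0
  · rw [h0, pow_zero]; exact le_max_left _ _
  have hdvd : p i ∣ α.den := Nat.dvd_of_factorization_pos h0
  have hnum : ‖(α.num : ℚ_[p i])‖ = 1 := by
    refine le_antisymm (Padic.norm_int_le_one _) (not_lt.1 fun h => ?_)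
    rw [Padic.norm_intCast_lt_one_iff] at h
    have h1 : p i ∣ α.num.natAbs := Int.natCast_dvd.1 h
    have h2 := Nat.dvd_gcd h1 hdvd
    rw [α.reduced.gcd_eq_one] at h2
    exact (hp i).out.one_lt.ne' (Nat.dvd_one.1 h2)
  have hden : ‖((α.den : ℤ) : ℚ_[p i])‖ ≤ (p i : ℝ) ^ (-(α.den.factorization (p i) : ℤ)) := by
    rw [Padic.norm_int_le_pow_iff_dvd]
    exact_mod_cast Nat.ordProj_dvd α.den (p i)
  have hd0 : 0 < ‖((α.den : ℤ) : ℚ_[p i])‖ := by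
    rw [norm_pos_iff]
    exact_mod_cast α.den_ne_zero
  have e : ‖(α : ℚ_[p i])‖ = ‖((α.den : ℤ) : ℚ_[p i])‖⁻¹ := by
    conv_lhs => rw [← Rat.num_div_den α]
    push_cast
    rw [norm_div, hnum, one_div]
  rw [e]
  refine le_trans ?_ (le_max_right _ _)
  rw [le_inv_comm₀ (by positivity) hd0]
  refine hden.trans (le_of_eq ?_)
  rw [_root_.zpow_neg, zpow_natCast]

lemma den_dvd_of_mem_ZS {α : ℚ} (h : α ∈ ZS p) : ∃ k, α.den ∣ (∏ i, p i) ^ k := by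
  obtain ⟨a, k, rfl⟩ := h
  refine ⟨k, ?_⟩
  have := Rat.den_dvd a ((∏ i, p i : ℕ) ^ k : ℕ)
  push_cast at this ⊢
  exact_mod_cast this

/-- The summable weights bounding the contribution of dependent pairs. -/
def decay (n : ℕ) : ℝ≥0∞ := ENNReal.ofReal (((n : ℝ) ^ (3 / 2 : ℝ))⁻¹)

lemma tsum_decay_ne_top : ∑' n, decay n ≠ ∞ :=
  (Real.summable_nat_rpow_inv.2 (by norm_num)).tsum_ofReal_ne_top

lemma inv_cube_le {a b c : ℕ} (ha : 0 < a) (hb : 0 < b) (hc : 0 < c) {x : ℝ}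
    (h1 : (a : ℝ) * b ≤ x) (h2 : (c : ℝ) ≤ x) :
    ENNReal.ofReal ((x ^ 3)⁻¹) ≤ decay a * (decay b * decay c) := by
  have ha' : (0 : ℝ) < a := by exact_mod_cast ha
  have hb' : (0 : ℝ) < b := by exact_mod_cast hb
  have hc' : (0 : ℝ) < c := by exact_mod_cast hc
  have hx : 0 < x := hc'.trans_le h2
  rw [decay, decay, decay, ← ENNReal.ofReal_mul (by positivity), ← ENNReal.ofReal_mul (by positivity),
    ← mul_inv, ← mul_inv]
  refine ENNReal.ofReal_le_ofReal (inv_anti₀ (by positivity) ?_)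
  rw [← mul_assoc, ← Real.mul_rpow ha'.le hb'.le]
  calc ((a : ℝ) * b) ^ (3 / 2 : ℝ) * (c : ℝ) ^ (3 / 2 : ℝ)
      ≤ x ^ (3 / 2 : ℝ) * x ^ (3 / 2 : ℝ) := by gcongr
    _ = x ^ 3 := by
      rw [← Real.rpow_add hx, ← Real.rpow_natCast]
      norm_num

lemma tsum_num_den_ne_top (p : Fin s → ℕ) [∀ i, Fact (p i).Prime] :
    ∑' α : ZS p, decay (α : ℚ).den * decay (α : ℚ).num.natAbs ≠ ∞ := by
  let f : ZS p → Bool × ℕ × ℕ := fun α =>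
    (decide (0 ≤ (α : ℚ).num), (α : ℚ).den, (α : ℚ).num.natAbs)
  have hf : Function.Injective f := by
    intro α β h
    simp only [f, Prod.mk.injEq, decide_eq_decide] at h
    refine Subtype.ext (Rat.ext ?_ h.2.1)
    omega
  refine ne_top_of_le_ne_top ?_ (ENNReal.tsum_comp_le_tsum_of_injective hf
    fun z : Bool × ℕ × ℕ => decay z.2.1 * decay z.2.2)
  rw [ENNReal.tsum_prod (f := fun (_ : Bool) (z : ℕ × ℕ) => decay z.1 * decay z.2)]
  simp_rw [ENNReal.tsum_prod (f := fun a b => decay a * decay b), ENNReal.tsum_mul_left, ENNReal.tsum_mul_right]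
  rw [tsum_bool]
  exact ENNReal.mul_ne_top (ENNReal.add_ne_top.2 ⟨tsum_decay_ne_top, tsum_decay_ne_top⟩)
    tsum_decay_ne_top

/-- The componentwise larger of two elements. -/
def larger (a b : ∀ v, PF p v) (v : Option (Fin s)) : PF p v := open Classical in
  if ‖a v‖ ≤ ‖b v‖ then b v else a v

lemma norm_larger (a b : ∀ v, PF p v) (v : Option (Fin s)) :
    ‖larger a b v‖ = max ‖a v‖ ‖b v‖ := by
  rw [larger]
  split_ifs with h
  · exact (max_eq_right h).symm
  · exact (max_eq_left (not_le.1 h).le).symm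

lemma larger_eq (a b : ∀ v, PF p v) (v : Option (Fin s)) :
    larger a b v = a v ∨ larger a b v = b v := by
  rw [larger]
  split_ifs
  · exact Or.inr rfl
  · exact Or.inl rfl

variable [∀ i, MeasurableSpace ℚ_[p i]] [∀ i, BorelSpace ℚ_[p i]]

lemma ofReal_le_pmod_larger (hinj : Function.Injective p) {n : ℕ}
    (hn : n.Coprime (∏ i, p i)) (α : ZS p) :
    ENNReal.ofReal (max ((n : ℝ) * (α : ℚ).den) (α : ℚ).num.natAbs) ≤
      pmod (larger (embS p n) (embS p α)) := by
  have hd0 : (0 : ℝ) < (α : ℚ).den := by exact_mod_cast (α : ℚ).den_pos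
  have e1 : pmod (larger (embS p n) (embS p α)) =
      ENNReal.ofReal (∏ v, ‖larger (embS p n) (embS p α) v‖) := by
    rw [pmod, ENNReal.ofReal_prod_of_nonneg fun _ _ => norm_nonneg _]
    simp_rw [ofReal_norm]
  rw [e1]
  refine ENNReal.ofReal_le_ofReal ?_
  rw [Fintype.prod_option, norm_larger, norm_embS_none, norm_embS_none]
  obtain ⟨k, hk⟩ := den_dvd_of_mem_ZS α.2
  have h1 : ((α : ℚ).den : ℝ) ≤ ∏ i, ‖larger (embS p n) (embS p α) (some i)‖ := by
    calc ((α : ℚ).den : ℝ) ≤ ∏ i, (p i : ℝ) ^ (α : ℚ).den.factorization (p i) := by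
          exact_mod_cast nat_le_prod_pow_factorization hinj hk
      _ ≤ _ := by
        refine Finset.prod_le_prod (fun _ _ => by positivity) fun i _ => ?_
        rw [norm_larger, norm_embS_some, norm_embS_some]
        have : ‖(((n : ZS p) : ℚ) : ℚ_[p i])‖ = 1 := by
          have : (((n : ZS p) : ℚ) : ℚ_[p i]) = (n : ℚ_[p i]) := by push_cast; rfl
          rw [this, Padic.norm_natCast_eq_one_iff]
          exact (Nat.Coprime.coprime_dvd_right
            (Finset.dvd_prod_of_mem _ (Finset.mem_univ i)) hn).symm
        rw [this]
        exact pow_factorization_den_le _ i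
  refine le_trans (le_of_eq ?_) (mul_le_mul_of_nonneg_left h1 (by positivity))
  have e2 : |(((n : ZS p) : ℚ) : ℝ)| = n := by
    push_cast
    rw [abs_of_nonneg (by positivity)]
  have e3 : |((α : ℚ) : ℝ)| * (α : ℚ).den = (α : ℚ).num.natAbs := by
    conv_lhs => rw [← Rat.num_div_den (α : ℚ)]
    push_cast
    rw [abs_div, abs_of_pos hd0]
    simp only [Rat.num_div_den]
    rw [div_mul_cancel₀ _ hd0.ne', ← Int.cast_abs, Int.abs_eq_natAbs, Int.cast_natCast]
  rw [max_mul_of_nonneg _ _ hd0.le, e2, e3]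

lemma isUnit_larger {a b : ∀ v, PF p v} (ha : IsUnit a) : IsUnit (larger a b) := by
  rw [isUnit_iff_ne_zero_apply] at ha ⊢
  intro v
  rw [← norm_pos_iff, norm_larger]
  exact lt_max_of_lt_left (norm_pos_iff.2 (ha v))

/-- The constant bounding the contribution of dependent pairs. -/
def depConst (p : Fin s → ℕ) [∀ i, Fact (p i).Prime] : ℝ≥0∞ :=
  (∑' n, decay n) * ∑' α : ZS p, decay (α : ℚ).den * decay (α : ℚ).num.natAbs

lemma depConst_ne_top (p : Fin s → ℕ) [∀ i, Fact (p i).Prime] : depConst p ≠ ∞ :=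
  ENNReal.mul_ne_top tsum_decay_ne_top (tsum_num_den_ne_top p)

lemma dep_rect_le (hinj : Function.Injective p) (N : ZS p) {e : ℕ}
    {A : ∀ v, Set (Fin (e + 3) → PF p v)} (hA : ∀ v, MeasurableSet (A v)) :
    (latticeS hinj).dep N ((rect A).indicator 1) ((rect A).indicator 1) ≤
      depConst p * volume (rect A) := by
  have hmA := measurableSet_rect hA
  have key : ∀ (n : ℕ) (hn0 : 0 < n) (hn : n.Coprime (∏ i, p i)) (α : ZS p) (hα : α ≠ 0),
      ∫⁻ x : Fin (e + 3) → ∀ v, PF p v,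
        (rect A).indicator (1 : (Fin (e + 3) → ∀ v, PF p v) → ℝ≥0∞) (fun j => embS p n * x j) *
        (rect A).indicator (1 : (Fin (e + 3) → ∀ v, PF p v) → ℝ≥0∞) (fun j => embS p α * x j) ≤
      decay n * (decay (α : ℚ).den * decay (α : ℚ).num.natAbs) * volume (rect A) := by
    intro n hn0 hn α hα
    set c := larger (embS p n) (embS p α) with hc
    have hcu : IsUnit c := isUnit_larger (isUnit_embS p (by exact_mod_cast hn0.ne'))
    calc _ ≤ ∫⁻ x : Fin (e + 3) → ∀ v, PF p v,
          (rect A).indicator (1 : (Fin (e + 3) → ∀ v, PF p v) → ℝ≥0∞) (fun j => c * x j) := by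
          refine lintegral_mono fun x => ?_
          by_cases h1 : (fun j => embS p n * x j) ∈ rect A
          · by_cases h2 : (fun j => embS p α * x j) ∈ rect A
            · have h3 : (fun j => c * x j) ∈ rect A := by
                rw [mem_rect] at h1 h2 ⊢
                intro v
                rcases larger_eq (embS p n) (embS p α) v with h | h
                · have := h1 v
                  simp only [Pi.mul_apply] at this ⊢
                  rwa [hc, h]
                · have := h2 v
                  simp only [Pi.mul_apply] at this ⊢
                  rwa [hc, h]
              simp only [Set.indicator_of_mem h1, Set.indicator_of_mem h2,
                Set.indicator_of_mem h3, Pi.one_apply, mul_one, le_refl]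
            · simp only [Set.indicator_of_notMem h2, mul_zero, zero_le]
          · simp only [Set.indicator_of_notMem h1, zero_mul, zero_le]
      _ = (pmod c)⁻¹ ^ (e + 3) * volume (rect A) := by
          rw [(latticeS hinj).lintegral_smul' hcu (measurable_one.indicator hmA),
            lintegral_indicator_one hmA]
          rfl
      _ ≤ _ := by
          refine mul_le_mul' ?_ le_rfl
          set x : ℝ := max ((n : ℝ) * (α : ℚ).den) (α : ℚ).num.natAbs with hx
          have hd : 0 < (α : ℚ).den := (α : ℚ).den_pos
          have hnum : 0 < (α : ℚ).num.natAbs := by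
            rw [Int.natAbs_pos, ne_eq, Rat.num_eq_zero]
            exact fun h => hα (Subtype.ext h)
          have hx1 : (1 : ℝ) ≤ x := by
            refine le_trans ?_ (le_max_right _ _)
            exact_mod_cast hnum
          have hcx : ENNReal.ofReal x ≤ pmod c := ofReal_le_pmod_larger hinj hn α
          have h1x : 1 ≤ pmod c := by
            refine le_trans ?_ hcx
            rw [← ENNReal.ofReal_one]
            exact ENNReal.ofReal_le_ofReal hx1
          calc (pmod c)⁻¹ ^ (e + 3) ≤ (pmod c)⁻¹ ^ 3 :=
                pow_le_pow_right_of_le_one' (ENNReal.inv_le_one.2 h1x) (by omega)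
            _ ≤ (ENNReal.ofReal x)⁻¹ ^ 3 := by gcongr
            _ = ENNReal.ofReal ((x ^ 3)⁻¹) := by
                rw [ENNReal.ofReal_inv_of_pos (by positivity), ENNReal.ofReal_pow (by positivity),
                  ENNReal.inv_pow]
            _ ≤ _ := inv_cube_le hn0 hd hnum (le_max_left _ _) (le_max_right _ _)
  choose f hf0 hfc hf using fun k : repsS p => k.2
  have hfinj : Function.Injective f := fun k k' h => Subtype.ext (by rw [hf k, hf k', h])
  rw [LatticeRing.dep]
  calc _ ≤ ∑' k : repsS p, ∑' α : scong N (k : ZS p),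
        decay (f k) * (decay ((α : ZS p) : ℚ).den * decay ((α : ZS p) : ℚ).num.natAbs) *
          volume (rect A) := by
        refine ENNReal.tsum_le_tsum fun k => ENNReal.tsum_le_tsum fun α => ?_
        have := key (f k) (hf0 k) (hfc k) α α.2.1
        rw [← hf k] at this
        exact this
    _ ≤ ∑' k : repsS p, decay (f k) * (∑' α : ZS p, decay (α : ℚ).den * decay (α : ℚ).num.natAbs) *
          volume (rect A) := by
        refine ENNReal.tsum_le_tsum fun k => ?_
        rw [ENNReal.tsum_mul_right, ENNReal.tsum_mul_left]
        refine mul_le_mul' (mul_le_mul' le_rfl ?_) le_rfl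
        exact ENNReal.tsum_comp_le_tsum_of_injective Subtype.val_injective
          fun α : ZS p => decay (α : ℚ).den * decay (α : ℚ).num.natAbs
    _ ≤ _ := by
        rw [ENNReal.tsum_mul_right, ENNReal.tsum_mul_right, depConst]
        refine mul_le_mul' (mul_le_mul' ?_ le_rfl) le_rfl
        exact ENNReal.tsum_comp_le_tsum_of_injective hfinj decay

lemma box_eq_rect {κ : Type*} (r : Option (Fin s) → ℝ) : box (PF p) κ r =
    rect (K := PF p) fun v => Set.univ.pi fun _ : κ => Metric.closedBall (0 : PF p v) (r v) := by
  ext x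
  rw [mem_box, mem_rect]
  simp only [Set.mem_univ_pi, mem_closedBall_zero_iff]
  exact forall_comm

/-- The mean square discrepancy of a product set is bounded by its volume. -/
theorem lintegral_sqd_rect_le (hinj : Function.Injective p) {e : ℕ}
    {φ : (Fin (e + 3) → Fin (e + 3) → ∀ v, PF p v) → ℝ≥0∞} (h : (latticeS hinj).IsWeight φ) :
    ∃ K : ℝ≥0∞, K ≠ ∞ ∧ ∀ {N : ZS p}, N ≠ 0 → ∀ (y : Fin (e + 3) → ZS p)
      {A : ∀ v, Set (Fin (e + 3) → PF p v)}, (∀ v, MeasurableSet (A v)) →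
      (∀ v, volume (A v) ≠ ∞) →
      ∫⁻ M, φ M * sqd ((latticeS hinj).cnt N y (rect A) M)
        ((pmod (embS p N))⁻¹ ^ (e + 3) * volume (rect A)) ≤ K * volume (rect A) := by
  obtain ⟨φ', h'⟩ := (latticeS hinj).exists_isWeight (e + 1)
  refine ⟨(latticeS hinj).mom φ' 1 * depConst p,
    ENNReal.mul_ne_top (h'.mom_le h'.lintegral_ne_top 1) (depConst_ne_top p), ?_⟩
  intro N hN y A hA hAt
  refine h.lintegral_sqd_volume_le h' hN y (exists_box_isExhaustion hinj (e + 2))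
    (depConst_ne_top p) (fun l => ?_) (measurableSet_rect hA) ?_ (dep_rect_le hinj N hA)
  · rw [box_eq_rect]
    exact dep_rect_le hinj N fun v => MeasurableSet.univ_pi fun _ =>
      Metric.isClosed_closedBall.measurableSet
  · rw [volume_rect hA]
    exact ENNReal.prod_ne_top fun v _ => hAt v

end

lemma ENNReal.sq_sum_le {κ : Type*} (s : Finset κ) (f : κ → ℝ≥0∞) :
    (∑ i ∈ s, f i) ^ 2 ≤ s.card * ∑ i ∈ s, f i ^ 2 := by
  have := ENNReal.rpow_sum_le_const_mul_sum_rpow s f (p := 2) (by norm_num)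
  norm_num at this
  exact this

lemma ENNReal.sum_tsub_sum_le {κ : Type*} (s : Finset κ) (a b : κ → ℝ≥0∞) :
    (∑ i ∈ s, a i) - ∑ i ∈ s, b i ≤ ∑ i ∈ s, (a i - b i) := by
  rw [tsub_le_iff_right, ← Finset.sum_add_distrib]
  exact Finset.sum_le_sum fun i _ => le_tsub_add

lemma sqd_sum_le {κ : Type*} (s : Finset κ) (a b : κ → ℝ≥0∞) :
    sqd (∑ i ∈ s, a i) (∑ i ∈ s, b i) ≤ s.card * ∑ i ∈ s, sqd (a i) (b i) := by
  simp only [sqd]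
  rw [Finset.sum_add_distrib, mul_add]
  exact add_le_add
    ((pow_le_pow_left' (ENNReal.sum_tsub_sum_le s a b) 2).trans (ENNReal.sq_sum_le s _))
    ((pow_le_pow_left' (ENNReal.sum_tsub_sum_le s b a) 2).trans (ENNReal.sq_sum_le s _))

/-- The dyadic increments of a chain of sets. -/
def dy {α : Type*} (G : ℕ → Set α) (e i : ℕ) : Set α := G (i * 2 ^ e) \ G (i / 2 * 2 ^ (e + 1))

section Dyadic

variable {α : Type*} {G : ℕ → Set α}

lemma pairwise_disjoint_dy (hG : Monotone G) (e : ℕ) : Pairwise (Function.onFun Disjoint (dy G e)) := by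
  have key : ∀ i i', i < i' → Disjoint (dy G e i) (dy G e i') := by
    intro i i' h
    have h1 : i * 2 ^ e ≤ i' / 2 * 2 ^ (e + 1) := by
      rw [pow_succ', ← mul_assoc]
      exact Nat.mul_le_mul_right _ (by omega)
    rw [Set.disjoint_left]
    exact fun x hx hx' => hx'.2 (hG h1 hx.1)
  intro i i' h
  rcases lt_or_gt_of_ne h with h | h
  · exact key _ _ h
  · exact (key _ _ h).symm

lemma dy_div (J e : ℕ) :
    dy G e (J / 2 ^ e) = G (J / 2 ^ e * 2 ^ e) \ G (J / 2 ^ (e + 1) * 2 ^ (e + 1)) := by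
  rw [dy, Nat.div_div_eq_div_mul, ← pow_succ]

lemma div_mul_pow_anti (J : ℕ) : Antitone fun e => J / 2 ^ e * 2 ^ e := by
  refine antitone_nat_of_succ_le fun e => ?_
  rw [pow_succ, ← Nat.div_div_eq_div_mul, mul_comm (2 ^ e) 2, ← mul_assoc]
  exact Nat.mul_le_mul_right _ (Nat.div_mul_le_self _ _)

lemma disjoint_dy_div (hG : Monotone G) (J : ℕ) {e e' : ℕ} (h : e ≠ e') :
    Disjoint (dy G e (J / 2 ^ e)) (dy G e' (J / 2 ^ e')) := by
  have key : ∀ e e', e < e' → Disjoint (dy G e (J / 2 ^ e)) (dy G e' (J / 2 ^ e')) := by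
    intro e e' h
    rw [dy_div, dy_div, Set.disjoint_left]
    exact fun x hx hx' => hx.2 (hG (div_mul_pow_anti J h) hx'.1)
  rcases lt_or_gt_of_ne h with h | h
  · exact key _ _ h
  · exact (key _ _ h).symm

lemma exists_mem_dy_div (h0 : G 0 = ∅) {J K : ℕ} (hJ : J < 2 ^ K) {x : α} (hx : x ∈ G J) :
    ∃ e : Fin K, x ∈ dy G e (J / 2 ^ (e : ℕ)) := by
  by_contra! hcon
  have : ∀ e ≤ K, x ∈ G (J / 2 ^ e * 2 ^ e) := by
    intro e he
    induction e with
    | zero => simpa using hx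
    | succ e ih =>
      by_contra h
      exact hcon ⟨e, he⟩ (by rw [dy_div]; exact ⟨ih (by omega), h⟩)
  have h1 := this K le_rfl
  rw [Nat.div_eq_of_lt hJ, zero_mul, h0] at h1
  exact h1

lemma dy_div_subset (hG : Monotone G) (J e : ℕ) : dy G e (J / 2 ^ e) ⊆ G J :=
  fun _ hx => hG (Nat.div_mul_le_self J _) hx.1

end Dyadic

section Maximal

variable {ι : Type*} [Fintype ι] [DecidableEq ι] {X : ι → Type*} [∀ v, MeasurableSpace (X v)]
  (μ : ∀ v, Measure (X v)) [∀ v, SigmaFinite (μ v)] (c : ℝ≥0∞)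

/-- The total square discrepancy over the dyadic increments. -/
def dyTotal (G : ∀ v, ℕ → Set (X v)) (K : ℕ) (n : Measure (∀ v, X v)) : ℝ≥0∞ :=
  ∑ e : ι → Fin K, ∑ i : ι → Fin (2 ^ K), sqd (n (Set.univ.pi fun v => dy (G v) (e v) (i v)))
    (c * ∏ v, μ v (dy (G v) (e v) (i v)))

variable {μ c} {G : ∀ v, ℕ → Set (X v)}

lemma measurableSet_dy (hm : ∀ v j, MeasurableSet (G v j)) (v : ι) (e i : ℕ) :
    MeasurableSet (dy (G v) e i) := (hm v _).diff (hm v _)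

/-- The discrepancy of every member of a product of chains is controlled by the dyadic total. -/
lemma sqd_le_dyTotal (hG : ∀ v, Monotone (G v)) (h0 : ∀ v, G v 0 = ∅)
    (hm : ∀ v j, MeasurableSet (G v j)) {K : ℕ} {J : ι → ℕ} (hJ : ∀ v, J v < 2 ^ K)
    (n : Measure (∀ v, X v)) :
    sqd (n (Set.univ.pi fun v => G v (J v))) (c * ∏ v, μ v (G v (J v))) ≤
      K ^ Fintype.card ι * dyTotal μ c G K n := by
  have hd : ∀ e : ι → Fin K, MeasurableSet
      (Set.univ.pi fun v => dy (G v) (e v) (J v / 2 ^ (e v : ℕ))) := fun e =>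
    MeasurableSet.univ_pi fun v => measurableSet_dy hm v _ _
  have hun : (Set.univ.pi fun v => G v (J v)) = ⋃ e : ι → Fin K,
      Set.univ.pi fun v => dy (G v) (e v) (J v / 2 ^ (e v : ℕ)) := by
    ext x
    simp only [Set.mem_univ_pi, Set.mem_iUnion]
    refine ⟨fun h => ?_, fun ⟨e, he⟩ v => dy_div_subset (hG v) _ _ (he v)⟩
    choose e he using fun v => exists_mem_dy_div (h0 v) (hJ v) (h v)
    exact ⟨e, he⟩
  have hdis : Pairwise (Function.onFun Disjoint fun e : ι → Fin K =>
      Set.univ.pi fun v => dy (G v) (e v) (J v / 2 ^ (e v : ℕ))) := by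
    intro e e' h
    obtain ⟨v, hv⟩ := Function.ne_iff.1 h
    rw [Function.onFun, Set.disjoint_left]
    exact fun x hx hx' => Set.disjoint_left.1 (disjoint_dy_div (hG v) (J v)
      (fun h => hv (Fin.ext h))) (hx v (Set.mem_univ v)) (hx' v (Set.mem_univ v))
  have hsum : ∀ n : Measure (∀ v, X v), n (Set.univ.pi fun v => G v (J v)) =
      ∑ e : ι → Fin K, n (Set.univ.pi fun v => dy (G v) (e v) (J v / 2 ^ (e v : ℕ))) := by
    intro n
    rw [hun, measure_iUnion hdis hd, tsum_fintype]
  rw [hsum n, ← Measure.pi_pi μ, hsum (Measure.pi μ), Finset.mul_sum]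
  refine (sqd_sum_le _ _ _).trans ?_
  rw [Finset.card_univ, Fintype.card_pi, Finset.prod_const, Fintype.card_fin, Finset.card_univ,
    Nat.cast_pow]
  refine mul_le_mul' le_rfl (Finset.sum_le_sum fun e _ => ?_)
  have hlt : ∀ v, J v / 2 ^ (e v : ℕ) < 2 ^ K := fun v => (Nat.div_le_self _ _).trans_lt (hJ v)
  rw [Measure.pi_pi]
  obtain ⟨i₀, hi₀⟩ : ∃ i₀ : ι → Fin (2 ^ K), ∀ v, (i₀ v : ℕ) = J v / 2 ^ (e v : ℕ) :=
    ⟨fun v => ⟨_, hlt v⟩, fun _ => rfl⟩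
  simp only [← hi₀]
  exact Finset.single_le_sum (f := fun i : ι → Fin (2 ^ K) =>
      sqd (n (Set.univ.pi fun v => dy (G v) (e v) (i v))) (c * ∏ v, μ v (dy (G v) (e v) (i v))))
    (fun _ _ => zero_le) (Finset.mem_univ i₀)

variable {Y : Type*} [MeasurableSpace Y] {ρ : Measure Y} {φ : Y → ℝ≥0∞}
  {ν : Y → Measure (∀ v, X v)}

lemma measurable_dyTotal
    (hν : ∀ A : ∀ v, Set (X v), (∀ v, MeasurableSet (A v)) → Measurable fun M => ν M (Set.univ.pi A))
    (hm : ∀ v j, MeasurableSet (G v j)) (K : ℕ) : Measurable fun M => dyTotal μ c G K (ν M) :=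
  Finset.measurable_sum _ fun _ _ => Finset.measurable_sum _ fun _ _ =>
    (hν _ fun v => measurableSet_dy hm v _ _).sqd measurable_const

lemma lintegral_dyTotal_le (hφ : Measurable φ)
    (hν : ∀ A : ∀ v, Set (X v), (∀ v, MeasurableSet (A v)) → Measurable fun M => ν M (Set.univ.pi A))
    {K₀ : ℝ≥0∞} (H : ∀ A : ∀ v, Set (X v), (∀ v, MeasurableSet (A v)) → (∀ v, μ v (A v) ≠ ∞) →
      ∫⁻ M, φ M * sqd (ν M (Set.univ.pi A)) (c * ∏ v, μ v (A v)) ∂ρ ≤ K₀ * ∏ v, μ v (A v))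
    (hG : ∀ v, Monotone (G v)) (hm : ∀ v j, MeasurableSet (G v j))
    {b : ι → ℝ≥0∞} (hb : ∀ v, b v ≠ ∞) (hGb : ∀ v j, μ v (G v j) ≤ b v) (K : ℕ) :
    ∫⁻ M, φ M * dyTotal μ c G K (ν M) ∂ρ ≤ K₀ * (K ^ Fintype.card ι * ∏ v, b v) := by
  have hmeas : ∀ (e : ι → Fin K) (i : ι → Fin (2 ^ K)), Measurable fun M =>
      φ M * sqd (ν M (Set.univ.pi fun v => dy (G v) (e v) (i v)))
        (c * ∏ v, μ v (dy (G v) (e v) (i v))) := fun e i =>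
    hφ.mul ((hν _ fun v => measurableSet_dy hm v _ _).sqd measurable_const)
  simp only [dyTotal, Finset.mul_sum]
  rw [lintegral_finsetSum _ fun e _ => Finset.measurable_sum _ fun i _ => hmeas e i]
  have key : ∀ e : ι → Fin K, ∫⁻ M, ∑ i : ι → Fin (2 ^ K),
      φ M * sqd (ν M (Set.univ.pi fun v => dy (G v) (e v) (i v)))
        (c * ∏ v, μ v (dy (G v) (e v) (i v))) ∂ρ ≤ K₀ * ∏ v, b v := by
    intro e
    rw [lintegral_finsetSum _ fun i _ => hmeas e i]
    calc _ ≤ ∑ i : ι → Fin (2 ^ K), K₀ * ∏ v, μ v (dy (G v) (e v) (i v)) := by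
          refine Finset.sum_le_sum fun i _ => H _ (fun v => measurableSet_dy hm v _ _) fun v => ?_
          exact ne_top_of_le_ne_top (hb v) ((measure_mono Set.sdiff_subset).trans (hGb v _))
      _ = K₀ * ∑ i : ι → Fin (2 ^ K), ∏ v, μ v (dy (G v) (e v) (i v)) := by
          rw [Finset.mul_sum]
      _ = K₀ * ∏ v, ∑ i : Fin (2 ^ K), μ v (dy (G v) (e v) i) := by
          rw [Finset.prod_univ_sum, Fintype.piFinset_univ]
      _ ≤ _ := by
          refine mul_le_mul' le_rfl (Finset.prod_le_prod' fun v _ => ?_)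
          have hdis : Pairwise (Function.onFun Disjoint
              fun i : Fin (2 ^ K) => dy (G v) (e v) i) := fun i i' h =>
            pairwise_disjoint_dy (hG v) (e v) fun h' => h (Fin.ext h')
          rw [← tsum_fintype (L := .unconditional _),
            ← measure_iUnion hdis fun i => measurableSet_dy hm v _ _]
          refine (measure_mono (Set.iUnion_subset fun i => ?_)).trans
            (hGb v (2 ^ K * 2 ^ (e v : ℕ)))
          exact Set.sdiff_subset.trans (hG v (Nat.mul_le_mul_right _ i.2.le))
  refine (Finset.sum_le_sum fun e _ => key e).trans (le_of_eq ?_)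
  rw [Finset.sum_const, Finset.card_univ, Fintype.card_pi, Finset.prod_const, Fintype.card_fin,
    Finset.card_univ, nsmul_eq_mul, Nat.cast_pow]
  ring

end Maximal

lemma exists_countable_cofinal (T : Set ℝ) :
    ∃ T' ⊆ T, T'.Countable ∧ ∀ t ∈ T, ∃ t' ∈ T', t ≤ t' := by
  choose f hfT hf using fun q : {q : ℚ // ∃ t ∈ T, (q : ℝ) < t} => q.2
  refine ⟨Set.range f ∪ {t | t ∈ T ∧ ∀ t' ∈ T, t' ≤ t}, ?_, ?_, fun t ht => ?_⟩
  · rintro t (⟨q, rfl⟩ | h)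
    · exact hfT q
    · exact h.1
  · refine (Set.countable_range f).union (Set.Subsingleton.countable ?_)
    exact fun a ha b hb => le_antisymm (hb.2 a ha.1) (ha.2 b hb.1)
  · by_cases h : ∀ t' ∈ T, t' ≤ t
    · exact ⟨t, Or.inr ⟨ht, h⟩, le_rfl⟩
    · push Not at h
      obtain ⟨t', ht', hlt⟩ := h
      obtain ⟨q, hq1, hq2⟩ := exists_rat_btwn hlt
      exact ⟨f ⟨q, t', ht', hq2⟩, Or.inl ⟨_, rfl⟩, hq1.le.trans (hf ⟨q, t', ht', hq2⟩).le⟩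

lemma exists_countable_coinitial (T : Set ℝ) :
    ∃ T' ⊆ T, T'.Countable ∧ ∀ t ∈ T, ∃ t' ∈ T', t' ≤ t := by
  obtain ⟨T', h1, h2, h3⟩ := exists_countable_cofinal (Neg.neg ⁻¹' T)
  refine ⟨Neg.neg '' T', ?_, h2.image _, fun t ht => ?_⟩
  · rintro _ ⟨t, ht, rfl⟩
    exact h1 ht
  · obtain ⟨t', ht', h⟩ := h3 (-t) (by simpa using ht)
    exact ⟨-t', ⟨t', ht', rfl⟩, by linarith⟩

section Chains

variable {α : Type*} [MeasurableSpace α] (μ : Measure α) (E : ℝ → Set α)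

/-- The union of the members of a family whose measure is at most `a`. -/
def upSet (a : ℝ≥0∞) : Set α := ⋃ t ∈ {t | μ (E t) ≤ a}, E t

/-- The intersection of the members of a family whose measure is at least `a`. -/
def loSet (a : ℝ≥0∞) : Set α := ⋂ t ∈ {t | a ≤ μ (E t)}, E t

variable {μ E}

lemma upSet_mono {a b : ℝ≥0∞} (h : a ≤ b) : upSet μ E a ⊆ upSet μ E b :=
  Set.biUnion_subset_biUnion_left fun _ ht => le_trans ht h

lemma loSet_mono {a b : ℝ≥0∞} (h : a ≤ b) : loSet μ E a ⊆ loSet μ E b :=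
  Set.biInter_subset_biInter_left fun _ ht => le_trans h ht

lemma subset_upSet {t : ℝ} {a : ℝ≥0∞} (h : μ (E t) ≤ a) : E t ⊆ upSet μ E a :=
  Set.subset_biUnion_of_mem (u := E) h

lemma loSet_subset {t : ℝ} {a : ℝ≥0∞} (h : a ≤ μ (E t)) : loSet μ E a ⊆ E t :=
  Set.biInter_subset_of_mem h

lemma upSet_eq_empty (h1 : ∀ t, 1 ≤ μ (E t)) : upSet μ E 0 = ∅ := by
  simp only [upSet, Set.iUnion_eq_empty]
  intro t ht
  exact absurd ((h1 t).trans ht) (by simp)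

lemma exists_upSet_eq (hE : Monotone E) (a : ℝ≥0∞) : ∃ T : Set ℝ, T.Countable ∧
    (∀ t ∈ T, μ (E t) ≤ a) ∧ upSet μ E a = ⋃ t ∈ T, E t := by
  obtain ⟨T, h1, h2, h3⟩ := exists_countable_cofinal {t | μ (E t) ≤ a}
  refine ⟨T, h2, h1, (Set.iUnion₂_subset fun t ht => ?_).antisymm (Set.biUnion_subset_biUnion_left h1)⟩
  obtain ⟨t', ht', h⟩ := h3 t ht
  exact (hE h).trans (Set.subset_biUnion_of_mem (u := E) ht')

lemma exists_loSet_eq (hE : Monotone E) (a : ℝ≥0∞) : ∃ T : Set ℝ, T.Countable ∧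
    (∀ t ∈ T, a ≤ μ (E t)) ∧ (∀ t, a ≤ μ (E t) → ∃ t' ∈ T, t' ≤ t) ∧
      loSet μ E a = ⋂ t ∈ T, E t := by
  obtain ⟨T, h1, h2, h3⟩ := exists_countable_coinitial {t | a ≤ μ (E t)}
  refine ⟨T, h2, h1, h3, (Set.biInter_subset_biInter_left h1).antisymm
    (Set.subset_iInter₂ fun t ht => ?_)⟩
  obtain ⟨t', ht', h⟩ := h3 t ht
  exact (Set.biInter_subset_of_mem ht').trans (hE h)

lemma measurableSet_upSet (hE : Monotone E) (hm : ∀ t, MeasurableSet (E t)) (a : ℝ≥0∞) :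
    MeasurableSet (upSet μ E a) := by
  obtain ⟨T, h1, -, h2⟩ := exists_upSet_eq (μ := μ) hE a
  rw [h2]
  exact MeasurableSet.biUnion h1 fun t _ => hm t

lemma measurableSet_loSet (hE : Monotone E) (hm : ∀ t, MeasurableSet (E t)) (a : ℝ≥0∞) :
    MeasurableSet (loSet μ E a) := by
  obtain ⟨T, h1, -, -, h2⟩ := exists_loSet_eq (μ := μ) hE a
  rw [h2]
  exact MeasurableSet.biInter h1 fun t _ => hm t

lemma measure_upSet_le (hE : Monotone E) (a : ℝ≥0∞) : μ (upSet μ E a) ≤ a := by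
  obtain ⟨T, h1, h2, h3⟩ := exists_upSet_eq (μ := μ) hE a
  rw [h3, measure_biUnion_eq_iSup h1]
  · exact iSup₂_le h2
  · intro t ht t' ht'
    rcases le_total t t' with h | h
    · exact ⟨t', ht', hE h, le_rfl⟩
    · exact ⟨t, ht, le_rfl, hE h⟩

lemma le_measure_loSet (hE : Monotone E) (hm : ∀ t, MeasurableSet (E t)) {a : ℝ≥0∞} {t₀ : ℝ}
    (h₀ : a ≤ μ (E t₀)) (hf : ∀ t, μ (E t) ≠ ∞) : a ≤ μ (loSet μ E a) := by
  obtain ⟨T, h1, h2, h3, h4⟩ := exists_loSet_eq (μ := μ) hE a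
  obtain ⟨t', ht', -⟩ := h3 t₀ h₀
  have := h1.to_subtype
  rw [h4, Set.biInter_eq_iInter, Directed.measure_iInter (fun t : T => (hm t).nullMeasurableSet) ?_
    ⟨⟨t', ht'⟩, hf t'⟩]
  · exact le_iInf fun t => h2 t t.2
  · intro t t'
    rcases le_total t t' with h | h
    · exact ⟨t, subset_rfl, hE h⟩
    · exact ⟨t', hE h, subset_rfl⟩

variable (μ E)

/-- The increasing chain of outer approximations with step `u` and `L` steps. -/
def upChain (u : ℝ) (L j : ℕ) : Set α := upSet μ E (ENNReal.ofReal ((min j L : ℕ) * u))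

/-- The increasing chain of inner approximations with step `u` and `L` steps. -/
def loChain (u : ℝ) (L j : ℕ) : Set α :=
  if j = 0 then ∅ else upSet μ E (ENNReal.ofReal (L * u)) ∩ loSet μ E (ENNReal.ofReal (j * u))

variable {μ E}

lemma upChain_mono {u : ℝ} (hu : 0 ≤ u) (L : ℕ) : Monotone (upChain μ E u L) := fun _ _ h =>
  upSet_mono (ENNReal.ofReal_le_ofReal (mul_le_mul_of_nonneg_right
    (by exact_mod_cast min_le_min_right L h) hu))

lemma loChain_mono {u : ℝ} (hu : 0 ≤ u) (L : ℕ) : Monotone (loChain μ E u L) := by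
  intro i j h
  by_cases hi : i = 0
  · simp [loChain, hi]
  · have hj : j ≠ 0 := by omega
    rw [loChain, if_neg hi, loChain, if_neg hj]
    exact Set.inter_subset_inter_right _ (loSet_mono (ENNReal.ofReal_le_ofReal
      (mul_le_mul_of_nonneg_right (by exact_mod_cast h) hu)))

lemma upChain_zero (h1 : ∀ t, 1 ≤ μ (E t)) (u : ℝ) (L : ℕ) : upChain μ E u L 0 = ∅ := by
  rw [upChain, Nat.zero_min, Nat.cast_zero, zero_mul, ENNReal.ofReal_zero, upSet_eq_empty h1]

lemma loChain_zero (u : ℝ) (L : ℕ) : loChain μ E u L 0 = ∅ := if_pos rfl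

lemma measurableSet_upChain (hE : Monotone E) (hm : ∀ t, MeasurableSet (E t)) (u : ℝ) (L j : ℕ) :
    MeasurableSet (upChain μ E u L j) := measurableSet_upSet hE hm _

lemma measurableSet_loChain (hE : Monotone E) (hm : ∀ t, MeasurableSet (E t)) (u : ℝ) (L j : ℕ) :
    MeasurableSet (loChain μ E u L j) := by
  rw [loChain]
  split_ifs
  · exact MeasurableSet.empty
  · exact (measurableSet_upSet hE hm _).inter (measurableSet_loSet hE hm _)

lemma measure_upChain_le (hE : Monotone E) {u : ℝ} (hu : 0 ≤ u) (L j : ℕ) :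
    μ (upChain μ E u L j) ≤ ENNReal.ofReal (L * u) :=
  (measure_upSet_le hE _).trans (ENNReal.ofReal_le_ofReal
    (mul_le_mul_of_nonneg_right (by exact_mod_cast min_le_right j L) hu))

lemma measure_loChain_le (hE : Monotone E) (u : ℝ) (L j : ℕ) :
    μ (loChain μ E u L j) ≤ ENNReal.ofReal (L * u) := by
  rw [loChain]
  split_ifs
  · simp
  · exact (measure_mono Set.inter_subset_left).trans (measure_upSet_le hE _)

lemma measure_upChain_le' (hE : Monotone E) {u : ℝ} (hu : 0 ≤ u) (L j : ℕ) :
    μ (upChain μ E u L j) ≤ ENNReal.ofReal (j * u) :=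
  (measure_upSet_le hE _).trans (ENNReal.ofReal_le_ofReal
    (mul_le_mul_of_nonneg_right (by exact_mod_cast min_le_left j L) hu))

lemma subset_upChain {u : ℝ} {L j : ℕ} (hj : j ≤ L) {t : ℝ} (h : μ (E t) ≤ ENNReal.ofReal (j * u)) :
    E t ⊆ upChain μ E u L j := by
  rw [upChain, min_eq_left hj]
  exact subset_upSet h

lemma loChain_subset {u : ℝ} {L j : ℕ} {t : ℝ} (h : ENNReal.ofReal (j * u) ≤ μ (E t)) :
    loChain μ E u L j ⊆ E t := by
  rw [loChain]
  split_ifs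
  · exact Set.empty_subset _
  · exact Set.inter_subset_right.trans (loSet_subset h)

lemma le_measure_loChain (hE : Monotone E) (hm : ∀ t, MeasurableSet (E t))
    (hf : ∀ t, μ (E t) ≠ ∞) {u : ℝ} {L j : ℕ} {t : ℝ} (h : ENNReal.ofReal (j * u) ≤ μ (E t))
    (hL : μ (E t) ≤ ENNReal.ofReal (L * u)) :
    ENNReal.ofReal (j * u) ≤ μ (loChain μ E u L j) := by
  rw [loChain]
  split_ifs with h0
  · simp [h0]
  · refine (le_measure_loSet hE hm h hf).trans (measure_mono (Set.subset_inter ?_ subset_rfl))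
    exact (loSet_subset h).trans (subset_upSet hL)

end Chains

lemma abs_toReal_sub_le_of_sqd_le {a b : ℝ≥0∞} (hb : b ≠ ∞) {x : ℝ} (hx : 0 ≤ x)
    (h : sqd a b ≤ ENNReal.ofReal x) : a ≠ ∞ ∧ |a.toReal - b.toReal| ≤ √x := by
  have ha : a ≠ ∞ := by
    rintro rfl
    rw [sqd, ENNReal.top_sub hb] at h
    simp at h
  refine ⟨ha, Real.abs_le_sqrt ?_⟩
  rcases le_total a b with hab | hab
  · have h1 := ENNReal.toReal_le_of_le_ofReal hx (le_trans le_add_self h)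
    rw [ENNReal.toReal_pow, ENNReal.toReal_sub_of_le hab hb] at h1
    nlinarith
  · have h1 := ENNReal.toReal_le_of_le_ofReal hx (le_trans le_self_add h)
    rw [ENNReal.toReal_pow, ENNReal.toReal_sub_of_le hab ha] at h1
    exact h1

lemma one_add_pow_le_three {x : ℝ} (hx : 0 ≤ x) (hx1 : x ≤ 1) (r : ℕ) :
    (1 + x) ^ r ≤ 1 + 3 ^ r * x := by
  induction r with
  | zero => simp [hx]
  | succ r ih =>
    have h3 : (1 : ℝ) ≤ 3 ^ r := one_le_pow₀ (by norm_num)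
    rw [pow_succ, pow_succ]
    have := mul_le_mul_of_nonneg_right ih (show 0 ≤ 1 + x by linarith)
    nlinarith [mul_nonneg hx (sub_nonneg.2 hx1), mul_nonneg hx hx, mul_nonneg (sub_nonneg.2 h3) hx,
      mul_nonneg (mul_nonneg hx (sub_nonneg.2 hx1)) (le_trans zero_le_one h3)]

lemma one_sub_pow_ge_three {x : ℝ} (hx : 0 ≤ x) (hx1 : x ≤ 1) (r : ℕ) :
    1 - 3 ^ r * x ≤ (1 - x) ^ r := by
  have h := one_add_mul_le_pow (a := -x) (by linarith) r
  have h3 : (r : ℝ) ≤ 3 ^ r := by exact_mod_cast (Nat.lt_pow_self (by norm_num : 1 < 3)).le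
  rw [← sub_eq_add_neg] at h
  nlinarith

section Chaining

variable {ι : Type*} [Fintype ι] [DecidableEq ι] {X : ι → Type*} [∀ v, MeasurableSpace (X v)]
  {μ : ∀ v, Measure (X v)} [∀ v, SigmaFinite (μ v)] {c : ℝ≥0∞} {E : ∀ v, ℝ → Set (X v)}

variable (μ E)

/-- The step of the chains at the dyadic scale `l`. -/
def stepAt (l : ι → ℕ) (v : ι) : ℝ := 2 ^ l v / 2 ^ ∑ v, l v

/-- The outer chains at the dyadic scale `l`. -/
def upAt (l : ι → ℕ) (v : ι) (j : ℕ) : Set (X v) :=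
  upChain (μ v) (E v) (stepAt l v) (2 ^ (∑ v, l v + 1)) j

/-- The inner chains at the dyadic scale `l`. -/
def loAt (l : ι → ℕ) (v : ι) (j : ℕ) : Set (X v) :=
  loChain (μ v) (E v) (stepAt l v) (2 ^ (∑ v, l v + 1)) j

variable {μ E}

lemma stepAt_pos (l : ι → ℕ) (v : ι) : 0 < stepAt l v := by
  rw [stepAt]
  positivity

lemma mul_stepAt (l : ι → ℕ) (v : ι) :
    ((2 ^ (∑ v, l v + 1) : ℕ) : ℝ) * stepAt l v = 2 ^ (l v + 1) := by
  rw [stepAt]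
  push_cast
  field_simp
  ring

lemma prod_toReal_le {A : ∀ v, Set (X v)} {a : ι → ℝ} (ha : ∀ v, 0 ≤ a v)
    (h : ∀ v, μ v (A v) ≤ ENNReal.ofReal (a v)) : ∏ v, (μ v (A v)).toReal ≤ ∏ v, a v :=
  Finset.prod_le_prod (fun _ _ => ENNReal.toReal_nonneg) fun v _ =>
    ENNReal.toReal_le_of_le_ofReal (ha v) (h v)

lemma abs_count_sub_le (hE : ∀ v, Monotone (E v)) (hm : ∀ v t, MeasurableSet (E v t))
    (h1 : ∀ v t, 1 ≤ μ v (E v t)) (hf : ∀ v t, μ v (E v t) ≠ ∞) (hc : c ≠ ∞)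
    (n : Measure (∀ v, X v)) (t : ι → ℝ) (l : ι → ℕ)
    (hl : ∀ v, 2 ^ l v ≤ (μ v (E v (t v))).toReal)
    (hl' : ∀ v, (μ v (E v (t v))).toReal < 2 ^ (l v + 1)) {B : ℝ} (hB : 0 ≤ B)
    (hup : ((∑ v, l v + 2 : ℕ) : ℝ≥0∞) ^ Fintype.card ι * dyTotal μ c (upAt μ E l) (∑ v, l v + 2) n ≤
      ENNReal.ofReal B)
    (hlo : ((∑ v, l v + 2 : ℕ) : ℝ≥0∞) ^ Fintype.card ι * dyTotal μ c (loAt μ E l) (∑ v, l v + 2) n ≤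
      ENNReal.ofReal B) :
    n (Set.univ.pi fun v => E v (t v)) ≠ ∞ ∧
      |(n (Set.univ.pi fun v => E v (t v))).toReal - c.toReal * ∏ v, (μ v (E v (t v))).toReal| ≤
        √B + c.toReal * 6 ^ Fintype.card ι := by
  set V : ι → ℝ := fun v => (μ v (E v (t v))).toReal with hV
  have hVE : ∀ v, μ v (E v (t v)) = ENNReal.ofReal (V v) := fun v => (ENNReal.ofReal_toReal (hf v _)).symm
  have hV0 : ∀ v, 0 < V v := fun v => lt_of_lt_of_le (by positivity) (hl v)
  set k := ∑ v, l v with hk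
  set x : ℝ := 1 / 2 ^ k with hx
  have hx0 : 0 ≤ x := by positivity
  have hx1 : x ≤ 1 := by
    rw [hx, div_le_one (by positivity)]
    exact one_le_pow₀ (by norm_num)
  have hux : ∀ v, stepAt l v ≤ V v * x := fun v => by
    rw [stepAt, hx, mul_one_div]
    exact div_le_div_of_nonneg_right (hl v) (by positivity)
  set J : ι → ℕ := fun v => ⌊V v / stepAt l v⌋₊ with hJ
  have hJ1 : ∀ v, (J v : ℝ) * stepAt l v ≤ V v := fun v => by
    rw [← le_div_iff₀ (stepAt_pos l v)]
    exact Nat.floor_le (div_nonneg (hV0 v).le (stepAt_pos l v).le)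
  have hJ2 : ∀ v, V v ≤ ((J v + 1 : ℕ) : ℝ) * stepAt l v := fun v => by
    rw [← div_le_iff₀ (stepAt_pos l v)]
    push_cast
    exact (Nat.lt_floor_add_one _).le
  have hVL : ∀ v, V v ≤ ((2 ^ (k + 1) : ℕ) : ℝ) * stepAt l v := fun v => by
    rw [mul_stepAt]
    exact (hl' v).le
  have hJ3 : ∀ v, J v + 1 ≤ 2 ^ (k + 1) := fun v => by
    have : (J v : ℝ) < ((2 ^ (k + 1) : ℕ) : ℝ) := by
      refine lt_of_mul_lt_mul_right ?_ (stepAt_pos l v).le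
      rw [mul_stepAt]
      exact (hJ1 v).trans_lt (hl' v)
    exact_mod_cast this
  have hJ4 : ∀ v, J v + 1 < 2 ^ (k + 2) := fun v =>
    (hJ3 v).trans_lt (Nat.pow_lt_pow_right (by norm_num) (by omega))
  have hxV : x * ∏ v, V v ≤ 2 ^ Fintype.card ι := by
    have : ∏ v, V v ≤ ∏ v, (2 : ℝ) ^ (l v + 1) :=
      Finset.prod_le_prod (fun v _ => (hV0 v).le) fun v _ => (hl' v).le
    rw [Finset.prod_pow_eq_pow_sum, Finset.sum_add_distrib, ← hk] at this
    simp only [Finset.sum_const, Finset.card_univ, smul_eq_mul, mul_one] at this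
    rw [hx, one_div, inv_mul_le_iff₀ (by positivity), ← pow_add]
    exact this
  have h63 : (6 : ℝ) ^ Fintype.card ι = 3 ^ Fintype.card ι * 2 ^ Fintype.card ι := by
    rw [← mul_pow]; norm_num
  have hP0 : 0 ≤ ∏ v, V v := Finset.prod_nonneg fun v _ => (hV0 v).le
  have h30 : (0 : ℝ) ≤ 3 ^ Fintype.card ι := by positivity
  have hupP : ∏ v, (μ v (upAt μ E l v (J v + 1))).toReal ≤ (∏ v, V v) + 6 ^ Fintype.card ι := by
    calc ∏ v, (μ v (upAt μ E l v (J v + 1))).toReal ≤ ∏ v, (V v * (1 + x)) := by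
          refine prod_toReal_le (fun v => mul_nonneg (hV0 v).le (by linarith)) fun v =>
            (measure_upChain_le' (hE v) (stepAt_pos l v).le _ _).trans (ENNReal.ofReal_le_ofReal ?_)
          push_cast
          linarith [hJ1 v, hux v]
      _ = (∏ v, V v) * (1 + x) ^ Fintype.card ι := by
          rw [Finset.prod_mul_distrib, Finset.prod_const, Finset.card_univ]
      _ ≤ (∏ v, V v) * (1 + 3 ^ Fintype.card ι * x) :=
          mul_le_mul_of_nonneg_left (one_add_pow_le_three hx0 hx1 _) hP0
      _ ≤ _ := by
          rw [h63]
          nlinarith [mul_le_mul_of_nonneg_left hxV h30]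
  have hloP : (∏ v, V v) - 6 ^ Fintype.card ι ≤ ∏ v, (μ v (loAt μ E l v (J v))).toReal := by
    calc (∏ v, V v) - 6 ^ Fintype.card ι ≤ (∏ v, V v) * (1 - 3 ^ Fintype.card ι * x) := by
          rw [h63]
          nlinarith [mul_le_mul_of_nonneg_left hxV h30]
      _ ≤ (∏ v, V v) * (1 - x) ^ Fintype.card ι :=
          mul_le_mul_of_nonneg_left (one_sub_pow_ge_three hx0 hx1 _) hP0
      _ = ∏ v, (V v * (1 - x)) := by
          rw [Finset.prod_mul_distrib, Finset.prod_const, Finset.card_univ]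
      _ ≤ _ := by
          refine Finset.prod_le_prod (fun v _ => mul_nonneg (hV0 v).le (by linarith)) fun v _ => ?_
          have h := le_measure_loChain (μ := μ v) (hE v) (hm v) (hf v) (u := stepAt l v)
            (L := 2 ^ (k + 1)) (j := J v) (t := t v)
            (by rw [hVE]; exact ENNReal.ofReal_le_ofReal (hJ1 v))
            (by rw [hVE]; exact ENNReal.ofReal_le_ofReal (hVL v))
          have h' := (ENNReal.ofReal_le_iff_le_toReal (ne_top_of_le_ne_top ENNReal.ofReal_ne_top
            (measure_loChain_le (hE v) _ _ _))).1 h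
          refine le_trans ?_ h'
          have := hJ2 v
          push_cast at this
          linarith [hux v]
  have hne : ∀ {A : ∀ v, Set (X v)}, (∀ v, μ v (A v) ≠ ∞) → c * ∏ v, μ v (A v) ≠ ∞ := fun h =>
    ENNReal.mul_ne_top hc (ENNReal.prod_ne_top fun v _ => h v)
  have hup1 := sqd_le_dyTotal (μ := μ) (c := c) (G := upAt μ E l) (K := k + 2) (J := fun v => J v + 1)
    (fun v => upChain_mono (stepAt_pos l v).le _) (fun v => upChain_zero (h1 v) _ _)
    (fun v j => measurableSet_upChain (hE v) (hm v) _ _ _) hJ4 n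
  have hlo1 := sqd_le_dyTotal (μ := μ) (c := c) (G := loAt μ E l) (K := k + 2) (J := J)
    (fun v => loChain_mono (stepAt_pos l v).le _) (fun v => loChain_zero _ _)
    (fun v j => measurableSet_loChain (hE v) (hm v) _ _ _) (fun v => (Nat.lt_succ_self _).trans (hJ4 v)) n
  obtain ⟨a1, a2⟩ := abs_toReal_sub_le_of_sqd_le (hne (A := fun v => upAt μ E l v (J v + 1)) fun v => ne_top_of_le_ne_top
    ENNReal.ofReal_ne_top (measure_upChain_le (hE v) (stepAt_pos l v).le _ _)) hB (hup1.trans hup)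
  obtain ⟨b1, b2⟩ := abs_toReal_sub_le_of_sqd_le (hne (A := fun v => loAt μ E l v (J v)) fun v => ne_top_of_le_ne_top
    ENNReal.ofReal_ne_top (measure_loChain_le (hE v) _ _ _)) hB (hlo1.trans hlo)
  have hsub1 : n (Set.univ.pi fun v => E v (t v)) ≤ n (Set.univ.pi fun v => upAt μ E l v (J v + 1)) :=
    measure_mono (Set.pi_mono fun v _ => subset_upChain (hJ3 v)
      (by rw [hVE]; exact ENNReal.ofReal_le_ofReal (hJ2 v)))
  have hsub2 : n (Set.univ.pi fun v => loAt μ E l v (J v)) ≤ n (Set.univ.pi fun v => E v (t v)) :=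
    measure_mono (Set.pi_mono fun v _ => loChain_subset
      (by rw [hVE]; exact ENNReal.ofReal_le_ofReal (hJ1 v)))
  have hfin := ne_top_of_le_ne_top a1 hsub1
  refine ⟨hfin, ?_⟩
  have r1 := ENNReal.toReal_mono a1 hsub1
  have r2 := ENNReal.toReal_mono hfin hsub2
  rw [ENNReal.toReal_mul, ENNReal.toReal_prod, abs_le] at a2 b2
  have hc0 : 0 ≤ c.toReal := ENNReal.toReal_nonneg
  have q1 := mul_le_mul_of_nonneg_left hupP hc0
  have q2 := mul_le_mul_of_nonneg_left hloP hc0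
  rw [abs_le]
  constructor <;> linarith [a2.1, a2.2, b2.1, b2.2]

variable {Y : Type*} [MeasurableSpace Y] {ρ : Measure Y} {φ : Y → ℝ≥0∞}
  {ν : Y → Measure (∀ v, X v)}

lemma summable_polynomial_mul_pow (r : ℕ) {q : ℝ} (hq : 0 < q) (hq1 : q < 1) :
    Summable fun k : ℕ => ((k : ℝ) + 2) ^ r * q ^ k := by
  have h := (summable_nat_add_iff 2).2 (summable_pow_mul_geometric_of_norm_lt_one r
    (r := q) (by rwa [Real.norm_of_nonneg hq.le]))
  refine (h.mul_left (q ^ 2)⁻¹).congr fun k => ?_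
  push_cast
  rw [pow_add]
  field_simp

variable (μ c E ν) in
/-- The weighted sum over all dyadic scales of the square discrepancies of the chains. -/
def chainTotal (a : ℝ) (M : Y) : ℝ≥0∞ :=
  ∑' k : ℕ, ∑ l ∈ Finset.piAntidiag (Finset.univ : Finset ι) k,
    ENNReal.ofReal (((k : ℝ) + 2) ^ Fintype.card ι / a ^ k) *
      (dyTotal μ c (upAt μ E l) (k + 2) (ν M) + dyTotal μ c (loAt μ E l) (k + 2) (ν M))

lemma measurable_chainTotal (hE : ∀ v, Monotone (E v)) (hm : ∀ v t, MeasurableSet (E v t))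
    (hν : ∀ A : ∀ v, Set (X v), (∀ v, MeasurableSet (A v)) → Measurable fun M => ν M (Set.univ.pi A))
    (a : ℝ) : Measurable (chainTotal μ c E ν a) :=
  Measurable.tsum fun _ => Finset.measurable_sum _ fun _ _ => measurable_const.mul
    ((measurable_dyTotal hν (fun v _ => measurableSet_upChain (hE v) (hm v) _ _ _) _).add
      (measurable_dyTotal hν (fun v _ => measurableSet_loChain (hE v) (hm v) _ _ _) _))

lemma lintegral_chainTotal_ne_top (hE : ∀ v, Monotone (E v)) (hm : ∀ v t, MeasurableSet (E v t))
    (hφ : Measurable φ)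
    (hν : ∀ A : ∀ v, Set (X v), (∀ v, MeasurableSet (A v)) → Measurable fun M => ν M (Set.univ.pi A))
    {K₀ : ℝ≥0∞} (hK : K₀ ≠ ∞)
    (H : ∀ A : ∀ v, Set (X v), (∀ v, MeasurableSet (A v)) → (∀ v, μ v (A v) ≠ ∞) →
      ∫⁻ M, φ M * sqd (ν M (Set.univ.pi A)) (c * ∏ v, μ v (A v)) ∂ρ ≤ K₀ * ∏ v, μ v (A v))
    {a : ℝ} (ha : 2 < a) : ∫⁻ M, φ M * chainTotal μ c E ν a M ∂ρ ≠ ∞ := by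
  set r := Fintype.card ι with hr
  have hup : ∀ l : ι → ℕ, ∀ v j, MeasurableSet (upAt μ E l v j) := fun l v j =>
    measurableSet_upChain (hE v) (hm v) _ _ _
  have hlo : ∀ l : ι → ℕ, ∀ v j, MeasurableSet (loAt μ E l v j) := fun l v j =>
    measurableSet_loChain (hE v) (hm v) _ _ _
  have hmup : ∀ (l : ι → ℕ) (k : ℕ), Measurable fun M => dyTotal μ c (upAt μ E l) k (ν M) :=
    fun l k => measurable_dyTotal hν (hup l) k
  have hmlo : ∀ (l : ι → ℕ) (k : ℕ), Measurable fun M => dyTotal μ c (loAt μ E l) k (ν M) :=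
    fun l k => measurable_dyTotal hν (hlo l) k
  have hone : ∀ (k : ℕ) (l : ι → ℕ), l ∈ Finset.piAntidiag (Finset.univ : Finset ι) k →
      ∫⁻ M, φ M * (ENNReal.ofReal (((k : ℝ) + 2) ^ r / a ^ k) *
        (dyTotal μ c (upAt μ E l) (k + 2) (ν M) + dyTotal μ c (loAt μ E l) (k + 2) (ν M))) ∂ρ ≤
      2 * K₀ * 2 ^ r * ENNReal.ofReal (((k : ℝ) + 2) ^ (2 * r) * (2 / a) ^ k) := by
    intro k l hl
    have hlk : ∑ v, l v = k := (Finset.mem_piAntidiag.1 hl).1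
    have hb : ∏ v, ENNReal.ofReal (((2 ^ (∑ v, l v + 1) : ℕ) : ℝ) * stepAt l v) =
        ENNReal.ofReal (2 ^ k) * 2 ^ r := by
      simp only [mul_stepAt]
      rw [← ENNReal.ofReal_prod_of_nonneg fun v _ => by positivity, Finset.prod_pow_eq_pow_sum,
        Finset.sum_add_distrib, hlk, pow_add, ENNReal.ofReal_mul (by positivity)]
      congr 1
      rw [Finset.sum_const, Finset.card_univ, smul_eq_mul, mul_one, ENNReal.ofReal_pow (by norm_num),
        ENNReal.ofReal_ofNat]
    have h1 := lintegral_dyTotal_le (ρ := ρ) hφ hν H (G := upAt μ E l)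
      (fun v => upChain_mono (stepAt_pos l v).le _) (hup l)
      (fun v => ENNReal.ofReal_ne_top) (fun v j => measure_upChain_le (hE v) (stepAt_pos l v).le _ j)
      (k + 2)
    have h2 := lintegral_dyTotal_le (ρ := ρ) hφ hν H (G := loAt μ E l)
      (fun v => loChain_mono (stepAt_pos l v).le _) (hlo l)
      (fun v => ENNReal.ofReal_ne_top) (fun v j => measure_loChain_le (hE v) _ _ j) (k + 2)
    rw [hb] at h1 h2
    have hp1 : Measurable fun M => φ M * dyTotal μ c (upAt μ E l) (k + 2) (ν M) := hφ.mul (hmup l _)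
    have hp2 : Measurable fun M => φ M * (dyTotal μ c (upAt μ E l) (k + 2) (ν M) +
        dyTotal μ c (loAt μ E l) (k + 2) (ν M)) := hφ.mul ((hmup l _).add (hmlo l _))
    have hk2 : ((k + 2 : ℕ) : ℝ≥0∞) ^ r = ENNReal.ofReal (((k : ℝ) + 2) ^ r) := by
      rw [ENNReal.ofReal_pow (by positivity)]
      congr 1
      rw [← ENNReal.ofReal_natCast]
      push_cast
      rfl
    rw [← hr, hk2] at h1 h2
    simp_rw [mul_left_comm (φ _) (ENNReal.ofReal _)]
    rw [lintegral_const_mul _ hp2]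
    simp_rw [mul_add (φ _)]
    rw [lintegral_add_left hp1]
    refine (mul_le_mul_right (add_le_add h1 h2) _).trans (le_of_eq ?_)
    have : ((k : ℝ) + 2) ^ (2 * r) * (2 / a) ^ k =
        (((k : ℝ) + 2) ^ r / a ^ k) * (((k : ℝ) + 2) ^ r * 2 ^ k) := by
      rw [div_pow, two_mul, pow_add]
      ring
    have ha0 : 0 < a := by linarith
    rw [this, ENNReal.ofReal_mul (by positivity), ENNReal.ofReal_mul (by positivity)]
    ring
  have hterm : ∀ k : ℕ, ∑ l ∈ Finset.piAntidiag (Finset.univ : Finset ι) k,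
      ∫⁻ M, φ M * (ENNReal.ofReal (((k : ℝ) + 2) ^ r / a ^ k) *
        (dyTotal μ c (upAt μ E l) (k + 2) (ν M) + dyTotal μ c (loAt μ E l) (k + 2) (ν M))) ∂ρ ≤
      2 * K₀ * 2 ^ r * ENNReal.ofReal (((k : ℝ) + 2) ^ (3 * r) * (2 / a) ^ k) := by
    intro k
    have hcard : (Finset.piAntidiag (Finset.univ : Finset ι) k).card ≤ (k + 2) ^ r := by
      calc (Finset.piAntidiag (Finset.univ : Finset ι) k).card
          ≤ (Fintype.piFinset fun _ : ι => Finset.range (k + 2)).card := by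
            refine Finset.card_le_card fun l hl => ?_
            rw [Fintype.mem_piFinset]
            intro v
            have := Finset.single_le_sum (f := l) (fun _ _ => Nat.zero_le _) (Finset.mem_univ v)
            rw [(Finset.mem_piAntidiag.1 hl).1] at this
            exact Finset.mem_range.2 (by omega)
        _ = (k + 2) ^ r := by
            rw [Fintype.card_piFinset]
            simp [hr]
    refine (Finset.sum_le_card_nsmul _ _ _ (hone k)).trans ?_
    rw [nsmul_eq_mul, show 3 * r = r + 2 * r by ring, pow_add, mul_assoc (((k : ℝ) + 2) ^ r),
      ENNReal.ofReal_mul (p := ((k : ℝ) + 2) ^ r) (by positivity), mul_left_comm]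
    gcongr
    rw [← ENNReal.ofReal_natCast]
    refine ENNReal.ofReal_le_ofReal ?_
    exact_mod_cast hcard
  have hsum : ∫⁻ M, φ M * chainTotal μ c E ν a M ∂ρ = ∑' k : ℕ,
      ∑ l ∈ Finset.piAntidiag (Finset.univ : Finset ι) k,
      ∫⁻ M, φ M * (ENNReal.ofReal (((k : ℝ) + 2) ^ r / a ^ k) *
        (dyTotal μ c (upAt μ E l) (k + 2) (ν M) + dyTotal μ c (loAt μ E l) (k + 2) (ν M))) ∂ρ := by
    have hmm : ∀ (k : ℕ) (l : ι → ℕ), Measurable fun M =>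
        φ M * (ENNReal.ofReal (((k : ℝ) + 2) ^ r / a ^ k) *
        (dyTotal μ c (upAt μ E l) (k + 2) (ν M) + dyTotal μ c (loAt μ E l) (k + 2) (ν M))) :=
      fun k l => hφ.mul (measurable_const.mul ((hmup l _).add (hmlo l _)))
    simp only [chainTotal, ← ENNReal.tsum_mul_left, Finset.mul_sum]
    rw [lintegral_tsum fun k => (Finset.measurable_sum _ fun l _ => hmm k l).aemeasurable]
    exact tsum_congr fun k => lintegral_finsetSum _ fun l _ => hmm k l
  rw [hsum]
  refine ne_top_of_le_ne_top ?_ (ENNReal.tsum_le_tsum hterm)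
  rw [ENNReal.tsum_mul_left]
  refine ENNReal.mul_ne_top (ENNReal.mul_ne_top (ENNReal.mul_ne_top (by simp) hK)
    (ENNReal.pow_ne_top (by simp))) ?_
  exact (summable_polynomial_mul_pow (3 * r) (div_pos two_pos (by linarith))
    ((div_lt_one (by linarith)).2 ha)).tsum_ofReal_ne_top

/-- A second moment bound for boxes implies a pointwise counting estimate, uniform over products of
monotone families. -/
theorem ae_abs_count_sub_le (hE : ∀ v, Monotone (E v)) (hm : ∀ v t, MeasurableSet (E v t))
    (h1 : ∀ v t, 1 ≤ μ v (E v t)) (hf : ∀ v t, μ v (E v t) ≠ ∞) (hc : c ≠ ∞)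
    (hφ : Measurable φ)
    (hν : ∀ A : ∀ v, Set (X v), (∀ v, MeasurableSet (A v)) → Measurable fun M => ν M (Set.univ.pi A))
    {K₀ : ℝ≥0∞} (hK : K₀ ≠ ∞)
    (H : ∀ A : ∀ v, Set (X v), (∀ v, MeasurableSet (A v)) → (∀ v, μ v (A v) ≠ ∞) →
      ∫⁻ M, φ M * sqd (ν M (Set.univ.pi A)) (c * ∏ v, μ v (A v)) ∂ρ ≤ K₀ * ∏ v, μ v (A v))
    {δ : ℝ} (hδ : 1 / 2 < δ) :
    ∀ᵐ M ∂ρ, φ M ≠ 0 → ∃ C : ℝ, 0 < C ∧ ∀ t : ι → ℝ,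
      ν M (Set.univ.pi fun v => E v (t v)) ≠ ∞ ∧
      |(ν M (Set.univ.pi fun v => E v (t v))).toReal - c.toReal * ∏ v, (μ v (E v (t v))).toReal| ≤
        C * (∏ v, (μ v (E v (t v))).toReal) ^ δ := by
  set b : ℝ := 2 ^ δ with hb
  have hb0 : 0 < b := by positivity
  have ha : 2 < b ^ 2 := by
    rw [hb, ← Real.rpow_natCast, ← Real.rpow_mul (by norm_num)]
    conv_lhs => rw [← Real.rpow_one 2]
    exact Real.rpow_lt_rpow_of_exponent_lt (by norm_num) (by push_cast; linarith)
  have hfin := ae_lt_top (hφ.mul (measurable_chainTotal (μ := μ) (c := c) hE hm hν (b ^ 2)))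
    (lintegral_chainTotal_ne_top hE hm hφ hν hK H ha)
  filter_upwards [hfin] with M hM hM0
  set Tot := chainTotal μ c E ν (b ^ 2) M with hTot
  have hT : Tot ≠ ∞ := by
    intro h
    rw [Pi.mul_apply, ← hTot, h, ENNReal.mul_top hM0] at hM
    exact lt_irrefl _ hM
  refine ⟨√Tot.toReal + c.toReal * 6 ^ Fintype.card ι + 1, by positivity, fun t => ?_⟩
  have hV1 : ∀ v, 1 ≤ (μ v (E v (t v))).toReal := fun v => by
    rw [← ENNReal.toReal_one]
    exact ENNReal.toReal_mono (hf v _) (h1 v _)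
  choose l hl hl' using fun v => exists_nat_pow_near (hV1 v) (one_lt_two (α := ℝ))
  set k := ∑ v, l v with hk
  have hW : ((k + 2 : ℕ) : ℝ≥0∞) ^ Fintype.card ι * (dyTotal μ c (upAt μ E l) (k + 2) (ν M) +
      dyTotal μ c (loAt μ E l) (k + 2) (ν M)) ≤ ENNReal.ofReal ((b ^ 2) ^ k * Tot.toReal) := by
    have hle : ENNReal.ofReal (((k : ℝ) + 2) ^ Fintype.card ι / (b ^ 2) ^ k) *
      (dyTotal μ c (upAt μ E l) (k + 2) (ν M) + dyTotal μ c (loAt μ E l) (k + 2) (ν M)) ≤ Tot := by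
      refine le_trans ?_ (ENNReal.le_tsum k)
      exact Finset.single_le_sum (f := fun l => ENNReal.ofReal (((k : ℝ) + 2) ^ Fintype.card ι /
        (b ^ 2) ^ k) * (dyTotal μ c (upAt μ E l) (k + 2) (ν M) +
          dyTotal μ c (loAt μ E l) (k + 2) (ν M))) (fun _ _ => zero_le)
        (Finset.mem_piAntidiag.2 ⟨hk.symm, fun _ _ => Finset.mem_univ _⟩)
    rw [ENNReal.ofReal_mul (by positivity), ENNReal.ofReal_toReal hT]
    refine le_trans (le_of_eq ?_) (mul_le_mul_right hle _)
    rw [← mul_assoc, ← ENNReal.ofReal_mul (by positivity), mul_div_cancel₀ _ (by positivity),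
      ENNReal.ofReal_pow (by positivity)]
    congr 2
    rw [← ENNReal.ofReal_natCast]
    push_cast
    rfl
  obtain ⟨r1, r2⟩ := abs_count_sub_le hE hm h1 hf hc (ν M) t l hl hl'
    (B := (b ^ 2) ^ k * Tot.toReal) (by positivity)
    ((mul_le_mul_right le_self_add _).trans hW) ((mul_le_mul_right le_add_self _).trans hW)
  refine ⟨r1, r2.trans ?_⟩
  set P := ∏ v, (μ v (E v (t v))).toReal with hP
  have hkP : (2 : ℝ) ^ k ≤ P := by
    rw [hk, ← Finset.prod_pow_eq_pow_sum]
    exact Finset.prod_le_prod (fun _ _ => by positivity) fun v _ => hl v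
  have hP1 : 1 ≤ P := le_trans (one_le_pow₀ (by norm_num)) hkP
  have hbk : b ^ k ≤ P ^ δ := by
    have : b ^ k = ((2 : ℝ) ^ k) ^ δ := by
      rw [hb, ← Real.rpow_natCast, ← Real.rpow_natCast, ← Real.rpow_mul (by norm_num),
        ← Real.rpow_mul (by norm_num), mul_comm]
    rw [this]
    exact Real.rpow_le_rpow (by positivity) hkP (by linarith)
  have hPδ : 1 ≤ P ^ δ := Real.one_le_rpow hP1 (by linarith)
  rw [← pow_mul, mul_comm 2 k, pow_mul, Real.sqrt_mul (by positivity), Real.sqrt_sq (by positivity)]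
  have e1 := mul_le_mul_of_nonneg_right hbk (Real.sqrt_nonneg Tot.toReal)
  have e2 := mul_le_mul_of_nonneg_left hPδ
    (show 0 ≤ c.toReal * 6 ^ Fintype.card ι by positivity)
  nlinarith

end Chaining

/-- The counting function `F` is `c` times the volume of the product of the sets `E v (t v)`, with an
error term of exponent `δ`. -/
def CountBound {ι : Type*} [Fintype ι] {X : ι → Type*} [∀ v, MeasureSpace (X v)]
    (E : ∀ v, ℝ → Set (X v)) (c : ℝ≥0∞) (δ : ℝ) (F : (ι → ℝ) → ℝ≥0∞) : Prop :=
  ∃ C : ℝ, 0 < C ∧ ∀ t : ι → ℝ, F t ≠ ∞ ∧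
    |(F t).toReal - c.toReal * ∏ v, (volume (E v (t v))).toReal| ≤
      C * (∏ v, (volume (E v (t v))).toReal) ^ δ

section Shell

variable {s : ℕ} {p : Fin s → ℕ} [∀ i, Fact (p i).Prime] [∀ i, MeasurableSpace ℚ_[p i]]
  [∀ i, BorelSpace ℚ_[p i]]

lemma ae_weight_countBound (hinj : Function.Injective p) {e : ℕ} {N : ZS p} (hN : N ≠ 0)
    {E : ∀ v, ℝ → Set (Fin (e + 3) → PF p v)} (hE : ∀ v, Monotone (E v))
    (hm : ∀ v t, MeasurableSet (E v t)) (h1 : ∀ v t, 1 ≤ volume (E v t))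
    (hf : ∀ v t, volume (E v t) ≠ ∞) {δ : ℝ} (hδ : 1 / 2 < δ)
    {φ : (Fin (e + 3) → Fin (e + 3) → ∀ v, PF p v) → ℝ≥0∞} (h : (latticeS hinj).IsWeight φ)
    (y : Fin (e + 3) → ZS p) :
    ∀ᵐ M, φ M ≠ 0 → CountBound E ((pmod (embS p N))⁻¹ ^ (e + 3)) δ
      fun t => (latticeS hinj).cnt N y (rect fun v => E v (t v)) M := by
  obtain ⟨K₀, hK, H⟩ := lintegral_sqd_rect_le hinj h
  let ν : (Fin (e + 3) → Fin (e + 3) → ∀ v, PF p v) → Measure (∀ v, Fin (e + 3) → PF p v) :=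
    fun M => Measure.sum fun w : cong N y =>
      Measure.dirac (swapPlaces ((latticeS hinj).Dv M (w : Fin (e + 3) → ZS p)))
  have hν : ∀ A : ∀ v, Set (Fin (e + 3) → PF p v), (∀ v, MeasurableSet (A v)) →
      ∀ M, ν M (Set.univ.pi A) = (latticeS hinj).cnt N y (rect A) M := fun A hA M => by
    have hA' : MeasurableSet (Set.univ.pi A) := MeasurableSet.univ_pi hA
    rw [Measure.sum_apply _ hA', LatticeRing.cnt]
    refine tsum_congr fun w => ?_
    rw [Measure.dirac_apply' _ hA']
    rfl
  have hu : IsUnit (embS p N) := isUnit_embS p hN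
  have hc : (pmod (embS p N))⁻¹ ^ (e + 3) ≠ ∞ :=
    ENNReal.pow_ne_top (ENNReal.inv_ne_top.2 (pmod_ne_zero hu))
  have := ae_abs_count_sub_le (μ := fun v => (volume : Measure (Fin (e + 3) → PF p v)))
    (ρ := volume) (ν := ν) hE hm h1 hf hc h.measurable (fun A hA => by
      simp_rw [hν A hA]
      exact (latticeS hinj).measurable_cnt N y (measurableSet_rect hA)) hK (fun A hA hAf => by
      simp_rw [hν A hA]
      rw [← volume_rect hA]
      exact H hN y hA hAf) hδ
  filter_upwards [this] with M hM hM0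
  obtain ⟨C, hC, hCt⟩ := hM hM0
  refine ⟨C, hC, fun t => ?_⟩
  simp only
  rw [← hν _ fun v => hm v (t v)]
  exact hCt t

lemma ae_shell_countBound (hinj : Function.Injective p) {e : ℕ} {N : ZS p} (hN : N ≠ 0)
    {E : ∀ v, ℝ → Set (Fin (e + 3) → PF p v)} (hE : ∀ v, Monotone (E v))
    (hm : ∀ v t, MeasurableSet (E v t)) (h1 : ∀ v t, 1 ≤ volume (E v t))
    (hf : ∀ v t, volume (E v t) ≠ ∞) {δ : ℝ} (hδ : 1 / 2 < δ) :
    ∀ᵐ M : Fin (e + 3) → Fin (e + 3) → ∀ v, PF p v, (Matrix.of M).det ∈ shellS p →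
      ∀ y, CountBound E ((pmod (embS p N))⁻¹ ^ (e + 3)) δ
        fun t => (latticeS hinj).cnt N y (rect fun v => E v (t v)) M := by
  obtain ⟨φ, h⟩ := (latticeS hinj).exists_isWeight (e + 2)
  have hall := (latticeS hinj).ae_act (ae_all_iff.2 fun y =>
    ae_weight_countBound hinj hN hE hm h1 hf hδ h y)
  filter_upwards [hall, h.ae_tsum] with M hM hs hdet y
  have hdet' : (Matrix.of M).det ∈ (latticeS hinj).shell := hdet
  rw [Set.indicator_of_mem hdet', Pi.one_apply] at hs
  obtain ⟨γ, hγ⟩ : ∃ γ : SpecialLinearGroup (Fin (e + 3)) (ZS p),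
      φ ((latticeS hinj).act (ent γ) M) ≠ 0 := by
    by_contra! hcon
    rw [ENNReal.tsum_eq_zero.2 hcon] at hs
    exact zero_ne_one hs
  have := hM γ ((rmulEquiv γ).symm y) hγ
  simp_rw [LatticeRing.cnt_act] at this
  have hy : rmul ((rmulEquiv γ).symm y) γ = y := (rmulEquiv γ).apply_symm_apply y
  rwa [hy] at this

end Shell

section LeftMul

variable {ι : Type*} [Fintype ι] {K : ι → Type*} [∀ v, NormedField (K v)]
  [∀ v, MeasureSpace (K v)] [∀ v, PlaceField (K v)]

lemma measurePreserving_matrix_mul {k : ℕ} {H : Fin k → Fin k → ∀ v, K v}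
    (hH : (Matrix.of H).det = 1) :
    MeasurePreserving fun M : Fin k → Fin k → ∀ v, K v => fun i j => ∑ l, H i l * M l j := by
  have hrow : MeasurePreserving fun x : Fin k → ∀ v, K v => fun i => ∑ l, H i l * x l := by
    have hmeas : Measurable fun x : Fin k → ∀ v, K v => fun i => ∑ l, H i l * x l := by
      refine measurable_pi_lambda _ fun i => Finset.measurable_sum _ fun l _ => ?_
      exact (measurable_const_mul (H i l)).comp (measurable_pi_apply l)
    refine ⟨hmeas, ?_⟩
    ext A hA
    have hT : (Matrix.of fun i j => H j i).det = 1 := by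
      rw [← hH, ← Matrix.det_transpose]
      rfl
    have := lintegral_vecMul_place (M := fun i j => H j i) (by rw [hT]; exact isUnit_one)
      (measurable_one.indicator hA : Measurable (A.indicator (1 : (Fin k → ∀ v, K v) → ℝ≥0∞)))
    rw [hT, lintegral_indicator_one hA] at this
    have h1 : pmod (1 : ∀ v, K v) = 1 := by simp [pmod]
    rw [h1, one_mul] at this
    rw [Measure.map_apply hmeas hA, ← this, ← lintegral_indicator_one (hmeas hA)]
    refine lintegral_congr fun x => ?_
    simp only [mul_comm (x _)]
    rfl
  exact measurePreserving_swapPlaces.comp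
    ((measurePreserving_pi _ _ fun _ => hrow).comp measurePreserving_swapPlaces)

end LeftMul

lemma unimod_mul {R : Type*} [CommRing R] {e : ℕ} {H : Fin (e + 1) → Fin (e + 1) → R}
    (hH : (Matrix.of H).det = 1) (M : Fin (e + 1) → Fin (e + 1) → R) :
    LatticeRing.unimod (fun i j => ∑ l, H i l * M l j) =
      fun i j => ∑ l, H i l * LatticeRing.unimod M l j := by
  have hdet : (Matrix.of fun i j => ∑ l, H i l * M l j).det = (Matrix.of M).det := by
    have : (Matrix.of fun i j => ∑ l, H i l * M l j) = Matrix.of H * Matrix.of M := by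
      ext i j; simp [Matrix.mul_apply]
    rw [this, Matrix.det_mul, hH, one_mul]
  funext i j
  refine Fin.cases ?_ (fun j => ?_) j
  · simp only [LatticeRing.unimod, LatticeRing.sc, Fin.cons_zero, hdet, Finset.mul_sum]
    exact Finset.sum_congr rfl fun l _ => by ring
  · simp only [LatticeRing.unimod, LatticeRing.sc, Fin.cons_succ, Fin.tail]

lemma unimod_of_det_eq_one {R : Type*} [CommRing R] {e : ℕ} {M : Fin (e + 1) → Fin (e + 1) → R}
    (hM : (Matrix.of M).det = 1) : LatticeRing.unimod M = M := by
  funext i j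
  refine Fin.cases ?_ (fun j => ?_) j
  · simp [LatticeRing.unimod, LatticeRing.sc, hM]
  · simp [LatticeRing.unimod, LatticeRing.sc, Fin.tail]

section Transfer

variable {s : ℕ} {p : Fin s → ℕ} [∀ i, Fact (p i).Prime] [∀ i, MeasurableSpace ℚ_[p i]]
  [∀ i, BorelSpace ℚ_[p i]]

lemma volume_det_mem_shellS_ne_zero (k : ℕ) :
    volume {M : Fin k → Fin k → ∀ v, PF p v | (Matrix.of M).det ∈ shellS p} ≠ 0 := by
  have hcont : Continuous fun M : Fin k → Fin k → ∀ v, PF p v => (Matrix.of M).det :=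
    Continuous.matrix_det continuous_id
  have hopen : IsOpen {M : Fin k → Fin k → ∀ v, PF p v |
      ∀ v, 1 / 2 < ‖(Matrix.of M).det v‖ ∧ ‖(Matrix.of M).det v‖ < 2} := by
    simp only [Set.ofPred_forall]
    refine isOpen_iInter_of_finite fun v => ?_
    have hv : Continuous fun M : Fin k → Fin k → ∀ v, PF p v => ‖(Matrix.of M).det v‖ :=
      ((continuous_apply v).comp hcont).norm
    exact (isOpen_lt continuous_const hv).inter (isOpen_lt hv continuous_const)
  have hne : (1 : Matrix (Fin k) (Fin k) (∀ v, PF p v)) ∈ {M : Fin k → Fin k → ∀ v, PF p v |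
      ∀ v, 1 / 2 < ‖(Matrix.of M).det v‖ ∧ ‖(Matrix.of M).det v‖ < 2} := by
    intro v
    have : (Matrix.of (1 : Matrix (Fin k) (Fin k) (∀ v, PF p v))).det = 1 := Matrix.det_one
    rw [this, Pi.one_apply, norm_one]
    norm_num
  have i1 : (volume : Measure (∀ v, PF p v)).IsAddHaarMeasure :=
    inferInstanceAs (Measure.pi fun v => (volume : Measure (PF p v))).IsAddHaarMeasure
  have i2 : (volume : Measure (Fin k → ∀ v, PF p v)).IsAddHaarMeasure :=
    inferInstanceAs (Measure.pi fun _ : Fin k =>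
      (volume : Measure (∀ v, PF p v))).IsAddHaarMeasure
  have i2s : SigmaFinite (volume : Measure (Fin k → ∀ v, PF p v)) :=
    inferInstanceAs (SigmaFinite (Measure.pi fun _ : Fin k => (volume : Measure (∀ v, PF p v))))
  have i3 : (volume : Measure (Fin k → Fin k → ∀ v, PF p v)).IsAddHaarMeasure :=
    inferInstanceAs (Measure.pi fun _ : Fin k =>
      (volume : Measure (Fin k → ∀ v, PF p v))).IsAddHaarMeasure
  intro h
  refine (hopen.measure_pos volume ⟨_, hne⟩).ne' (measure_mono_null (fun M hM => ?_) h)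
  exact fun v => ⟨(hM v).1.le, (hM v).2.le⟩

lemma ae_group_countBound (hinj : Function.Injective p) {e : ℕ} {N : ZS p} (hN : N ≠ 0)
    {E : ∀ v, ℝ → Set (Fin (e + 3) → PF p v)} (hE : ∀ v, Monotone (E v))
    (hm : ∀ v t, MeasurableSet (E v t)) (h1 : ∀ v t, 1 ≤ volume (E v t))
    (hf : ∀ v t, volume (E v t) ≠ ∞) {δ : ℝ} (hδ : 1 / 2 < δ)
    {G : Type*} [Group G] [MeasurableSpace G] [MeasurableMul G] {μ : Measure G} [SFinite μ]
    [μ.IsMulLeftInvariant] {θ : G → Fin (e + 3) → Fin (e + 3) → ∀ v, PF p v}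
    (hθ : Measurable θ) (hdet : ∀ g, (Matrix.of (θ g)).det = 1)
    (hmul : ∀ u g, θ (u * g) = fun i j => ∑ l, θ g i l * θ u l j)
    (hsurj : ∀ M, (Matrix.of M).det = 1 → ∃ u, θ u = M) :
    ∀ᵐ g ∂μ, ∀ y, CountBound E ((pmod (embS p N))⁻¹ ^ (e + 3)) δ
      fun t => (latticeS hinj).cnt N y (rect fun v => E v (t v)) (θ g) := by
  obtain ⟨B, hB, hBm, hB0⟩ := exists_measurable_superset_of_null (ae_iff.1
    (ae_shell_countBound hinj hN hE hm h1 hf hδ))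
  have hmeas : Measurable fun x : G × (Fin (e + 3) → Fin (e + 3) → ∀ v, PF p v) =>
      (fun i j => ∑ l, θ x.1 i l * x.2 l j : Fin (e + 3) → Fin (e + 3) → ∀ v, PF p v) := by
    refine measurable_pi_lambda _ fun i => measurable_pi_lambda _ fun j =>
      Finset.measurable_sum _ fun l _ => ?_
    have h1 : Measurable fun x : G × (Fin (e + 3) → Fin (e + 3) → ∀ v, PF p v) => θ x.1 i l :=
      (measurable_pi_apply l).comp ((measurable_pi_apply i).comp (hθ.comp measurable_fst))
    have h2 : Measurable fun x : G × (Fin (e + 3) → Fin (e + 3) → ∀ v, PF p v) => x.2 l j :=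
      (measurable_pi_apply j).comp ((measurable_pi_apply l).comp measurable_snd)
    exact h1.mul h2
  have hae : ∀ᵐ g ∂μ, ∀ᵐ M : Fin (e + 3) → Fin (e + 3) → ∀ v, PF p v,
      (fun i j => ∑ l, θ g i l * M l j) ∉ B := Filter.Eventually.of_forall fun g => by
    have := (measurePreserving_matrix_mul (hdet g)).measure_preimage hBm.nullMeasurableSet
    rw [ae_iff]
    simp only [not_not]
    rw [← hB0, ← this]
    rfl
  have i2 : SigmaFinite (volume : Measure (Fin (e + 3) → ∀ v, PF p v)) :=
    inferInstanceAs (SigmaFinite (Measure.pi fun _ : Fin (e + 3) =>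
      (volume : Measure (∀ v, PF p v))))
  have i3 : SigmaFinite (volume : Measure (Fin (e + 3) → Fin (e + 3) → ∀ v, PF p v)) :=
    inferInstanceAs (SigmaFinite (Measure.pi fun _ : Fin (e + 3) =>
      (volume : Measure (Fin (e + 3) → ∀ v, PF p v))))
  rw [Measure.ae_ae_comm (p := fun (g : G) (M : Fin (e + 3) → Fin (e + 3) → ∀ v, PF p v) =>
    (fun i j => ∑ l, θ g i l * M l j) ∉ B) (hmeas hBm.compl)] at hae
  obtain ⟨M, hM, hMg⟩ := Measure.exists_mem_of_measure_ne_zero_of_ae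
    (volume_det_mem_shellS_ne_zero (p := p) (e + 3)) (ae_restrict_of_ae hae)
  have hMu : IsUnit (Matrix.of M).det := (latticeS hinj).isUnit_of_mem_shell _ hM
  obtain ⟨u, hu⟩ := hsurj _ (LatticeRing.det_unimod hMu)
  rw [← eventually_mul_left_iff μ u]
  filter_upwards [hMg] with g hg y
  have hgood := by_contra fun hc => hg (hB hc)
  have hdetM : (Matrix.of fun i j => ∑ l, θ g i l * M l j).det = (Matrix.of M).det := by
    have : (Matrix.of fun i j => ∑ l, θ g i l * M l j) = Matrix.of (θ g) * Matrix.of M := by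
      ext i j; simp [Matrix.mul_apply]
    rw [this, Matrix.det_mul, hdet, one_mul]
  have := hgood (by rw [hdetM]; exact hM) y
  simp only [LatticeRing.cnt, LatticeRing.Dv_eq_comb] at this ⊢
  rwa [unimod_mul (hdet g), ← hu, ← hmul, ← unimod_of_det_eq_one (hdet (u * g))] at this

end Transfer

/-- The inclusion of the special linear group into the matrices. -/
def coeSL {K : Type*} [CommRing K] {d : ℕ} (g : SpecialLinearGroup (Fin d) K) :
    Matrix (Fin d) (Fin d) K := g.1

section SLTopology

variable {K : Type*} [NormedField K] [ProperSpace K] {d : ℕ}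
  [TopologicalSpace (SpecialLinearGroup (Fin d) K)]

lemma sigmaCompactSpace_SL (hi : Topology.IsInducing (coeSL (K := K) (d := d))) :
    SigmaCompactSpace (SpecialLinearGroup (Fin d) K) := by
  have hs : SigmaCompactSpace (Matrix (Fin d) (Fin d) K) :=
    inferInstanceAs (SigmaCompactSpace (Fin d → Fin d → K))
  refine Topology.IsClosedEmbedding.sigmaCompactSpace (e := coeSL (K := K) (d := d))
    ⟨⟨hi, Subtype.val_injective⟩, ?_⟩
  have : Set.range (coeSL (K := K) (d := d)) = {A | A.det = 1} := Subtype.range_coe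
  rw [this]
  exact isClosed_eq (Continuous.matrix_det continuous_id) continuous_const

lemma continuousMul_SL (hi : Topology.IsInducing (coeSL (K := K) (d := d))) :
    ContinuousMul (SpecialLinearGroup (Fin d) K) := by
  refine ⟨hi.continuous_iff.2 ?_⟩
  exact (hi.continuous.comp continuous_fst).matrix_mul (hi.continuous.comp continuous_snd)

lemma measurable_ent_SL [MeasurableSpace K] [BorelSpace K]
    [MeasurableSpace (SpecialLinearGroup (Fin d) K)] [BorelSpace (SpecialLinearGroup (Fin d) K)]
    (hi : Topology.IsInducing (coeSL (K := K) (d := d)))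
    (i j : Fin d) : Measurable fun g : SpecialLinearGroup (Fin d) K => ent g i j := by
  have : Continuous fun g : SpecialLinearGroup (Fin d) K => ent g i j :=
    hi.continuous.matrix_elem i j
  exact this.measurable

end SLTopology

section Glue

variable {s : ℕ} {p : Fin s → ℕ} [∀ i, Fact (p i).Prime]

/-- The element of `ℚ_S` with given components. -/
def glue (x : ℝ) (y : ∀ i, ℚ_[p i]) : ∀ v, PF p v
  | none => x
  | some i => y i

/-- The transpose of an element of `SL_d(ℚ_S)`, as a matrix over `ℚ_S`. -/
def transposeSL {d : ℕ} (g : SpecialLinearGroup (Fin d) ℝ × ∀ i, SpecialLinearGroup (Fin d) ℚ_[p i]) :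
    Fin d → Fin d → ∀ v, PF p v :=
  fun i j => glue (ent g.1 j i) fun k => ent (g.2 k) j i

variable {d : ℕ}

lemma det_transposeSL [∀ i, MeasurableSpace ℚ_[p i]] [∀ i, BorelSpace ℚ_[p i]]
    (g : SpecialLinearGroup (Fin d) ℝ × ∀ i, SpecialLinearGroup (Fin d) ℚ_[p i]) :
    (Matrix.of (transposeSL g)).det = 1 := by
  funext v
  rw [det_apply_place]
  cases v with
  | none =>
    refine (Matrix.det_transpose (g.1 : Matrix (Fin d) (Fin d) ℝ)).trans ?_
    exact g.1.2
  | some i =>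
    refine (Matrix.det_transpose (g.2 i : Matrix (Fin d) (Fin d) ℚ_[p i])).trans ?_
    exact (g.2 i).2

lemma transposeSL_mul
    (u g : SpecialLinearGroup (Fin d) ℝ × ∀ i, SpecialLinearGroup (Fin d) ℚ_[p i]) :
    transposeSL (u * g) = fun i j => ∑ l, transposeSL g i l * transposeSL u l j := by
  funext i j v
  rw [Finset.sum_apply]
  cases v with
  | none =>
    have : ent (u * g).1 j i = ∑ l, ent g.1 l i * ent u.1 j l := by
      rw [Prod.fst_mul, ent_mul]
      exact Finset.sum_congr rfl fun l _ => mul_comm _ _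
    exact this
  | some k =>
    have : ent ((u * g).2 k) j i = ∑ l, ent (g.2 k) l i * ent (u.2 k) j l := by
      rw [Prod.snd_mul, Pi.mul_apply, ent_mul]
      exact Finset.sum_congr rfl fun l _ => mul_comm _ _
    exact this

lemma exists_transposeSL_eq [∀ i, MeasurableSpace ℚ_[p i]] [∀ i, BorelSpace ℚ_[p i]]
    {M : Fin d → Fin d → ∀ v, PF p v} (hM : (Matrix.of M).det = 1) :
    ∃ u, transposeSL u = M := by
  have h : ∀ v, (Matrix.of fun i j => M i j v).det = 1 := fun v => by
    rw [← det_apply_place, hM, Pi.one_apply]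
  refine ⟨(⟨fun i j => rc (M j i), ?_⟩, fun k => ⟨fun i j => pc k (M j i), ?_⟩), ?_⟩
  · exact (Matrix.det_transpose _).symm.trans (h none)
  · exact (Matrix.det_transpose _).symm.trans (h (some k))
  · funext i j v
    cases v <;> rfl

lemma measurable_transposeSL [∀ i, MeasurableSpace ℚ_[p i]] [∀ i, BorelSpace ℚ_[p i]]
    [MeasurableSpace (SpecialLinearGroup (Fin d) ℝ)]
    [∀ i, MeasurableSpace (SpecialLinearGroup (Fin d) ℚ_[p i])]
    (hR : ∀ i j, Measurable fun g : SpecialLinearGroup (Fin d) ℝ => ent g i j)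
    (hP : ∀ k i j, Measurable fun g : SpecialLinearGroup (Fin d) ℚ_[p k] => ent g i j) :
    Measurable fun g : SpecialLinearGroup (Fin d) ℝ × ∀ i, SpecialLinearGroup (Fin d) ℚ_[p i] =>
      transposeSL g := by
  refine measurable_pi_lambda _ fun i => measurable_pi_lambda _ fun j =>
    measurable_pi_lambda _ fun v => ?_
  cases v with
  | none => exact (hR j i).comp measurable_fst
  | some k => exact (hP k j i).comp ((measurable_pi_apply k).comp measurable_snd)

end Glue

section Grid

variable {s : ℕ} {p : Fin s → ℕ} [∀ i, Fact (p i).Prime] [∀ i, MeasurableSpace ℚ_[p i]]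
  [∀ i, BorelSpace ℚ_[p i]]

lemma LatticeRing.cnt_eq_encard {Λ R : Type*} [CommRing Λ] [CommRing R] [MeasureSpace R]
    (D : LatticeRing Λ R) {e : ℕ} (N : Λ) (y : Fin (e + 1) → Λ) (A : Set (Fin (e + 1) → R))
    (M : Fin (e + 1) → Fin (e + 1) → R) :
    D.cnt N y A M = ({w | w ∈ cong N y ∧ D.Dv M w ∈ A}.encard : ℝ≥0∞) := by
  rw [LatticeRing.cnt, ← ENNReal.tsum_set_one,
    tsum_subtype {w | w ∈ cong N y ∧ D.Dv M w ∈ A} (fun _ => (1 : ℝ≥0∞)),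
    tsum_subtype (cong N y) (fun w => A.indicator (1 : (Fin (e + 1) → R) → ℝ≥0∞) (D.Dv M w))]
  refine tsum_congr fun w => ?_
  by_cases h1 : w ∈ cong N y
  · by_cases h2 : D.Dv M w ∈ A
    · have h : w ∈ {w | w ∈ cong N y ∧ D.Dv M w ∈ A} := ⟨h1, h2⟩
      rw [Set.indicator_of_mem h1, Set.indicator_of_mem h2, Set.indicator_of_mem h, Pi.one_apply]
    · have h : w ∉ {w | w ∈ cong N y ∧ D.Dv M w ∈ A} := fun h => h2 h.2
      rw [Set.indicator_of_mem h1, Set.indicator_of_notMem h2, Set.indicator_of_notMem h]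
  · have h : w ∉ {w | w ∈ cong N y ∧ D.Dv M w ∈ A} := fun h => h1 h.1
    rw [Set.indicator_of_notMem h1, Set.indicator_of_notMem h]

/-- The points `w` of a congruence class of `ℤ_S^d` for which `g w` lies in the product of the
sets `A v`. -/
def gridSet {d : ℕ} (N : ℕ) (vd : Fin d → ℚ)
    (g : SpecialLinearGroup (Fin d) ℝ × ∀ i, SpecialLinearGroup (Fin d) ℚ_[p i])
    (A : ∀ v, Set (Fin d → PF p v)) : Set (Fin d → ℚ) :=
  {w | (∀ j, IsZS (∏ i, p i) ((w j - vd j) / N)) ∧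
    (fun j => ∑ l, ent g.1 j l * (w l : ℝ) : Fin d → ℝ) ∈ A none ∧
    ∀ i, (fun j => ∑ l, ent (g.2 i) j l * (w l : ℚ_[p i]) : Fin d → ℚ_[p i]) ∈ A (some i)}

lemma Dv_transposeSL_mem_rect (hinj : Function.Injective p) {e : ℕ}
    (g : SpecialLinearGroup (Fin (e + 1)) ℝ × ∀ i, SpecialLinearGroup (Fin (e + 1)) ℚ_[p i])
    (A : ∀ v, Set (Fin (e + 1) → PF p v)) (w : Fin (e + 1) → ZS p) :
    (latticeS hinj).Dv (transposeSL g) w ∈ rect A ↔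
      (fun j => ∑ l, ent g.1 j l * ((w l : ℚ) : ℝ) : Fin (e + 1) → ℝ) ∈ A none ∧
      ∀ i, (fun j => ∑ l, ent (g.2 i) j l * ((w l : ℚ) : ℚ_[p i]) : Fin (e + 1) → ℚ_[p i]) ∈
        A (some i) := by
  rw [LatticeRing.Dv_eq_comb, unimod_of_det_eq_one (det_transposeSL g), mem_rect, Option.forall]
  have hv : ∀ v, (fun j => (latticeS hinj).comb w (transposeSL g) j v) =
      fun j => ∑ l, transposeSL g l j v * embS p (w l) v := fun v => by
    funext j
    rw [LatticeRing.comb, Finset.sum_apply]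
    exact Finset.sum_congr rfl fun l _ => mul_comm _ _
  simp_rw [hv]
  exact Iff.rfl

lemma natCast_ZS_ne_zero {N : ℕ} (hN : 0 < N) : (N : ZS p) ≠ 0 := by
  intro h
  have : ((N : ZS p) : ℚ) = 0 := by rw [h]; rfl
  rw [Subring.coe_natCast] at this
  exact hN.ne' (by exact_mod_cast this)

lemma natCast_dvd_ZS_iff {N : ℕ} (hN : 0 < N) (x : ZS p) :
    (N : ZS p) ∣ x ↔ IsZS (∏ i, p i) ((x : ℚ) / N) := by
  have hN' : (N : ℚ) ≠ 0 := by exact_mod_cast hN.ne'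
  constructor
  · rintro ⟨z, rfl⟩
    have : (((N : ZS p) * z : ZS p) : ℚ) / N = z := by
      rw [Subring.coe_mul, Subring.coe_natCast]
      field_simp
    rw [this]
    exact z.2
  · intro h
    refine ⟨⟨_, h⟩, Subtype.ext ?_⟩
    rw [Subring.coe_mul, Subring.coe_natCast]
    field_simp

lemma image_cong_eq_gridSet_diff (hinj : Function.Injective p) {e N : ℕ} (hN : 0 < N)
    (y : Fin (e + 1) → ZS p)
    (g : SpecialLinearGroup (Fin (e + 1)) ℝ × ∀ i, SpecialLinearGroup (Fin (e + 1)) ℚ_[p i])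
    (A : ∀ v, Set (Fin (e + 1) → PF p v)) :
    (fun (w : Fin (e + 1) → ZS p) j => (w j : ℚ)) '' {w | w ∈ cong (N : ZS p) y ∧
      (latticeS hinj).Dv (transposeSL g) w ∈ rect A} =
      gridSet N (fun j => (y j : ℚ)) g A \ {0} := by
  ext w
  constructor
  · rintro ⟨w, ⟨⟨h0, hc⟩, hw⟩, rfl⟩
    rw [Dv_transposeSL_mem_rect] at hw
    refine ⟨⟨fun j => ?_, hw⟩, fun h => h0 ?_⟩
    · have := (natCast_dvd_ZS_iff hN _).1 (hc j)
      rwa [AddSubgroupClass.coe_sub] at this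
    · funext j
      exact Subtype.ext (congrFun h j)
  · rintro ⟨⟨hz, hw⟩, h0⟩
    have hN' : (N : ℚ) ≠ 0 := by exact_mod_cast hN.ne'
    have hmem : ∀ j, w j ∈ ZS p := fun j => by
      have h1 : w j = N * ((w j - y j) / N) + y j := by field_simp; ring
      rw [h1]
      exact add_mem (mul_mem (natCast_mem _ N) (hz j)) (y j).2
    refine ⟨fun j => ⟨w j, hmem j⟩, ⟨⟨fun h => h0 ?_, fun j => ?_⟩, ?_⟩, rfl⟩
    · funext j
      exact congrArg Subtype.val (congrFun h j)
    · rw [natCast_dvd_ZS_iff hN, AddSubgroupClass.coe_sub]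
      exact hz j
    · rw [Dv_transposeSL_mem_rect]
      exact hw

lemma abs_ncard_gridSet_sub_cnt_le (hinj : Function.Injective p) {e N : ℕ} (hN : 0 < N)
    (y : Fin (e + 1) → ZS p)
    (g : SpecialLinearGroup (Fin (e + 1)) ℝ × ∀ i, SpecialLinearGroup (Fin (e + 1)) ℚ_[p i])
    (A : ∀ v, Set (Fin (e + 1) → PF p v))
    (hfin : (latticeS hinj).cnt (N : ZS p) y (rect A) (transposeSL g) ≠ ∞) :
    |((gridSet N (fun j => (y j : ℚ)) g A).ncard : ℝ) -
      ((latticeS hinj).cnt (N : ZS p) y (rect A) (transposeSL g)).toReal| ≤ 1 := by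
  rw [LatticeRing.cnt_eq_encard] at hfin ⊢
  have hS := image_cong_eq_gridSet_diff hinj hN y g A
  set S' := {w | w ∈ cong (N : ZS p) y ∧ (latticeS hinj).Dv (transposeSL g) w ∈ rect A}
  set S := gridSet N (fun j => (y j : ℚ)) g A
  have hf : S'.Finite := by
    rw [← Set.encard_ne_top_iff]
    intro h
    rw [h] at hfin
    exact hfin rfl
  have hi : Function.Injective fun (w : Fin (e + 1) → ZS p) j => (w j : ℚ) := fun w w' h => by
    funext j
    exact Subtype.ext (congrFun h j)
  have h1 : ((S'.encard : ℝ≥0∞)).toReal = (S \ {0}).ncard := by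
    rw [← hS, Set.ncard_image_of_injective _ hi, ← hf.cast_ncard_eq]
    simp
  rw [h1]
  have h2 := Set.pred_ncard_le_ncard_sdiff_singleton S 0
  have h3 := Set.ncard_sdiff_singleton_le S 0
  rw [abs_le]
  constructor
  · have : ((S \ {0}).ncard : ℝ) ≤ S.ncard := by exact_mod_cast h3
    linarith
  · have : (S.ncard : ℝ) ≤ (S \ {0}).ncard + 1 := by exact_mod_cast (by omega)
    linarith

/-- The counting estimate for almost every element of `SL_d(ℚ_S)` and products of monotone
families of sets. -/
theorem ae_abs_ncard_gridSet_sub_le {d : ℕ} (hd : 3 ≤ d) (hinj : Function.Injective p) {N : ℕ}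
    (hN : 0 < N) (hNS : N.Coprime (∏ i, p i)) {vd : Fin d → ℚ}
    (hvd : ∀ j, IsZS (∏ i, p i) (vd j))
    {E : ∀ v, ℝ → Set (Fin d → PF p v)} (hE : ∀ v, Monotone (E v))
    (hm : ∀ v t, MeasurableSet (E v t)) (h1 : ∀ v t, 1 ≤ volume (E v t))
    (hf : ∀ v t, volume (E v t) ≠ ∞) {δ : ℝ} (hδ : 1 / 2 < δ)
    [TopologicalSpace (SpecialLinearGroup (Fin d) ℝ)]
    (hR : Topology.IsInducing (coeSL (K := ℝ) (d := d)))
    [∀ i, TopologicalSpace (SpecialLinearGroup (Fin d) ℚ_[p i])]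
    (hP : ∀ i, Topology.IsInducing (coeSL (K := ℚ_[p i]) (d := d)))
    [MeasurableSpace (SpecialLinearGroup (Fin d) ℝ)] [BorelSpace (SpecialLinearGroup (Fin d) ℝ)]
    [∀ i, MeasurableSpace (SpecialLinearGroup (Fin d) ℚ_[p i])]
    [∀ i, BorelSpace (SpecialLinearGroup (Fin d) ℚ_[p i])]
    (μG : Measure (SpecialLinearGroup (Fin d) ℝ × ∀ i, SpecialLinearGroup (Fin d) ℚ_[p i]))
    [μG.IsHaarMeasure] :
    ∀ᵐ g ∂μG, ∃ C : ℝ, 0 < C ∧ ∀ t : Option (Fin s) → ℝ,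
      |((gridSet N vd g fun v => E v (t v)).ncard : ℝ) -
        (∏ v, (volume (E v (t v))).toReal) / (N : ℝ) ^ d| ≤
      C * (∏ v, (volume (E v (t v))).toReal) ^ δ := by
  obtain ⟨e, rfl⟩ : ∃ e, d = e + 3 := ⟨d - 3, by omega⟩
  have cR := continuousMul_SL hR
  have cP := fun i => continuousMul_SL (hP i)
  have sR := sigmaCompactSpace_SL hR
  have sP := fun i => sigmaCompactSpace_SL (hP i)
  have hsf : SigmaFinite μG := inferInstance
  have mG : MeasurableMul
      (SpecialLinearGroup (Fin (e + 3)) ℝ × ∀ i, SpecialLinearGroup (Fin (e + 3)) ℚ_[p i]) := by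
    refine ⟨fun c => ?_, fun c => ?_⟩
    · exact ((measurable_const_mul c.1).comp measurable_fst).prodMk (measurable_pi_lambda _ fun i =>
        (measurable_const_mul (c.2 i)).comp ((measurable_pi_apply i).comp measurable_snd))
    · exact ((measurable_mul_const c.1).comp measurable_fst).prodMk (measurable_pi_lambda _ fun i =>
        (measurable_mul_const (c.2 i)).comp ((measurable_pi_apply i).comp measurable_snd))
  have hae := ae_group_countBound hinj (natCast_ZS_ne_zero hN) hE hm h1 hf hδ (μ := μG)
    (measurable_transposeSL (measurable_ent_SL hR) fun k => measurable_ent_SL (hP k))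
    det_transposeSL transposeSL_mul (fun M hM => exists_transposeSL_eq hM)
  filter_upwards [hae] with g hg
  obtain ⟨C, hC, hCt⟩ := hg fun j => ⟨vd j, hvd j⟩
  refine ⟨C + 1, by positivity, fun t => ?_⟩
  obtain ⟨hfin, hle⟩ := hCt t
  have h2 := abs_ncard_gridSet_sub_cnt_le hinj hN (fun j => ⟨vd j, hvd j⟩) g
    (fun v => E v (t v)) hfin
  have hc : ((pmod (embS p (N : ZS p)))⁻¹ ^ (e + 3)).toReal = ((N : ℝ) ^ (e + 3))⁻¹ := by
    rw [pmod_embS_natCast hN hNS, ENNReal.toReal_pow, ENNReal.toReal_inv, ENNReal.toReal_natCast,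
      inv_pow]
  rw [hc] at hle
  have hV : 1 ≤ ∏ v, (volume (E v (t v))).toReal := by
    refine Finset.one_le_prod fun v _ => ?_
    rw [← ENNReal.toReal_one]
    exact ENNReal.toReal_mono (hf v _) (h1 v _)
  have hVδ : 1 ≤ (∏ v, (volume (E v (t v))).toReal) ^ δ :=
    Real.one_le_rpow hV (by linarith)
  rw [div_eq_inv_mul, add_mul, one_mul]
  have := abs_sub_le ((gridSet N vd g fun v => E v (t v)).ncard : ℝ)
    ((latticeS hinj).cnt (N : ZS p) (fun j => ⟨vd j, hvd j⟩) (rect fun v => E v (t v))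
      (transposeSL g)).toReal (((N : ℝ) ^ (e + 3))⁻¹ * ∏ v, (volume (E v (t v))).toReal)
  have h3 : |((gridSet N vd g fun v => E v (t v)).ncard : ℝ) -
    ((latticeS hinj).cnt (N : ZS p) (fun j => ⟨vd j, hvd j⟩) (rect fun v => E v (t v))
      (transposeSL g)).toReal| ≤ 1 := h2
  linarith

end Grid

section LocalRegion

variable {K : Type*} [NormedField K] {m n : ℕ} {f : ℝ → ℝ}

/-- The component at one place of the region `E_f(T)`, with `T` truncated below at one. -/
def localRegion (K : Type*) [NormedField K] (m n : ℕ) (f : ℝ → ℝ) (t : ℝ) :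
    Set (Fin (m + n) → K) :=
  {x | ‖fun a : Fin m => x (Fin.castAdd n a)‖ ^ m ≤ f (‖fun b : Fin n => x (Fin.natAdd m b)‖ ^ n) ∧
    ‖fun b : Fin n => x (Fin.natAdd m b)‖ ^ n ≤ max t 1}

lemma monotone_localRegion : Monotone (localRegion K m n f) := fun _ _ h _ hx =>
  ⟨hx.1, hx.2.trans (max_le_max_right 1 h)⟩

lemma measurableSet_localRegion [MeasurableSpace K] [BorelSpace K] [SecondCountableTopology K]
    (hf : Measurable f) (t : ℝ) : MeasurableSet (localRegion K m n f t) := by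
  have h1 : Measurable fun x : Fin (m + n) → K => ‖fun a : Fin m => x (Fin.castAdd n a)‖ :=
    (measurable_pi_lambda _ fun a => measurable_pi_apply _).norm
  have h2 : Measurable fun x : Fin (m + n) → K => ‖fun b : Fin n => x (Fin.natAdd m b)‖ :=
    (measurable_pi_lambda _ fun a => measurable_pi_apply _).norm
  exact (measurableSet_le (h1.pow_const m) (hf.comp (h2.pow_const n))).inter
    (measurableSet_le (h2.pow_const n) measurable_const)

lemma closedBall_subset_localRegion (hf : ∀ t ≤ 1, f t = 1) (t : ℝ) :
    Metric.closedBall 0 1 ⊆ localRegion K m n f t := by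
  intro x hx
  rw [mem_closedBall_zero_iff, pi_norm_le_iff_of_nonneg zero_le_one] at hx
  have h1 : ‖fun a : Fin m => x (Fin.castAdd n a)‖ ^ m ≤ 1 := pow_le_one₀ (norm_nonneg _)
    ((pi_norm_le_iff_of_nonneg zero_le_one).2 fun a => hx _)
  have h2 : ‖fun b : Fin n => x (Fin.natAdd m b)‖ ^ n ≤ 1 := pow_le_one₀ (norm_nonneg _)
    ((pi_norm_le_iff_of_nonneg zero_le_one).2 fun a => hx _)
  exact ⟨by rw [hf _ h2]; exact h1, h2.trans (le_max_right _ _)⟩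

lemma localRegion_subset_closedBall (hm : m ≠ 0) (hn : n ≠ 0) (hf : ∀ t, f t ≤ 1) (t : ℝ) :
    localRegion K m n f t ⊆ Metric.closedBall 0 (max t 1) := by
  rintro x ⟨h1, h2⟩
  have hb : ∀ (r T : ℝ) (k : ℕ), k ≠ 0 → 1 ≤ T → r ^ k ≤ T → r ≤ T := fun r T k hk hT h => by
    by_contra! hc
    have := le_self_pow₀ (hT.trans hc.le) hk
    linarith
  have hT := le_max_right t 1
  have h1' := hb _ _ m hm hT ((h1.trans (hf _)).trans hT)
  have h2' := hb _ _ n hn hT h2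
  rw [mem_closedBall_zero_iff, pi_norm_le_iff_of_nonneg (zero_le_one.trans hT)]
  rw [pi_norm_le_iff_of_nonneg (zero_le_one.trans hT)] at h1' h2'
  exact fun j => Fin.addCases h1' h2' j

end LocalRegion

lemma antitone_of_eq_one {f : ℝ → ℝ} (h1 : ∀ ⦃t : ℝ⦄, t ≤ 1 → f t = 1)
    (hf : ∀ ⦃t₁ t₂ : ℝ⦄, 0 < t₁ → t₁ ≤ t₂ → f t₂ ≤ f t₁) : Antitone f := by
  intro a b hab
  rcases le_or_gt a 1 with ha | ha
  · rcases le_or_gt b 1 with hb | hb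
    · rw [h1 ha, h1 hb]
    · rw [h1 ha, ← h1 le_rfl]
      exact hf one_pos hb.le
  · exact hf (by linarith) hab

section Regions

variable {s : ℕ} {p : Fin s → ℕ} [∀ i, Fact (p i).Prime]
  [∀ i, MeasurableSpace ℚ_[p i]] [∀ i, BorelSpace ℚ_[p i]]

lemma one_le_volume_closedBall (d : ℕ) (v : Option (Fin s)) :
    1 ≤ volume (Metric.closedBall (0 : Fin d → PF p v) 1) := by
  rw [closedBall_pi _ zero_le_one]
  refine le_of_le_of_eq ?_ (volume_pi_pi fun _ : Fin d => Metric.closedBall (0 : PF p v) 1).symm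
  refine Finset.one_le_prod fun j _ => ?_
  cases v with
  | none =>
    have : volume (Metric.closedBall (0 : ℝ) 1) = ENNReal.ofReal (2 * 1) := Real.volume_closedBall 0 1
    refine le_of_le_of_eq ?_ this.symm
    norm_num
  | some i => exact (padicHaar_unitBall (p := p i)).ge

lemma eq_pi_padicHaar {q : ℕ} [Fact q.Prime] [MeasurableSpace ℚ_[q]] [BorelSpace ℚ_[q]] {d : ℕ}
    {μ : Measure (Fin d → ℚ_[q])} [μ.IsAddHaarMeasure] (hμ : μ {y | ∀ j, ‖y j‖ ≤ 1} = 1) :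
    μ = Measure.pi fun _ => padicHaar q := by
  have h := Measure.isAddLeftInvariant_eq_smul μ (Measure.pi fun _ => padicHaar q)
  have hbox : {y : Fin d → ℚ_[q] | ∀ j, ‖y j‖ ≤ 1} =
      Set.univ.pi fun _ => Metric.closedBall (0 : ℚ_[q]) 1 := by
    ext y; simp
  have h1 : (Measure.pi fun _ : Fin d => padicHaar q) {y | ∀ j, ‖y j‖ ≤ 1} = 1 := by
    rw [hbox, Measure.pi_pi]
    simp [padicHaar_unitBall]
  rw [h, Measure.smul_apply, h1] at hμ
  have hc : (Measure.addHaarScalarFactor μ (Measure.pi fun _ => padicHaar q)) = 1 := by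
    rw [ENNReal.smul_def, smul_eq_mul, mul_one] at hμ
    exact_mod_cast hμ
  rw [h, hc, one_smul]

lemma one_le_volume_localRegion {m n : ℕ} {f : ℝ → ℝ} (hf : ∀ t ≤ 1, f t = 1)
    (v : Option (Fin s)) (t : ℝ) : 1 ≤ volume (localRegion (PF p v) m n f t) :=
  (one_le_volume_closedBall _ v).trans (measure_mono (closedBall_subset_localRegion hf t))

lemma volume_localRegion_ne_top {m n : ℕ} {f : ℝ → ℝ} (hm : m ≠ 0) (hn : n ≠ 0)
    (hf : ∀ t, f t ≤ 1) (v : Option (Fin s)) (t : ℝ) :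
    volume (localRegion (PF p v) m n f t) ≠ ∞ := by
  have : (volume : Measure (Fin (m + n) → PF p v)).IsAddHaarMeasure :=
    inferInstanceAs (Measure.pi fun _ => (volume : Measure (PF p v))).IsAddHaarMeasure
  exact ((measure_mono (localRegion_subset_closedBall hm hn hf t)).trans_lt
    (isCompact_closedBall _ _).measure_lt_top).ne

end Regions

end Auxiliary

/-- **S-arithmetic analogue of Schmidt's counting theorem, second assertion.**
For almost every `g ∈ SL_d(ℚ_S)` (`d = m + n ≥ 3`) there are `C > 0` and `T_0` such
that `|#(g(Nℤ_S^d + v_d) ∩ E_ψ(T)) − vol(E_ψ(T))/N^d| ≤ C·vol(E_ψ(T))^δ` for all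
`T ⪰ T_0`. -/
theorem s_arithmetic_schmidt_counting_second
    (m n : ℕ) (hm : 0 < m) (hn : 0 < n) (hd : 3 ≤ m + n)
    (s : ℕ) (p : Fin s → ℕ) [∀ i, Fact (p i).Prime] (hpinj : Function.Injective p)
    [∀ i, MeasurableSpace ℚ_[p i]] [∀ i, BorelSpace ℚ_[p i]]
    (ψ : ApproxFamily m n s p)
    (N : ℕ) (hN : 0 < N) (hNS : Nat.Coprime N (∏ i, p i))
    (vd : Fin (m + n) → ℚ) (hvd : ∀ j, IsZS (∏ i, p i) (vd j))
    (δ : ℝ) (hδ₁ : 2 / 3 < δ) (hδ₂ : δ < 1)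
    -- Haar measure on `ℚ_S^d`, normalized so that `ℤ_p^d` has measure one at each
    -- finite place:
    (μd : ∀ i, Measure (Fin (m + n) → ℚ_[p i])) [∀ i, (μd i).IsAddHaarMeasure]
    (hμd : ∀ i, μd i {y | ∀ j, ‖y j‖ ≤ 1} = 1)
    -- the topological group `SL_d(ℚ_S)`, with its Borel structure and a Haar
    -- measure on it:
    [tSLR : TopologicalSpace (SpecialLinearGroup (Fin (m + n)) ℝ)]
    (htSLR : tSLR = TopologicalSpace.induced
      ((↑) : SpecialLinearGroup (Fin (m + n)) ℝ → Matrix (Fin (m + n)) (Fin (m + n)) ℝ)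
      inferInstance)
    [tSLP : ∀ i, TopologicalSpace (SpecialLinearGroup (Fin (m + n)) ℚ_[p i])]
    (htSLP : ∀ i, tSLP i = TopologicalSpace.induced
      ((↑) : SpecialLinearGroup (Fin (m + n)) ℚ_[p i] →
        Matrix (Fin (m + n)) (Fin (m + n)) ℚ_[p i])
      inferInstance)
    [mSLR : MeasurableSpace (SpecialLinearGroup (Fin (m + n)) ℝ)]
    (hmSLR : mSLR = borel _)
    [mSLP : ∀ i, MeasurableSpace (SpecialLinearGroup (Fin (m + n)) ℚ_[p i])]
    (hmSLP : ∀ i, mSLP i = borel _)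
    (μG : Measure ((SpecialLinearGroup (Fin (m + n)) ℝ) ×
      ∀ i, SpecialLinearGroup (Fin (m + n)) ℚ_[p i]))
    [μG.IsHaarMeasure] :
    ∀ᵐ g ∂μG, ∃ C : ℝ, 0 < C ∧ ∃ (T0R : ℝ) (T0P : Fin s → ℝ),
      ∀ (TR : ℝ) (TP : Fin s → ℝ), 0 ≤ TR → (∀ i, ∃ k : ℤ, TP i = (p i : ℝ) ^ k) →
        T0R ≤ TR → (∀ i, T0P i ≤ TP i) →
        |(gridCount m n p g
              {w : Fin (m + n) → ℚ | ∀ j, IsZS (∏ i, p i) ((w j - vd j) / N)}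
              (Efull m n p ψ.psiR ψ.psiP TR TP) : ℝ)
          - (((volume : Measure (Fin (m + n) → ℝ)).prod (Measure.pi μd))
              (Efull m n p ψ.psiR ψ.psiP TR TP)).toReal / (N : ℝ) ^ (m + n)|
        ≤ C * (((volume : Measure (Fin (m + n) → ℝ)).prod (Measure.pi μd))
              (Efull m n p ψ.psiR ψ.psiP TR TP)).toReal ^ δ := by
  classical
  let psi : Option (Fin s) → ℝ → ℝ := fun v => v.elim ψ.psiR ψ.psiP
  have hone : ∀ v, ∀ t ≤ 1, psi v t = 1 := fun v t ht => by
    cases v with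
    | none => exact ψ.oneR ht
    | some i => exact ψ.oneP i ht
  have hanti : ∀ v, Antitone (psi v) := fun v => by
    cases v with
    | none => exact antitone_of_eq_one ψ.oneR ψ.antiR
    | some i => exact antitone_of_eq_one (ψ.oneP i) (ψ.antiP i)
  have hle : ∀ v t, psi v t ≤ 1 := fun v t => by
    rcases le_or_gt t 1 with ht | ht
    · exact (hone v t ht).le
    · exact (hanti v ht.le).trans (hone v 1 le_rfl).le
  let E : ∀ v, ℝ → Set (Fin (m + n) → PF p v) := fun v => localRegion (PF p v) m n (psi v)
  have hEm : ∀ v t, MeasurableSet (E v t) := fun v =>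
    measurableSet_localRegion (hanti v).measurable
  have hbR : BorelSpace (SpecialLinearGroup (Fin (m + n)) ℝ) := ⟨hmSLR⟩
  have hbP : ∀ i, BorelSpace (SpecialLinearGroup (Fin (m + n)) ℚ_[p i]) := fun i => ⟨hmSLP i⟩
  have hae := ae_abs_ncard_gridSet_sub_le hd hpinj hN hNS hvd
    (fun v => monotone_localRegion (K := PF p v) (f := psi v)) hEm
    (fun v => one_le_volume_localRegion (hone v) v)
    (fun v => volume_localRegion_ne_top hm.ne' hn.ne' (hle v) v)
    (show 1 / 2 < δ by linarith) ⟨htSLR⟩ (fun i => ⟨htSLP i⟩) μG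
  filter_upwards [hae] with g hg
  obtain ⟨C, hC, hCt⟩ := hg
  refine ⟨C, hC, 1, fun _ => 1, fun TR TP _ _ hTR hTP => ?_⟩
  let t : Option (Fin s) → ℝ := fun v => v.elim TR TP
  have hfull : Efull m n p ψ.psiR ψ.psiP TR TP = localRegion ℝ m n ψ.psiR TR ×ˢ
      Set.univ.pi fun i => localRegion ℚ_[p i] m n (ψ.psiP i) (TP i) := by
    ext v
    rw [Set.mem_prod, Set.mem_univ_pi]
    simp only [localRegion, max_eq_left hTR, fun i => max_eq_left (hTP i)]
    exact and_assoc.symm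
  have hcount : gridCount m n p g {w | ∀ j, IsZS (∏ i, p i) ((w j - vd j) / N)}
      (Efull m n p ψ.psiR ψ.psiP TR TP) = (gridSet N vd g fun v => E v (t v)).ncard := by
    rw [hfull]
    refine congrArg Set.ncard (Set.ext fun w => and_congr_right fun _ => ?_)
    rw [Set.mem_prod, Set.mem_univ_pi]
    exact Iff.rfl
  have hvol : (((volume : Measure (Fin (m + n) → ℝ)).prod (Measure.pi μd))
      (Efull m n p ψ.psiR ψ.psiP TR TP)).toReal = ∏ v, (volume (E v (t v))).toReal := by
    rw [hfull, Measure.prod_prod, Measure.pi_pi, ENNReal.toReal_mul, ENNReal.toReal_prod,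
      Fintype.prod_option]
    congr 1
    refine Finset.prod_congr rfl fun i _ => ?_
    rw [eq_pi_padicHaar (hμd i)]
    rfl
  rw [hcount, hvol]
  exact hCt t

end
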